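/- Suppose aₙ → ∞ and set tₙ := m⁻¹(aₙ). If ψ(tₙ)²/(√n·ψ′(tₙ)) → 0 as n → ∞, then P(Sₙ ≥ n·aₙ) = (exp(−n·I(aₙ))/(√(2π)·√n·tₙ·s(tₙ)))·(1 + o(1/√n)) as n → ∞, where P(Sₙ ≥ n·aₙ) = ∫_{n·aₙ}^∞ p^{*n}(v) dv. -/

import Mathlib

open Real Filter Topology MeasureTheory Set

noncomputable section

/-- A representation of a function `l` in class `R₀`:
`l x = exp (∫_1^x ε u / u du)` for `x ≥ 1`, where `ε` is twice differentiable
(with first and second derivatives `ε'`, `ε''`) and `ε x → 0` as `x → ∞`. -/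
def IsR0Rep (l ε ε' ε'' : ℝ → ℝ) : Prop :=
  (∀ x, HasDerivAt ε (ε' x) x) ∧ (∀ x, HasDerivAt ε' (ε'' x) x) ∧
    Tendsto ε atTop (𝓝 0) ∧
    ∀ x ≥ (1 : ℝ), l x = Real.exp (∫ u in (1:ℝ)..x, ε u / u)

/-- The generalized inverse `ψ u = inf {x | h x ≥ u}` of `h`. -/
def geninv (h : ℝ → ℝ) (u : ℝ) : ℝ := sInf {x : ℝ | u ≤ h x}

/-- Class `R_β` (`β > 0`): `h x = x ^ β * l x` for large `x`, with `l ∈ R₀` whose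
representing `ε` satisfies `limsup x * |ε' x| < ∞` and `limsup x ^ 2 * |ε'' x| < ∞`. -/
def MemRbeta (h : ℝ → ℝ) (β : ℝ) : Prop :=
  0 < β ∧ ∃ l ε ε' ε'' : ℝ → ℝ, IsR0Rep l ε ε' ε'' ∧
    (∀ᶠ x in atTop, h x = x ^ β * l x) ∧
    (∃ C : ℝ, ∀ᶠ x in atTop, x * |ε' x| ≤ C) ∧
    (∃ C : ℝ, ∀ᶠ x in atTop, x ^ (2 : ℕ) * |ε'' x| ≤ C)

/-- Class `R_∞`: `h` is increasing and strictly monotone and its generalized inverse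
`ψ` satisfies `ψ x = exp (∫_1^x ε u / u du)` with `ψ x → ∞`, `x ε' x / ε x → 0`,
`x ^ 2 ε'' x / ε x → 0` and `liminf x ^ η * ε x > 0` for some `η ∈ (0, 1/4)`. -/
def MemRinfty (h : ℝ → ℝ) : Prop :=
  StrictMonoOn h (Set.Ici 0) ∧
  ∃ ε ε' ε'' : ℝ → ℝ,
    (∀ x, HasDerivAt ε (ε' x) x) ∧ (∀ x, HasDerivAt ε' (ε'' x) x) ∧
    (∀ x ≥ (1 : ℝ), geninv h x = Real.exp (∫ u in (1:ℝ)..x, ε u / u)) ∧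
    Tendsto (geninv h) atTop atTop ∧
    Tendsto (fun x => x * ε' x / ε x) atTop (𝓝 0) ∧
    Tendsto (fun x => x ^ (2 : ℕ) * ε'' x / ε x) atTop (𝓝 0) ∧
    ∃ η : ℝ, η ∈ Set.Ioo (0 : ℝ) (1/4) ∧ ∃ c > (0 : ℝ), ∀ᶠ x in atTop, c ≤ x ^ η * ε x

/-- The class `𝔯 = R_β ∪ R_∞`. -/
def MemFrakR (h : ℝ → ℝ) : Prop := (∃ β : ℝ, MemRbeta h β) ∨ MemRinfty h

/-- The moment generating function `Φ t = ∫_0^∞ e^{t x} p x dx`. -/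
def mgfFun (p : ℝ → ℝ) (t : ℝ) : ℝ := ∫ x in Set.Ici (0:ℝ), Real.exp (t * x) * p x

/-- `m = (log Φ)'`, the mean of the tilted density. -/
def mFun (p : ℝ → ℝ) : ℝ → ℝ := deriv fun t => Real.log (mgfFun p t)

/-- `s² = m'`, the variance of the tilted density. -/
def s2Fun (p : ℝ → ℝ) : ℝ → ℝ := deriv (mFun p)

/-- `μ₃ = (log Φ)'''`, the third centered moment of the tilted density. -/
def mu3Fun (p : ℝ → ℝ) : ℝ → ℝ := deriv (s2Fun p)

/-- The tilted density `π^a x = e^{t x} p x / Φ t` (with `t` the tilting parameter). -/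
def tilt (p : ℝ → ℝ) (t x : ℝ) : ℝ := Real.exp (t * x) * p x / mgfFun p t

/-- `convPow f n` is the `n`-fold convolution of the density `f` with itself. -/
def convPow (f : ℝ → ℝ) : ℕ → ℝ → ℝ
  | 0 => fun _ => 0
  | 1 => f
  | n + 2 => fun x => ∫ y : ℝ, f y * convPow f (n + 1) (x - y)

section FourierFacts

open scoped FourierTransform ContDiff SchwartzMap Convolution

/-- The Fourier transform (with Mathlib's normalization) of a real-valued function. -/
def ft (f : ℝ → ℝ) : ℝ → ℂ := 𝓕 (fun x => (f x : ℂ))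

theorem ft_apply (f : ℝ → ℝ) (w : ℝ) :
    ft f w = ∫ x, Complex.exp (-(2 * π * x * w : ℝ) * Complex.I) * (f x : ℂ) := by
  rw [ft, Real.fourier_real_eq_integral_exp_smul]
  congr 1
  ext x
  simp only [smul_eq_mul]
  congr 2
  push_cast
  ring

theorem ft_zero (f : ℝ → ℝ) : ft f 0 = ((∫ x, f x : ℝ) : ℂ) := by
  rw [ft_apply, ← integral_complex_ofReal]
  simp

theorem norm_ft_le (f : ℝ → ℝ) (w : ℝ) : ‖ft f w‖ ≤ ∫ x, |f x| := by
  rw [ft_apply]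
  refine (norm_integral_le_integral_norm _).trans (le_of_eq ?_)
  congr 1
  ext x
  rw [norm_mul, show (-(2 * π * x * w : ℝ) * Complex.I : ℂ) = ((-(2 * π * x * w) : ℝ) : ℂ) * Complex.I by
    push_cast; ring, Complex.norm_exp_ofReal_mul_I]
  simp

theorem continuous_ft {f : ℝ → ℝ} (hf : Integrable f) : Continuous (ft f) :=
  VectorFourier.fourierIntegral_continuous Real.continuous_fourierChar
    (by exact continuous_inner) hf.ofReal

theorem ft_add {f g : ℝ → ℝ} (hf : Integrable f) (hg : Integrable g) (w : ℝ) :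
    ft (fun x => f x + g x) w = ft f w + ft g w := by
  simp only [ft_apply]
  rw [← integral_add]
  · congr 1; ext x; push_cast; ring
  all_goals
    refine Integrable.bdd_mul (c := 1) (by first | exact hf.ofReal | exact hg.ofReal)
      (by fun_prop) (ae_of_all _ fun x => ?_)
    rw [show (-(2 * π * x * w : ℝ) * Complex.I : ℂ) = ((-(2 * π * x * w) : ℝ) : ℂ) * Complex.I by
      push_cast; ring, Complex.norm_exp_ofReal_mul_I]

theorem ft_const_mul (c : ℝ) (f : ℝ → ℝ) (w : ℝ) :
    ft (fun x => c * f x) w = c * ft f w := by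
  simp only [ft_apply]
  rw [← integral_const_mul]
  congr 1; ext x; push_cast; ring

theorem ft_convolution {f g : ℝ → ℝ} (hf : Integrable f) (hg : Integrable g) (w : ℝ) :
    ft (fun x => ∫ y, f y * g (x - y)) w = ft f w * ft g w := by
  have e : (fun x => ((∫ y, f y * g (x - y) : ℝ) : ℂ)) =
      ((fun x => (f x : ℂ)) ⋆[ContinuousLinearMap.mul ℂ ℂ] fun x => (g x : ℂ)) := by
    ext x
    rw [convolution, ← integral_complex_ofReal]
    simp
  rw [ft, e]
  exact Real.fourier_mul_convolution_eq (R := ℂ) hf.ofReal hg.ofReal w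

theorem integrable_conv {f g : ℝ → ℝ} (hf : Integrable f) (hg : Integrable g) :
    Integrable (fun x => ∫ y, f y * g (x - y)) := by
  exact hf.integrable_convolution (ContinuousLinearMap.mul ℝ ℝ) hg

theorem integrable_convPow {f : ℝ → ℝ} (hf : Integrable f) : ∀ n, Integrable (convPow f n)
  | 0 => integrable_zero _ _ _
  | 1 => hf
  | n + 2 => integrable_conv hf (integrable_convPow hf (n + 1))

theorem convPow_nonneg {f : ℝ → ℝ} (hf : ∀ x, 0 ≤ f x) : ∀ n x, 0 ≤ convPow f n x
  | 0, _ => le_rfl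
  | 1, x => hf x
  | n + 2, x => integral_nonneg fun y => mul_nonneg (hf y) (convPow_nonneg hf (n + 1) (x - y))

theorem ft_convPow {f : ℝ → ℝ} (hf : Integrable f) (w : ℝ) :
    ∀ n : ℕ, ft (convPow f (n + 1)) w = ft f w ^ (n + 1)
  | 0 => by simp [convPow]
  | n + 1 => by
    rw [show convPow f (n + 1 + 1) = fun x => ∫ y, f y * convPow f (n + 1) (x - y) from rfl,
      ft_convolution hf (integrable_convPow hf _), ft_convPow hf w n, pow_succ' _ (n + 1)]

theorem integral_conv {f g : ℝ → ℝ} (hf : Integrable f) (hg : Integrable g) :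
    ∫ x, (∫ y, f y * g (x - y)) = (∫ x, f x) * ∫ x, g x := by
  have h := ft_convolution hf hg 0
  simp only [ft_zero] at h
  exact_mod_cast h

theorem integral_convPow {f : ℝ → ℝ} (hf : Integrable f) (n : ℕ) :
    ∫ x, convPow f (n + 1) x = (∫ x, f x) ^ (n + 1) := by
  have h := ft_convPow hf 0 n
  simp only [ft_zero] at h
  exact_mod_cast h

/-- Fourier inversion, almost everywhere, without continuity. -/
theorem fourierInv_fourier_ae_eq {f : ℝ → ℂ} (hf : Integrable f) (hf' : Integrable (𝓕 f)) :
    ∀ᵐ x, 𝓕⁻ (𝓕 f) x = f x := by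
  have hc : Continuous (𝓕⁻ (𝓕 f)) := by
    have : 𝓕⁻ (𝓕 f) = fun x => 𝓕 (𝓕 f) (-x) := by
      ext x; rw [Real.fourierInv_eq_fourier_neg]
    rw [this]
    have h0 : Continuous (𝓕 (𝓕 f)) := VectorFourier.fourierIntegral_continuous
      Real.continuous_fourierChar (by exact continuous_inner) hf'
    exact h0.comp continuous_neg
  refine ae_eq_of_integral_contDiff_smul_eq hc.locallyIntegrable hf.locallyIntegrable ?_
  intro g hg hgs
  have hgs' : HasCompactSupport (fun x => (g x : ℂ)) := hgs.comp_left (g := ((↑) : ℝ → ℂ)) (by simp)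
  have hg' : ContDiff ℝ ∞ (fun x => (g x : ℂ)) := Complex.ofRealCLM.contDiff.comp hg
  let G : 𝓢(ℝ, ℂ) := hgs'.toSchwartzMap hg'
  have hG : ∀ x, G x = g x := fun x => rfl
  have key : ∀ (u : ℝ → ℂ), Integrable u → ∀ v : ℝ → ℂ, Integrable v →
      ∫ ξ, 𝓕 u ξ * v ξ = ∫ x, u x * 𝓕 v x := by
    intro u hu v hv
    have := VectorFourier.integral_fourierIntegral_smul_eq_flip (μ := (volume : Measure ℝ))
      (ν := (volume : Measure ℝ)) (L := innerₗ ℝ) Real.continuous_fourierChar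
      (by exact continuous_inner) hu hv
    rw [flip_innerₗ] at this
    exact this
  have hneg : ∫ x, g x • 𝓕⁻ (𝓕 f) x = ∫ x, 𝓕 (𝓕 f) x * (g (-x) : ℂ) := by
    rw [← integral_neg_eq_self]
    congr 1; ext x
    rw [Real.fourierInv_eq_fourier_neg, neg_neg, Complex.real_smul, mul_comm]
  have hGi : Integrable (fun x => (g x : ℂ)) := G.integrable
  rw [hneg, key _ hf' _ hGi.comp_neg]
  have hFG : Integrable (𝓕 (fun x => (g (-x) : ℂ))) := by
    have : 𝓕 (fun x => (g (-x) : ℂ)) = fun w => (𝓕 G) (-w) := by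
      ext w
      rw [SchwartzMap.fourier_coe, Real.fourier_real_eq, Real.fourier_real_eq,
        ← integral_neg_eq_self]
      congr 1; ext x
      simp [hG]
    rw [this]
    exact (𝓕 G).integrable.comp_neg
  rw [key _ hf _ hFG]
  congr 1
  ext x
  have h2 : 𝓕 (𝓕 (fun x => (g (-x) : ℂ))) x = g x := by
    have h3 := Continuous.fourierInv_fourier_eq (f := fun x => (g (-x) : ℂ)) (by
      exact Complex.continuous_ofReal.comp (hg.continuous.comp continuous_neg)) hGi.comp_neg hFG
    have h4 := congrFun h3 (-x)
    rw [Real.fourierInv_eq_fourier_neg, neg_neg] at h4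
    exact h4
  rw [h2, Complex.real_smul, mul_comm]

end FourierFacts

section Plancherel
open scoped FourierTransform ContDiff SchwartzMap

/-- On `L¹ ∩ L²` the `L²` Fourier transform agrees with the integral one. -/
theorem fourier_toLp_ae_eq {f : ℝ → ℂ} (hf : Integrable f) (hf2 : MemLp f 2) :
    ∀ᵐ x, (𝓕 (hf2.toLp f) : Lp ℂ 2 (volume : Measure ℝ)) x = 𝓕 f x := by
  have hc : Continuous (𝓕 f) := VectorFourier.fourierIntegral_continuous
      Real.continuous_fourierChar (by exact continuous_inner) hf
  have hloc : LocallyIntegrable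
      ((𝓕 (hf2.toLp f) : Lp ℂ 2 (volume : Measure ℝ)) : ℝ → ℂ) :=
    (Lp.memLp _).locallyIntegrable (by norm_num)
  refine ae_eq_of_integral_contDiff_smul_eq hloc hc.locallyIntegrable ?_
  intro g hg hgs
  have hgs' : HasCompactSupport (fun x => (g x : ℂ)) := hgs.comp_left (g := ((↑) : ℝ → ℂ)) (by simp)
  have hg' : ContDiff ℝ ∞ (fun x => (g x : ℂ)) := Complex.ofRealCLM.contDiff.comp hg
  let G : 𝓢(ℝ, ℂ) := hgs'.toSchwartzMap hg'
  have h := congrArg (fun T => T G) (Lp.fourier_toTemperedDistribution_eq (hf2.toLp f))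
  simp only [TemperedDistribution.fourier_apply, Lp.toTemperedDistribution_apply] at h
  have h1 : ∫ x, g x • (𝓕 (hf2.toLp f) : Lp ℂ 2 (volume : Measure ℝ)) x =
      ∫ x, (𝓕 G) x • (hf2.toLp f) x := by
    rw [h]; rfl
  rw [h1]
  have h2 : ∫ x, (𝓕 G) x • (hf2.toLp f) x = ∫ x, 𝓕 (G : ℝ → ℂ) x * f x := by
    refine integral_congr_ae ?_
    filter_upwards [hf2.coeFn_toLp] with x hx
    rw [hx]; rfl
  have := VectorFourier.integral_fourierIntegral_smul_eq_flip (μ := (volume : Measure ℝ))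
      (ν := (volume : Measure ℝ)) (L := innerₗ ℝ) Real.continuous_fourierChar
      (by exact continuous_inner) G.integrable hf
  rw [flip_innerₗ] at this
  rw [h2]
  exact this

theorem integral_norm_ft_sq_le {f : ℝ → ℝ} {M : ℝ} (hf : Integrable f) (hM : ∀ x, |f x| ≤ M) :
    Integrable (fun w => ‖ft f w‖ ^ 2) ∧ ∫ w, ‖ft f w‖ ^ 2 ≤ M * ∫ x, |f x| := by
  have hsq : Integrable (fun x => ‖(f x : ℂ)‖ ^ 2) := by
    have : Integrable (fun x => f x * f x) :=
      hf.bdd_mul hf.aestronglyMeasurable (ae_of_all _ hM)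
    refine this.congr (ae_of_all _ fun x => ?_)
    simp [sq]
  have hf2 : MemLp (fun x => (f x : ℂ)) 2 :=
    (memLp_two_iff_integrable_sq_norm hf.ofReal.aestronglyMeasurable).2 hsq
  have hae := fourier_toLp_ae_eq hf.ofReal hf2
  have hmem : MemLp (ft f) 2 := (Lp.memLp _).ae_eq hae
  have hint := (memLp_two_iff_integrable_sq_norm hmem.1).1 hmem
  refine ⟨hint, ?_⟩
  have hn := Lp.norm_fourier_eq (hf2.toLp _)
  have hL : ∀ u : Lp ℂ 2 (volume : Measure ℝ), ‖u‖ ^ 2 = ∫ x, ‖u x‖ ^ 2 := by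
    intro u
    have := L2.inner_def (𝕜 := ℂ) u u
    rw [inner_self_eq_norm_sq_to_K] at this
    have h2 : ∫ x, inner ℂ (u x) (u x) = ((∫ x, ‖u x‖ ^ 2 : ℝ) : ℂ) := by
      rw [← integral_complex_ofReal]
      congr 1; ext x
      rw [inner_self_eq_norm_sq_to_K]; simp
    rw [h2] at this
    exact Complex.ofReal_injective (by simpa using this)
  have h1 : ∫ w, ‖ft f w‖ ^ 2 = ∫ x, ‖(f x : ℂ)‖ ^ 2 := by
    have e1 : ∫ w, ‖ft f w‖ ^ 2 =
        ∫ x, ‖(𝓕 (hf2.toLp _) : Lp ℂ 2 (volume : Measure ℝ)) x‖ ^ 2 := by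
      refine integral_congr_ae ?_
      filter_upwards [hae] with x hx
      exact congrArg (fun z => ‖z‖ ^ 2) hx.symm
    have e2 : ∫ x, ‖(f x : ℂ)‖ ^ 2 = ∫ x, ‖(hf2.toLp _) x‖ ^ 2 := by
      refine integral_congr_ae ?_
      filter_upwards [hf2.coeFn_toLp] with x hx
      rw [hx]
    rw [e1, e2, ← hL, ← hL, hn]
  rw [h1, ← integral_const_mul]
  refine integral_mono hsq (hf.abs.const_mul M) fun x => ?_
  simp only [Complex.norm_real, norm_eq_abs, sq]
  exact mul_le_mul_of_nonneg_right (hM x) (abs_nonneg _)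

end Plancherel

theorem norm_pow_sub_pow_le_of_norm_le {A B : ℂ} {r : ℝ} (hA : ‖A‖ ≤ r) (hB : ‖B‖ ≤ r) (n : ℕ) :
    ‖A ^ (n + 1) - B ^ (n + 1)‖ ≤ (n + 1) * r ^ n * ‖A - B‖ := by
  have hr : 0 ≤ r := (norm_nonneg _).trans hA
  induction n with
  | zero => simp
  | succ n ih =>
    have e : A ^ (n + 1 + 1) - B ^ (n + 1 + 1) =
      A * (A ^ (n + 1) - B ^ (n + 1)) + B ^ (n + 1) * (A - B) := by ring
    rw [e]
    refine (norm_add_le _ _).trans ?_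
    rw [norm_mul, norm_mul, norm_pow]
    have h1 : ‖A‖ * ‖A ^ (n + 1) - B ^ (n + 1)‖ ≤ r * ((n + 1) * r ^ n * ‖A - B‖) :=
      mul_le_mul hA ih (norm_nonneg _) hr
    have h2 : ‖B‖ ^ (n + 1) * ‖A - B‖ ≤ r ^ (n + 1) * ‖A - B‖ := by gcongr
    push_cast
    calc _ ≤ _ := add_le_add h1 h2
      _ = _ := by ring

/-- The part of the binomial expansion of `(x + y) ^ n` which is divisible by `x ^ 2`. -/
theorem norm_add_pow_sub_le (x y : ℂ) (n : ℕ) :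
    ‖(x + y) ^ (n + 2) - y ^ (n + 2) - (n + 2) * x * y ^ (n + 1)‖ ≤
      (n + 2) ^ 2 * ‖x‖ ^ 2 * (‖x‖ + ‖y‖) ^ n := by
  have hS : ‖x + y‖ ≤ ‖x‖ + ‖y‖ := norm_add_le _ _
  have hy : ‖y‖ ≤ ‖x‖ + ‖y‖ := by linarith [norm_nonneg x]
  set S := ‖x‖ + ‖y‖ with hSdef
  have hS0 : 0 ≤ S := by positivity
  induction n with
  | zero =>
    have : (x + y) ^ (0 + 2) - y ^ (0 + 2) - ((0 : ℕ) + 2) * x * y ^ (0 + 1) = x ^ 2 := by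
      push_cast; ring
    rw [this, norm_pow]
    push_cast
    nlinarith [sq_nonneg ‖x‖]
  | succ n ih =>
    have e : (x + y) ^ (n + 1 + 2) - y ^ (n + 1 + 2) - ((n + 1 : ℕ) + 2) * x * y ^ (n + 1 + 1) =
        (x + y) * ((x + y) ^ (n + 2) - y ^ (n + 2) - (n + 2) * x * y ^ (n + 1)) +
          (n + 2) * (x ^ 2 * y ^ (n + 1)) := by
      push_cast; ring
    rw [e]
    refine (norm_add_le _ _).trans ?_
    rw [norm_mul, norm_mul, norm_mul, norm_pow, norm_pow]
    have h1 := mul_le_mul hS ih (norm_nonneg _) hS0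
    have h3 : ‖(n + 2 : ℂ)‖ = n + 2 := by
      rw [show (n + 2 : ℂ) = ((n + 2 : ℝ) : ℂ) by push_cast; ring, Complex.norm_real,
        Real.norm_of_nonneg (by positivity)]
    have h2 : ‖(n + 2 : ℂ)‖ * (‖x‖ ^ 2 * ‖y‖ ^ (n + 1)) ≤ (n + 2) * (‖x‖ ^ 2 * S ^ (n + 1)) := by
      rw [h3]; gcongr
    calc _ ≤ _ := add_le_add h1 h2
      _ = ((n + 2) ^ 2 + (n + 2)) * (‖x‖ ^ 2 * S ^ (n + 1)) := by ring
      _ ≤ (n + 1 + 2) ^ 2 * (‖x‖ ^ 2 * S ^ (n + 1)) := by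
        gcongr; nlinarith [(Nat.cast_nonneg n : (0:ℝ) ≤ n)]
      _ = _ := by push_cast; ring

theorem norm_exp_mul_I_sub_taylor_le (θ : ℝ) :
    ‖Complex.exp (θ * Complex.I) -
      (1 + θ * Complex.I - (θ : ℂ) ^ 2 / 2 - (θ : ℂ) ^ 3 / 6 * Complex.I)‖ ≤ 4 * θ ^ 4 := by
  have hth : ‖(θ * Complex.I : ℂ)‖ = |θ| := by simp
  rcases le_or_gt |θ| 1 with h | h
  · have := Complex.exp_bound (x := θ * Complex.I) (by rw [hth]; exact h) (n := 4) (by norm_num)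
    rw [hth] at this
    have e : ∑ m ∈ Finset.range 4, (θ * Complex.I : ℂ) ^ m / (m.factorial : ℂ) =
        1 + θ * Complex.I - (θ : ℂ) ^ 2 / 2 - (θ : ℂ) ^ 3 / 6 * Complex.I := by
      simp only [Finset.sum_range_succ, Finset.sum_range_zero, mul_pow, Nat.factorial]
      have h3 : Complex.I ^ 3 = -Complex.I := by
        rw [pow_succ, Complex.I_sq]; ring
      rw [h3, Complex.I_sq]
      push_cast; ring
    rw [e] at this
    refine this.trans ?_
    have h4 : |θ| ^ 4 = θ ^ 4 := by
      rw [← abs_pow, abs_of_nonneg (by positivity)]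
    rw [h4]
    have : (0:ℝ) ≤ θ ^ 4 := by positivity
    norm_num [Nat.factorial]
    nlinarith
  · have h1 : ‖Complex.exp (θ * Complex.I)‖ = 1 := Complex.norm_exp_ofReal_mul_I θ
    have h0 : ‖Complex.exp (θ * Complex.I) -
      (1 + θ * Complex.I - (θ : ℂ) ^ 2 / 2 - (θ : ℂ) ^ 3 / 6 * Complex.I)‖ ≤
        1 + (1 + |θ| + |θ| ^ 2 / 2 + |θ| ^ 3 / 6) := by
      refine (norm_sub_le _ _).trans ?_
      rw [h1]
      gcongr
      refine (norm_sub_le _ _).trans (add_le_add ((norm_sub_le _ _).trans (add_le_add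
        ((norm_add_le _ _).trans (by simp)) (by simp))) (by simp))
    have h4 : θ ^ 4 = |θ| ^ 4 := by
      rw [← abs_pow, abs_of_nonneg (by positivity)]
    rw [h4]
    refine h0.trans ?_
    have a2 : |θ| ≤ |θ| ^ 2 := by nlinarith
    have a3 : |θ| ^ 2 ≤ |θ| ^ 3 := by nlinarith [sq_nonneg |θ|]
    have a4 : |θ| ^ 3 ≤ |θ| ^ 4 := by nlinarith [pow_pos (zero_lt_one.trans h) 3]
    linarith

theorem abs_exp_neg_sub_le {x : ℝ} (hx : 0 ≤ x) : |exp (-x) - (1 - x)| ≤ x ^ 2 := by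
  rw [abs_of_nonneg (by linarith [add_one_le_exp (-x)])]
  rcases le_or_gt x 1 with h | h
  · have h1 : exp (-x) ≤ 1 / (1 + x) := by
      rw [exp_neg, one_div]
      exact inv_anti₀ (by linarith) (by linarith [add_one_le_exp x])
    have : 1 / (1 + x) ≤ 1 - x + x ^ 2 := by
      rw [div_le_iff₀ (by linarith)]; nlinarith [pow_nonneg hx 3]
    linarith
  · have : exp (-x) ≤ 1 := exp_le_one_iff.2 (by linarith)
    nlinarith

/-- Taylor expansion of the Fourier transform of a standardized density. -/
theorem norm_ft_sub_taylor_le {f : ℝ → ℝ} (hf0 : ∀ x, 0 ≤ f x) (hf : Integrable f)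
    (h4 : Integrable fun x => x ^ 4 * f x)
    (i0 : ∫ x, f x = 1) (i1 : ∫ x, x * f x = 0) (i2 : ∫ x, x ^ 2 * f x = 1) (w : ℝ) :
    ‖ft f w - (1 - (((2 * π * w) ^ 2 / 2 : ℝ) : ℂ))‖ ≤
      |2 * π * w| ^ 3 * |∫ x, x ^ 3 * f x| + 4 * (2 * π * w) ^ 4 * ∫ x, x ^ 4 * f x := by
  have hdom : ∀ k ≤ 4, Integrable fun x => x ^ k * f x := by
    intro k hk
    refine (hf.add h4).mono' ((by fun_prop : Continuous fun x : ℝ => x ^ k).aestronglyMeasurable.mul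
      hf.aestronglyMeasurable) (ae_of_all _ fun x => ?_)
    rw [norm_mul, Real.norm_of_nonneg (hf0 x), norm_pow, norm_eq_abs]
    have : |x| ^ k ≤ 1 + x ^ 4 := by
      rcases le_or_gt |x| 1 with h | h
      · have := pow_le_one₀ (abs_nonneg x) h (n := k)
        have : (0:ℝ) ≤ x ^ 4 := by positivity
        linarith
      · have := pow_le_pow_right₀ h.le hk
        rw [← abs_pow x 4, abs_of_nonneg (by positivity : (0:ℝ) ≤ x ^ 4)] at this
        linarith
    simp only [Pi.add_apply]
    nlinarith [hf0 x]
  set u := 2 * π * w with hu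
  have hexp : ft f w = ∫ x, Complex.exp (((-(u * x) : ℝ) : ℂ) * Complex.I) * (f x : ℂ) := by
    rw [ft_apply]
    congr 1; ext x; congr 3
    push_cast [hu]; ring
  set P : ℝ → ℂ := fun x => (1 + ((-(u * x) : ℝ) : ℂ) * Complex.I - ((-(u * x) : ℝ) : ℂ) ^ 2 / 2
    - ((-(u * x) : ℝ) : ℂ) ^ 3 / 6 * Complex.I) * (f x : ℂ) with hP
  have hPe : P = fun x => (((f x : ℝ) : ℂ) + (-(u * Complex.I)) * ((x * f x : ℝ) : ℂ)
      + (-(u ^ 2 / 2)) * ((x ^ 2 * f x : ℝ) : ℂ)) + (u ^ 3 / 6 * Complex.I) * ((x ^ 3 * f x : ℝ) : ℂ) := by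
    ext x; simp only [hP]; push_cast; ring
  have j1 : Integrable fun x => ((x * f x : ℝ) : ℂ) := by
    simpa using (hdom 1 (by norm_num)).ofReal (𝕜 := ℂ)
  have j2 : Integrable fun x => ((x ^ 2 * f x : ℝ) : ℂ) := (hdom 2 (by norm_num)).ofReal
  have j3 : Integrable fun x => ((x ^ 3 * f x : ℝ) : ℂ) := (hdom 3 (by norm_num)).ofReal
  have j0 : Integrable fun x => ((f x : ℝ) : ℂ) := hf.ofReal
  have hPi : Integrable P := by
    rw [hPe]
    exact ((j0.add (j1.const_mul _)).add (j2.const_mul _)).add (j3.const_mul _)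
  have hPint : ∫ x, P x = 1 - ((u ^ 2 / 2 : ℝ) : ℂ) +
      (u ^ 3 / 6 * Complex.I) * ((∫ x, x ^ 3 * f x : ℝ) : ℂ) := by
    have j01 : Integrable fun x => ((f x : ℝ) : ℂ) + (-(u * Complex.I)) * ((x * f x : ℝ) : ℂ) :=
      j0.add (j1.const_mul _)
    have j012 : Integrable fun x => ((f x : ℝ) : ℂ) + (-(u * Complex.I)) * ((x * f x : ℝ) : ℂ)
        + (-(u ^ 2 / 2)) * ((x ^ 2 * f x : ℝ) : ℂ) := j01.add (j2.const_mul _)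
    rw [hPe]
    beta_reduce
    rw [integral_add j012 (j3.const_mul _), integral_add j01 (j2.const_mul _),
      integral_add j0 (j1.const_mul _)]
    simp only [integral_const_mul, integral_complex_ofReal, i0, i1, i2]
    push_cast; ring
  have hEi : Integrable fun x => Complex.exp (((-(u * x) : ℝ) : ℂ) * Complex.I) * (f x : ℂ) := by
    refine j0.bdd_mul (c := 1) (by fun_prop) (ae_of_all _ fun x => ?_)
    rw [Complex.norm_exp_ofReal_mul_I]
  have hdiff : ‖ft f w - ∫ x, P x‖ ≤ 4 * u ^ 4 * ∫ x, x ^ 4 * f x := by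
    rw [hexp, ← integral_sub hEi hPi, ← integral_const_mul]
    refine norm_integral_le_of_norm_le (h4.const_mul _) (ae_of_all _ fun x => ?_)
    simp only [hP]
    rw [← sub_mul, norm_mul, Complex.norm_real, Real.norm_of_nonneg (hf0 x)]
    have := norm_exp_mul_I_sub_taylor_le (-(u * x))
    calc _ ≤ 4 * (-(u * x)) ^ 4 * f x := mul_le_mul_of_nonneg_right this (hf0 x)
      _ = _ := by ring
  have e : ft f w - (1 - ((u ^ 2 / 2 : ℝ) : ℂ)) = (ft f w - ∫ x, P x) +
      (u ^ 3 / 6 * Complex.I) * ((∫ x, x ^ 3 * f x : ℝ) : ℂ) := by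
    rw [hPint]; ring
  rw [e]
  refine (norm_add_le _ _).trans ?_
  rw [add_comm]
  refine add_le_add ?_ hdiff
  rw [norm_mul, norm_mul, norm_div, norm_pow, Complex.norm_I, Complex.norm_real, Complex.norm_real,
    norm_eq_abs, norm_eq_abs]
  refine mul_le_mul_of_nonneg_right ?_ (abs_nonneg _)
  norm_num
  have := pow_nonneg (abs_nonneg u) 3
  linarith

/-- `g + b` is a probability density with mean `0` and variance `1`, split into a bounded part `g`
and a part `b` of small mass, with quantitative control of its higher moments and of its
characteristic function away from the origin. -/
structure IsStdSplit (g b : ℝ → ℝ) (C κ δ M ρ ε : ℝ) : Prop where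
  g_nonneg : ∀ x, 0 ≤ g x
  b_nonneg : ∀ x, 0 ≤ b x
  g_int : Integrable g
  b_int : Integrable b
  mass : ∫ x, (g x + b x) = 1
  mean : ∫ x, x * (g x + b x) = 0
  var : ∫ x, x ^ 2 * (g x + b x) = 1
  int4 : Integrable fun x => x ^ 4 * (g x + b x)
  mom4 : ∫ x, x ^ 4 * (g x + b x) ≤ C
  mom3 : |∫ x, x ^ 3 * (g x + b x)| ≤ κ
  κ_le : κ ≤ 1
  b_mass : ∫ x, b x ≤ δ
  δ_le : δ ≤ 1
  g_le : ∀ x, g x ≤ M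
  ε_pos : 0 < ε
  ε_le : ε ≤ 1 / 8
  ε_sq_le : 4 * C * ε ^ 2 ≤ 1 / 8
  ft_le : ∀ w, ε ≤ |2 * π * w| → ‖ft (fun x => g x + b x) w‖ ≤ ρ

namespace IsStdSplit

variable {g b : ℝ → ℝ} {C κ δ M ρ ε : ℝ}

theorem sum_nonneg (h : IsStdSplit g b C κ δ M ρ ε) (x : ℝ) : 0 ≤ g x + b x :=
  add_nonneg (h.g_nonneg x) (h.b_nonneg x)

theorem sum_int (h : IsStdSplit g b C κ δ M ρ ε) : Integrable fun x => g x + b x :=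
  h.g_int.add h.b_int

theorem integral_b_nonneg (h : IsStdSplit g b C κ δ M ρ ε) : 0 ≤ ∫ x, b x :=
  integral_nonneg h.b_nonneg

theorem δ_nonneg (h : IsStdSplit g b C κ δ M ρ ε) : 0 ≤ δ := h.integral_b_nonneg.trans h.b_mass

theorem κ_nonneg (h : IsStdSplit g b C κ δ M ρ ε) : 0 ≤ κ := (abs_nonneg _).trans h.mom3

theorem C_nonneg (h : IsStdSplit g b C κ δ M ρ ε) : 0 ≤ C :=
  (integral_nonneg fun x => mul_nonneg (by positivity) (h.sum_nonneg x)).trans h.mom4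

theorem integral_g_le (h : IsStdSplit g b C κ δ M ρ ε) : ∫ x, g x ≤ 1 := by
  have := h.mass
  rw [integral_add h.g_int h.b_int] at this
  linarith [h.integral_b_nonneg]

theorem norm_ft_g_le (h : IsStdSplit g b C κ δ M ρ ε) (w : ℝ) : ‖ft g w‖ ≤ 1 := by
  refine (norm_ft_le g w).trans (le_trans (le_of_eq ?_) h.integral_g_le)
  congr 1; ext x; exact abs_of_nonneg (h.g_nonneg x)

theorem norm_ft_b_le (h : IsStdSplit g b C κ δ M ρ ε) (w : ℝ) : ‖ft b w‖ ≤ δ := by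
  refine (norm_ft_le b w).trans (le_trans (le_of_eq ?_) h.b_mass)
  congr 1; ext x; exact abs_of_nonneg (h.b_nonneg x)

theorem norm_ft_sub_le (h : IsStdSplit g b C κ δ M ρ ε) (w : ℝ) :
    ‖ft (fun x => g x + b x) w - (1 - (((2 * π * w) ^ 2 / 2 : ℝ) : ℂ))‖ ≤
      κ * |2 * π * w| ^ 3 + 4 * C * (2 * π * w) ^ 4 := by
  refine (norm_ft_sub_taylor_le h.sum_nonneg h.sum_int h.int4 h.mass h.mean h.var w).trans ?_
  have h1 := mul_le_mul_of_nonneg_left h.mom3 (pow_nonneg (abs_nonneg (2 * π * w)) 3)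
  have h2 := mul_le_mul_of_nonneg_left h.mom4 (by positivity : 0 ≤ 4 * (2 * π * w) ^ 4)
  linarith

theorem norm_ft_le_exp (h : IsStdSplit g b C κ δ M ρ ε) {w : ℝ} (hw : |2 * π * w| ≤ ε) :
    ‖ft (fun x => g x + b x) w‖ ≤ exp (-((2 * π * w) ^ 2 / 4)) := by
  have h1 := h.norm_ft_sub_le w
  set u := 2 * π * w
  have h2 := norm_le_norm_add_norm_sub' (ft (fun x => g x + b x) w) (1 - ((u ^ 2 / 2 : ℝ) : ℂ))
  have hu2 : u ^ 2 ≤ ε ^ 2 := sq_le_sq' (by linarith [abs_le.1 hw]) (abs_le.1 hw).2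
  have h3 : ‖1 - ((u ^ 2 / 2 : ℝ) : ℂ)‖ = 1 - u ^ 2 / 2 := by
    rw [show (1 - ((u ^ 2 / 2 : ℝ) : ℂ)) = ((1 - u ^ 2 / 2 : ℝ) : ℂ) by push_cast; ring,
      Complex.norm_real, Real.norm_of_nonneg]
    nlinarith [h.ε_le, h.ε_pos]
  have h4 : κ * |u| ^ 3 ≤ u ^ 2 * (1 / 8) := by
    have : κ * |u| ^ 3 = (κ * |u|) * u ^ 2 := by rw [← sq_abs u]; ring
    rw [this, mul_comm]
    gcongr
    nlinarith [h.κ_le, h.κ_nonneg, h.ε_le, abs_nonneg u]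
  have h5 : 4 * C * u ^ 4 ≤ u ^ 2 * (1 / 8) := by
    have : 4 * C * u ^ 4 = u ^ 2 * (4 * C * u ^ 2) := by ring
    rw [this]
    gcongr
    have := h.C_nonneg
    exact le_trans (by gcongr) h.ε_sq_le
  have := add_one_le_exp (-(u ^ 2 / 4))
  linarith

theorem norm_ft_pow_sub_le (h : IsStdSplit g b C κ δ M ρ ε) {w : ℝ} (hw : |2 * π * w| ≤ ε) (n : ℕ) :
    ‖ft (fun x => g x + b x) w ^ (n + 2) - ((exp (-((n + 2) * (2 * π * w) ^ 2 / 2)) : ℝ) : ℂ)‖ ≤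
      (n + 2) * (κ * |2 * π * w| ^ 3 + (4 * C + 1) * (2 * π * w) ^ 4) *
        exp (-((n + 2) * (2 * π * w) ^ 2 / 8)) := by
  have h1 := h.norm_ft_le_exp hw
  have h2 := h.norm_ft_sub_le w
  set u := 2 * π * w
  set A := ft (fun x => g x + b x) w
  have hB : ‖((exp (-(u ^ 2 / 2)) : ℝ) : ℂ)‖ ≤ exp (-(u ^ 2 / 4)) := by
    rw [Complex.norm_real, Real.norm_of_nonneg (exp_nonneg _)]
    exact exp_le_exp.2 (by nlinarith [sq_nonneg u])
  have h3 := norm_pow_sub_pow_le_of_norm_le h1 hB (n + 1)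
  have e1 : ((exp (-(u ^ 2 / 2)) : ℝ) : ℂ) ^ (n + 1 + 1) =
      ((exp (-((n + 2) * u ^ 2 / 2)) : ℝ) : ℂ) := by
    rw [← Complex.ofReal_pow, ← exp_nat_mul]
    congr 2; push_cast; ring
  rw [e1] at h3
  have e2 : exp (-(u ^ 2 / 4)) ^ (n + 1) ≤ exp (-((n + 2) * u ^ 2 / 8)) := by
    rw [← exp_nat_mul]
    refine exp_le_exp.2 ?_
    push_cast
    nlinarith [mul_nonneg (Nat.cast_nonneg n : (0:ℝ) ≤ n) (sq_nonneg u)]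
  have h4 : ‖A - ((exp (-(u ^ 2 / 2)) : ℝ) : ℂ)‖ ≤ κ * |u| ^ 3 + (4 * C + 1) * u ^ 4 := by
    have h5 := abs_exp_neg_sub_le (x := u ^ 2 / 2) (by positivity)
    have h6 : ‖(1 - ((u ^ 2 / 2 : ℝ) : ℂ)) - ((exp (-(u ^ 2 / 2)) : ℝ) : ℂ)‖ ≤ u ^ 4 := by
      rw [norm_sub_rev, show (((exp (-(u ^ 2 / 2)) : ℝ) : ℂ) - (1 - ((u ^ 2 / 2 : ℝ) : ℂ))) =
        ((exp (-(u ^ 2 / 2)) - (1 - u ^ 2 / 2) : ℝ) : ℂ) by push_cast; ring, Complex.norm_real]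
      refine h5.trans ?_
      have : 0 ≤ u ^ 4 := by positivity
      nlinarith
    calc _ ≤ _ := norm_sub_le_norm_sub_add_norm_sub A (1 - ((u ^ 2 / 2 : ℝ) : ℂ)) _
      _ ≤ _ := add_le_add h2 h6
      _ = _ := by ring
  refine h3.trans ?_
  have hcast : ((n + 1 : ℕ) : ℝ) = n + 1 := by push_cast; ring
  rw [hcast]
  have hκ := h.κ_nonneg
  have hC := h.C_nonneg
  calc _ ≤ ((n:ℝ) + 1 + 1) * exp (-((n + 2) * u ^ 2 / 8)) *
        (κ * |u| ^ 3 + (4 * C + 1) * u ^ 4) := by gcongr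
    _ = _ := by ring

/-- A dominating function for the error in the central limit theorem, on the Fourier side. -/
def errBound (g : ℝ → ℝ) (C κ δ ρ ε : ℝ) (n : ℕ) (w : ℝ) : ℝ :=
  (n + 2) * (κ * |2 * π * w| ^ 3 + (4 * C + 1) * (2 * π * w) ^ 4) *
        exp (-((n + 2) * (2 * π * w) ^ 2 / 8)) +
    ((n + 3) * δ ^ (n + 1) * exp 1 + exp (-((n + 2) * ε ^ 2 / 4))) * exp (-((2 * π * w) ^ 2 / 8)) +
    (n + 2) ^ 2 * (ρ + 2 * δ) ^ n * ‖ft g w‖ ^ 2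

theorem norm_ft_rem_le (h : IsStdSplit g b C κ δ M ρ ε) (hρ : 0 ≤ ρ) (n : ℕ) (w : ℝ) :
    ‖(ft (fun x => g x + b x) w ^ (n + 2) - ft b w ^ (n + 2) - (n + 2) * ft g w * ft b w ^ (n + 1)) -
      ((exp (-((n + 2) * (2 * π * w) ^ 2 / 2)) : ℝ) : ℂ)‖ ≤ errBound g C κ δ ρ ε n w := by
  have hκ := h.κ_nonneg
  have hC := h.C_nonneg
  have hδ := h.δ_nonneg
  have hδ1 := h.δ_le
  have hg1 := h.norm_ft_g_le w
  have hb1 := h.norm_ft_b_le w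
  have hn2 : ‖(n + 2 : ℂ)‖ = n + 2 := by
    rw [show (n + 2 : ℂ) = ((n + 2 : ℝ) : ℂ) by push_cast; ring, Complex.norm_real,
      Real.norm_of_nonneg (by positivity)]
  unfold errBound
  rcases le_or_gt |2 * π * w| ε with hw | hw
  · have h1 := h.norm_ft_pow_sub_le hw n
    set u := 2 * π * w
    have h2 : ‖ft b w ^ (n + 2) + (n + 2) * ft g w * ft b w ^ (n + 1)‖ ≤ (n + 3) * δ ^ (n + 1) := by
      refine (norm_add_le _ _).trans ?_
      rw [norm_mul, norm_mul, norm_pow, norm_pow, hn2]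
      have a1 : ‖ft b w‖ ^ (n + 2) ≤ δ ^ (n + 1) := by
        calc _ ≤ δ ^ (n + 2) := by gcongr
          _ ≤ _ := pow_le_pow_of_le_one hδ hδ1 (by omega)
      have a2 : (n + 2 : ℝ) * ‖ft g w‖ * ‖ft b w‖ ^ (n + 1) ≤ (n + 2) * 1 * δ ^ (n + 1) := by gcongr
      linarith
    have h3 : 1 ≤ exp 1 * exp (-(u ^ 2 / 8)) := by
      rw [← exp_add, one_le_exp_iff]
      have : u ^ 2 ≤ ε ^ 2 := sq_le_sq' (by linarith [abs_le.1 hw]) (abs_le.1 hw).2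
      nlinarith [h.ε_le, h.ε_pos]
    have h4 : (n + 3) * δ ^ (n + 1) ≤ ((n + 3) * δ ^ (n + 1) * exp 1 + exp (-((n + 2) * ε ^ 2 / 4))) *
        exp (-(u ^ 2 / 8)) := by
      have a0 : 0 ≤ (n + 3) * δ ^ (n + 1) := by positivity
      have a1 : 0 ≤ exp (-((n + 2) * ε ^ 2 / 4)) * exp (-(u ^ 2 / 8)) := by positivity
      nlinarith [mul_le_mul_of_nonneg_left h3 a0]
    have h5 : 0 ≤ (n + 2) ^ 2 * (ρ + 2 * δ) ^ n * ‖ft g w‖ ^ 2 := by positivity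
    have e : (ft (fun x => g x + b x) w ^ (n + 2) - ft b w ^ (n + 2)
        - (n + 2) * ft g w * ft b w ^ (n + 1)) - ((exp (-((n + 2) * u ^ 2 / 2)) : ℝ) : ℂ) =
        (ft (fun x => g x + b x) w ^ (n + 2) - ((exp (-((n + 2) * u ^ 2 / 2)) : ℝ) : ℂ)) -
        (ft b w ^ (n + 2) + (n + 2) * ft g w * ft b w ^ (n + 1)) := by ring
    rw [e]
    refine (norm_sub_le _ _).trans ?_
    linarith
  · have hf := h.ft_le w hw.le
    set u := 2 * π * w
    have hsum : ft (fun x => g x + b x) w = ft g w + ft b w := ft_add h.g_int h.b_int w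
    rw [hsum] at hf ⊢
    have hg2 : ‖ft g w‖ ≤ ρ + δ := by
      have := norm_sub_le (ft g w + ft b w) (ft b w)
      rw [add_sub_cancel_right] at this
      linarith
    have h1 := norm_add_pow_sub_le (ft g w) (ft b w) n
    have h2 : (n + 2 : ℝ) ^ 2 * ‖ft g w‖ ^ 2 * (‖ft g w‖ + ‖ft b w‖) ^ n ≤
        (n + 2) ^ 2 * ‖ft g w‖ ^ 2 * (ρ + 2 * δ) ^ n :=
      mul_le_mul_of_nonneg_left (pow_le_pow_left₀ (by positivity) (by linarith) n) (by positivity)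
    have h3 : exp (-((n + 2) * u ^ 2 / 2)) ≤ exp (-((n + 2) * ε ^ 2 / 4)) * exp (-(u ^ 2 / 8)) := by
      rw [← exp_add]
      refine exp_le_exp.2 ?_
      have : ε ^ 2 ≤ u ^ 2 := by
        rw [← sq_abs u]; exact pow_le_pow_left₀ h.ε_pos.le hw.le 2
      nlinarith [mul_nonneg (Nat.cast_nonneg n : (0:ℝ) ≤ n) (sq_nonneg u),
        mul_le_mul_of_nonneg_left this (Nat.cast_nonneg n : (0:ℝ) ≤ n), sq_nonneg u]
    refine (norm_sub_le _ _).trans ?_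
    rw [Complex.norm_real, Real.norm_of_nonneg (exp_nonneg _)]
    have h4 : 0 ≤ (n + 2) * (κ * |u| ^ 3 + (4 * C + 1) * u ^ 4) * exp (-((n + 2) * u ^ 2 / 8)) := by
      positivity
    have h5 : 0 ≤ ((n + 3) * δ ^ (n + 1) * exp 1) * exp (-(u ^ 2 / 8)) := by positivity
    nlinarith

end IsStdSplit

section FourierFacts
open scoped FourierTransform

theorem ft_gaussian {N : ℝ} (hN : 0 < N) (w : ℝ) :
    ft (fun z => (√(2 * π * N))⁻¹ * exp (-(z ^ 2 / (2 * N)))) w =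
      ((exp (-(N * (2 * π * w) ^ 2 / 2)) : ℝ) : ℂ) := by
  rw [ft_const_mul]
  have hb : 0 < (((2 * π * N)⁻¹ : ℝ) : ℂ).re := by rw [Complex.ofReal_re]; positivity
  have h := congrFun (fourier_gaussian_pi hb) w
  have e : ft (fun z => exp (-(z ^ 2 / (2 * N)))) w =
      𝓕 (fun x : ℝ => Complex.exp (-π * (((2 * π * N)⁻¹ : ℝ) : ℂ) * (x : ℂ) ^ 2)) w := by
    rw [ft]
    refine congrArg (fun F : ℝ → ℂ => 𝓕 F w) (funext fun x => ?_)
    rw [Complex.ofReal_exp]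
    congr 1
    push_cast
    have : (N : ℂ) ≠ 0 := by exact_mod_cast hN.ne'
    have : (π : ℂ) ≠ 0 := by exact_mod_cast pi_ne_zero
    field_simp
  have hs : (((2 * π * N)⁻¹ : ℝ) : ℂ) ^ (1 / 2 : ℂ) = (((√(2 * π * N))⁻¹ : ℝ) : ℂ) := by
    rw [← sqrt_inv, sqrt_eq_rpow, Complex.ofReal_cpow (by positivity)]
    norm_num
  rw [e, h, hs, Complex.ofReal_exp, one_div, Complex.ofReal_inv, Complex.ofReal_inv, inv_inv,
    ← mul_assoc, inv_mul_cancel₀, one_mul]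
  · congr 1
    push_cast
    have : (N : ℂ) ≠ 0 := by exact_mod_cast hN.ne'
    have : (π : ℂ) ≠ 0 := by exact_mod_cast pi_ne_zero
    field_simp
  · have : 0 < √(2 * π * N) := by positivity
    exact_mod_cast this.ne'

theorem ae_abs_le_of_norm_ft_le {f B : ℝ → ℝ} (hf : Integrable f) (hB : Integrable B)
    (h : ∀ w, ‖ft f w‖ ≤ B w) : ∀ᵐ z, |f z| ≤ ∫ w, B w := by
  have hi : Integrable (ft f) :=
    hB.mono' (continuous_ft hf).aestronglyMeasurable (ae_of_all _ h)
  filter_upwards [fourierInv_fourier_ae_eq hf.ofReal hi] with z hz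
  have h1 : ‖((f z : ℝ) : ℂ)‖ = |f z| := Complex.norm_real _
  have hz' : 𝓕⁻ (𝓕 fun x => ((f x : ℝ) : ℂ)) z = ((f z : ℝ) : ℂ) := hz
  rw [← h1, ← hz', Real.fourierInv_eq']
  refine (norm_integral_le_integral_norm _).trans (integral_mono_of_nonneg
    (ae_of_all _ fun _ => norm_nonneg _) hB (ae_of_all _ fun w => ?_))
  simp only [norm_smul]
  rw [Complex.norm_exp_ofReal_mul_I, one_mul]
  exact h w

end FourierFacts

/-- Gaussian absolute moments in the normalisation of the Fourier transform. -/
def gaussMom (k : ℕ) : ℝ := ∫ v : ℝ, |2 * π * v| ^ k * exp (-((2 * π * v) ^ 2 / 8))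

theorem integrable_abs_pow_mul_exp_neg_sq {a : ℝ} (ha : 0 < a) (k : ℕ) :
    Integrable fun v : ℝ => |v| ^ k * exp (-a * v ^ 2) := by
  have h := (integrable_rpow_mul_exp_neg_mul_sq ha (s := k)
    (by linarith [(Nat.cast_nonneg k : (0:ℝ) ≤ k)])).abs
  refine h.congr (ae_of_all _ fun v => ?_)
  simp only [rpow_natCast]
  rw [abs_mul, abs_pow, abs_of_nonneg (exp_nonneg _)]

theorem integrable_gaussMom (k : ℕ) :
    Integrable fun v : ℝ => |2 * π * v| ^ k * exp (-((2 * π * v) ^ 2 / 8)) := by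
  have h := (integrable_abs_pow_mul_exp_neg_sq (a := (2 * π) ^ 2 / 8) (by positivity) k).const_mul
    ((2 * π) ^ k)
  refine h.congr (ae_of_all _ fun v => ?_)
  simp only
  rw [abs_mul, abs_of_pos (by positivity : 0 < 2 * π), mul_pow (2 * π) |v|, ← mul_assoc,
    show -((2 * π) ^ 2 / 8) * v ^ 2 = -((2 * π * v) ^ 2 / 8) by ring]

theorem gaussMom_scale {N : ℝ} (hN : 0 < N) (k : ℕ) :
    Integrable (fun w : ℝ => |2 * π * w| ^ k * exp (-(N * (2 * π * w) ^ 2 / 8))) ∧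
    ∫ w : ℝ, |2 * π * w| ^ k * exp (-(N * (2 * π * w) ^ 2 / 8)) = gaussMom k / √N ^ (k + 1) := by
  have hs : 0 < √N := sqrt_pos.2 hN
  have e : (fun w : ℝ => |2 * π * w| ^ k * exp (-(N * (2 * π * w) ^ 2 / 8))) = fun w =>
      (√N ^ k)⁻¹ * (|2 * π * (√N * w)| ^ k * exp (-((2 * π * (√N * w)) ^ 2 / 8))) := by
    ext w
    have e1 : (2 * π * (√N * w)) ^ 2 = N * (2 * π * w) ^ 2 := by
      rw [show 2 * π * (√N * w) = √N * (2 * π * w) by ring, mul_pow, sq_sqrt hN.le]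
    rw [e1, show 2 * π * (√N * w) = √N * (2 * π * w) by ring, abs_mul (√N), abs_of_pos hs, mul_pow]
    field_simp
    rw [mul_pow, mul_comm]
  rw [e]
  refine ⟨((integrable_gaussMom k).comp_mul_left' hs.ne').const_mul _, ?_⟩
  rw [integral_const_mul, Measure.integral_comp_mul_left
    (fun v : ℝ => |2 * π * v| ^ k * exp (-((2 * π * v) ^ 2 / 8)))]
  rw [abs_of_pos (by positivity), gaussMom, smul_eq_mul]
  generalize ∫ v : ℝ, |2 * π * v| ^ k * exp (-((2 * π * v) ^ 2 / 8)) = I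
  field_simp
  ring

/-- The part of the convolution power of `g + b` with at most one factor from `g`. -/
def fewFactorPart (g b : ℝ → ℝ) (n : ℕ) (z : ℝ) : ℝ :=
  convPow b (n + 2) z + (n + 2) * ∫ y, g y * convPow b (n + 1) (z - y)

/-- The error term in the local limit theorem. -/
def lltErr (C κ δ M ρ ε : ℝ) (n : ℕ) : ℝ :=
  (κ * gaussMom 3 + (4 * C + 1) * gaussMom 4 / √(n + 2)) / (n + 2) +
    ((n + 3) * δ ^ (n + 1) * exp 1 + exp (-((n + 2) * ε ^ 2 / 4))) * gaussMom 0 +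
    (n + 2) ^ 2 * (ρ + 2 * δ) ^ n * M

namespace IsStdSplit

variable {g b : ℝ → ℝ} {C κ δ M ρ ε : ℝ}

theorem integral_errBound_le (h : IsStdSplit g b C κ δ M ρ ε) (hρ : 0 ≤ ρ) (n : ℕ) :
    Integrable (errBound g C κ δ ρ ε n) ∧
      ∫ w, errBound g C κ δ ρ ε n w ≤ lltErr C κ δ M ρ ε n := by
  have hN : (0:ℝ) < n + 2 := by positivity
  have hδ := h.δ_nonneg
  obtain ⟨i3, v3⟩ := gaussMom_scale hN 3
  obtain ⟨i4, v4⟩ := gaussMom_scale hN 4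
  have i0 := integrable_gaussMom 0
  have hM : ∀ x, |g x| ≤ M := fun x => by rw [abs_of_nonneg (h.g_nonneg x)]; exact h.g_le x
  have hM0 : 0 ≤ M := (abs_nonneg _).trans (hM 0)
  obtain ⟨ig, vg⟩ := integral_norm_ft_sq_le h.g_int hM
  have vg' : ∫ w, ‖ft g w‖ ^ 2 ≤ M := by
    refine vg.trans ?_
    have : ∫ x, |g x| = ∫ x, g x := by congr 1; ext x; exact abs_of_nonneg (h.g_nonneg x)
    rw [this]
    nlinarith [h.integral_g_le]
  have e : errBound g C κ δ ρ ε n = fun w =>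
      (((n + 2) * κ) * (|2 * π * w| ^ 3 * exp (-((n + 2) * (2 * π * w) ^ 2 / 8))) +
      ((n + 2) * (4 * C + 1)) * (|2 * π * w| ^ 4 * exp (-((n + 2) * (2 * π * w) ^ 2 / 8)))) +
      ((n + 3) * δ ^ (n + 1) * exp 1 + exp (-((n + 2) * ε ^ 2 / 4))) *
        (|2 * π * w| ^ 0 * exp (-((2 * π * w) ^ 2 / 8))) +
      ((n + 2) ^ 2 * (ρ + 2 * δ) ^ n) * ‖ft g w‖ ^ 2 := by
    ext w
    have : |2 * π * w| ^ 4 = (2 * π * w) ^ 4 := by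
      rw [show 4 = 2 * 2 by rfl, pow_mul, sq_abs, pow_mul]
    rw [errBound, this, pow_zero]
    ring
  have j3 := i3.const_mul ((n + 2) * κ)
  have j4 := i4.const_mul ((n + 2) * (4 * C + 1))
  have j0 := i0.const_mul ((n + 3) * δ ^ (n + 1) * exp 1 + exp (-((n + 2) * ε ^ 2 / 4)))
  have jg := ig.const_mul ((n + 2) ^ 2 * (ρ + 2 * δ) ^ n)
  rw [e]
  refine ⟨((j3.fun_add j4).fun_add j0).fun_add jg, ?_⟩
  rw [integral_add ((j3.fun_add j4).fun_add j0) jg, integral_add (j3.fun_add j4) j0, integral_add j3 j4,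
    integral_const_mul, integral_const_mul, integral_const_mul, integral_const_mul, v3, v4, lltErr]
  refine add_le_add (add_le_add (le_of_eq ?_) le_rfl)
    (mul_le_mul_of_nonneg_left vg' (by positivity))
  have hs : 0 < √((n:ℝ) + 2) := sqrt_pos.2 hN
  have hs2 : √((n:ℝ) + 2) ^ 2 = n + 2 := sq_sqrt hN.le
  set s := √((n:ℝ) + 2)
  rw [← hs2]
  field_simp
  ring

theorem integrable_fewFactorPart (h : IsStdSplit g b C κ δ M ρ ε) (n : ℕ) :
    Integrable (fewFactorPart g b n) :=
  (integrable_convPow h.b_int _).add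
    ((integrable_conv h.g_int (integrable_convPow h.b_int _)).const_mul _)

theorem fewFactorPart_nonneg (h : IsStdSplit g b C κ δ M ρ ε) (n : ℕ) (z : ℝ) :
    0 ≤ fewFactorPart g b n z :=
  add_nonneg (convPow_nonneg h.b_nonneg _ _) (mul_nonneg (by positivity)
    (integral_nonneg fun y => mul_nonneg (h.g_nonneg y) (convPow_nonneg h.b_nonneg _ _)))

theorem integral_fewFactorPart_le (h : IsStdSplit g b C κ δ M ρ ε) (n : ℕ) :
    ∫ z, fewFactorPart g b n z ≤ (n + 3) * δ ^ (n + 1) := by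
  have hδ := h.δ_nonneg
  have hb := h.b_mass
  have hb0 := h.integral_b_nonneg
  unfold fewFactorPart
  rw [integral_add (integrable_convPow h.b_int _)
    ((integrable_conv h.g_int (integrable_convPow h.b_int _)).const_mul _), integral_const_mul,
    integral_conv h.g_int (integrable_convPow h.b_int _), integral_convPow h.b_int,
    integral_convPow h.b_int]
  have h1 : (∫ x, b x) ^ (n + 1 + 1) ≤ δ ^ (n + 1) :=
    (pow_le_pow_left₀ hb0 hb _).trans (pow_le_pow_of_le_one hδ h.δ_le (by omega))
  have h2 : (∫ x, g x) * (∫ x, b x) ^ (n + 1) ≤ 1 * δ ^ (n + 1) :=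
    mul_le_mul h.integral_g_le (pow_le_pow_left₀ hb0 hb _) (by positivity) zero_le_one
  nlinarith [(Nat.cast_nonneg n : (0:ℝ) ≤ n)]

theorem local_limit (h : IsStdSplit g b C κ δ M ρ ε) (hρ : 0 ≤ ρ) (n : ℕ) :
    ∀ᵐ z, |convPow (fun x => g x + b x) (n + 2) z - fewFactorPart g b n z -
      (√(2 * π * (n + 2)))⁻¹ * exp (-(z ^ 2 / (2 * (n + 2))))| ≤ lltErr C κ δ M ρ ε n := by
  have hN : (0:ℝ) < n + 2 := by positivity
  obtain ⟨iE, vE⟩ := h.integral_errBound_le hρ n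
  have iγ : Integrable fun z : ℝ => (√(2 * π * (n + 2)))⁻¹ * exp (-(z ^ 2 / (2 * (n + 2)))) := by
    refine ((integrable_exp_neg_mul_sq (b := (2 * (n + 2 : ℝ))⁻¹) (by positivity)).congr
      (ae_of_all _ fun z => ?_)).const_mul _
    simp only
    congr 1; field_simp
  have ir := h.integrable_fewFactorPart n
  have ic := integrable_convPow h.sum_int (n + 2)
  have i1 := integrable_conv h.g_int (integrable_convPow h.b_int (n + 1))
  have := ae_abs_le_of_norm_ft_le ((ic.sub ir).sub iγ) iE fun w => ?_
  · filter_upwards [this] with z hz using hz.trans vE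
  · refine le_trans (le_of_eq ?_) (h.norm_ft_rem_le hρ n w)
    congr 1
    have e : (((convPow (fun x => g x + b x) (n + 2)) - fewFactorPart g b n) -
        fun z : ℝ => (√(2 * π * (n + 2)))⁻¹ * exp (-(z ^ 2 / (2 * (n + 2))))) = fun z =>
        convPow (fun x => g x + b x) (n + 2) z + (-1) * (fewFactorPart g b n z +
        (√(2 * π * (n + 2)))⁻¹ * exp (-(z ^ 2 / (2 * (n + 2))))) := by
      ext z; simp only [Pi.sub_apply]; ring
    have er : ft (fewFactorPart g b n) w = ft b w ^ (n + 2) + (n + 2) * (ft g w * ft b w ^ (n + 1)) := by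
      unfold fewFactorPart
      rw [ft_add (integrable_convPow h.b_int _) (i1.const_mul _), ft_const_mul,
        ft_convolution h.g_int (integrable_convPow h.b_int (n + 1)), ft_convPow h.b_int,
        ft_convPow h.b_int]
      push_cast; ring
    rw [e, ft_add ic ((ir.fun_add iγ).const_mul _), ft_const_mul, ft_add ir iγ, ft_gaussian hN, er,
      ft_convPow h.sum_int]
    push_cast; ring

end IsStdSplit

theorem integral_pow_mul_exp_neg_Ici {Λ : ℝ} (hΛ : 0 < Λ) (k : ℕ) :
    IntegrableOn (fun z : ℝ => z ^ k * exp (-(Λ * z))) (Ici 0) ∧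
      ∫ z in Ici (0:ℝ), z ^ k * exp (-(Λ * z)) = k.factorial / Λ ^ (k + 1) := by
  have h : ∫ z in Ici (0:ℝ), z ^ k * exp (-(Λ * z)) = k.factorial / Λ ^ (k + 1) := by
    rw [integral_Ici_eq_integral_Ioi]
    have := Real.integral_rpow_mul_exp_neg_mul_Ioi (a := k + 1) (r := Λ) (by positivity) hΛ
    rw [add_sub_cancel_right, Real.Gamma_nat_eq_factorial] at this
    simp only [rpow_natCast] at this
    rw [this, one_div, show (k + 1 : ℝ) = ((k + 1 : ℕ) : ℝ) by push_cast; ring, rpow_natCast]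
    rw [inv_pow]
    field_simp
  refine ⟨?_, h⟩
  refine Integrable.of_integral_ne_zero ?_
  rw [h]
  positivity

namespace IsStdSplit

variable {g b : ℝ → ℝ} {C κ δ M ρ ε : ℝ}

theorem abs_laplace_tail_sub_one_le (h : IsStdSplit g b C κ δ M ρ ε) (hρ : 0 ≤ ρ) (n : ℕ) {Λ : ℝ}
    (hΛ : 0 < Λ) :
    |(∫ z in Ici (0:ℝ), exp (-(Λ * z)) * convPow (fun x => g x + b x) (n + 2) z) *
        (√(2 * π * (n + 2)) * Λ) - 1| ≤
      √(2 * π * (n + 2)) * lltErr C κ δ M ρ ε n +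
        √(2 * π * (n + 2)) * Λ * ((n + 3) * δ ^ (n + 1)) + 1 / ((n + 2) * Λ ^ 2) := by
  have hN : (0:ℝ) < n + 2 := by positivity
  have hS : 0 < √(2 * π * (n + 2)) := by positivity
  set S := √(2 * π * (n + 2)) with hSdef
  set η := lltErr C κ δ M ρ ε n
  obtain ⟨k0, v0⟩ := integral_pow_mul_exp_neg_Ici hΛ 0
  obtain ⟨k2, v2⟩ := integral_pow_mul_exp_neg_Ici hΛ 2
  simp only [pow_zero, one_mul, Nat.factorial, Nat.cast_one, zero_add, pow_one] at k0 v0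
  have ir := h.integrable_fewFactorPart n
  have ic := integrable_convPow h.sum_int (n + 2)
  have hbd : ∀ F : ℝ → ℝ, Integrable F →
      IntegrableOn (fun z => exp (-(Λ * z)) * F z) (Ici 0) := fun F hF => by
    refine Integrable.bdd_mul (c := 1) hF.integrableOn (by fun_prop) ?_
    filter_upwards [ae_restrict_mem measurableSet_Ici] with z hz
    rw [Real.norm_of_nonneg (exp_nonneg _)]
    exact exp_le_one_iff.2 (by nlinarith [mem_Ici.1 hz])
  have iγ : Integrable fun z : ℝ => S⁻¹ * exp (-(z ^ 2 / (2 * (n + 2)))) := by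
    refine ((integrable_exp_neg_mul_sq (b := (2 * (n + 2 : ℝ))⁻¹) (by positivity)).congr
      (ae_of_all _ fun z => ?_)).const_mul _
    simp only
    congr 1; field_simp
  have jc := hbd _ ic
  have jr := hbd _ ir
  have jγ := hbd _ iγ
  have h1 : |∫ z in Ici (0:ℝ), (exp (-(Λ * z)) * convPow (fun x => g x + b x) (n + 2) z -
      exp (-(Λ * z)) * fewFactorPart g b n z -
      exp (-(Λ * z)) * (S⁻¹ * exp (-(z ^ 2 / (2 * (n + 2))))))| ≤ η / Λ := by
    have : η / Λ = ∫ z in Ici (0:ℝ), η * exp (-(Λ * z)) := by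
      rw [integral_const_mul, v0]; field_simp
    rw [this]
    refine norm_integral_le_of_norm_le (f := fun z => (exp (-(Λ * z)) *
      convPow (fun x => g x + b x) (n + 2) z - exp (-(Λ * z)) * fewFactorPart g b n z -
      exp (-(Λ * z)) * (S⁻¹ * exp (-(z ^ 2 / (2 * (n + 2))))))) (k0.const_mul η) ?_
    filter_upwards [ae_restrict_of_ae (h.local_limit hρ n)] with z hz
    rw [← mul_sub, ← mul_sub, norm_mul, Real.norm_of_nonneg (exp_nonneg _), mul_comm,
      Real.norm_eq_abs]
    exact mul_le_mul_of_nonneg_right hz (exp_nonneg _)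
  have jcr : IntegrableOn (fun z => exp (-(Λ * z)) * convPow (fun x => g x + b x) (n + 2) z -
      exp (-(Λ * z)) * fewFactorPart g b n z) (Ici 0) := jc.sub jr
  rw [integral_sub jcr jγ, integral_sub jc jr] at h1
  have h2 : ∫ z in Ici (0:ℝ), exp (-(Λ * z)) * fewFactorPart g b n z ≤ (n + 3) * δ ^ (n + 1) := by
    refine le_trans ?_ (h.integral_fewFactorPart_le n)
    refine le_trans (setIntegral_mono_on jr ir.integrableOn measurableSet_Ici fun z hz => ?_)
      (setIntegral_le_integral ir (ae_of_all _ (h.fewFactorPart_nonneg n)))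
    exact mul_le_of_le_one_left (h.fewFactorPart_nonneg n z)
      (exp_le_one_iff.2 (by nlinarith [mem_Ici.1 hz]))
  have h2' : 0 ≤ ∫ z in Ici (0:ℝ), exp (-(Λ * z)) * fewFactorPart g b n z :=
    integral_nonneg fun z => mul_nonneg (exp_nonneg _) (h.fewFactorPart_nonneg n z)
  have h3 : ∫ z in Ici (0:ℝ), exp (-(Λ * z)) * (S⁻¹ * exp (-(z ^ 2 / (2 * (n + 2))))) ≤
      S⁻¹ * (1 / Λ) := by
    rw [← v0, ← integral_const_mul]
    refine setIntegral_mono_on jγ (k0.const_mul _) measurableSet_Ici fun z _ => ?_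
    have : exp (-(z ^ 2 / (2 * (n + 2)))) ≤ 1 := exp_le_one_iff.2 (by
      rw [neg_nonpos]; positivity)
    calc _ = S⁻¹ * exp (-(Λ * z)) * exp (-(z ^ 2 / (2 * (n + 2)))) := by ring
      _ ≤ _ := mul_le_of_le_one_right (by positivity) this
  have h4 : S⁻¹ * (1 / Λ - (2 * (n + 2 : ℝ))⁻¹ * (2 / Λ ^ 3)) ≤
      ∫ z in Ici (0:ℝ), exp (-(Λ * z)) * (S⁻¹ * exp (-(z ^ 2 / (2 * (n + 2))))) := by
    have v2' : ∫ z in Ici (0:ℝ), z ^ 2 * exp (-(Λ * z)) = 2 / Λ ^ 3 := by rw [v2]; norm_num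
    rw [← v0, ← v2', ← integral_const_mul, ← integral_sub k0 (Integrable.const_mul k2 _),
      ← integral_const_mul]
    refine setIntegral_mono_on ((k0.sub (k2.const_mul _)).const_mul _) jγ measurableSet_Ici
      fun z _ => ?_
    have := add_one_le_exp (-(z ^ 2 / (2 * (n + 2 : ℝ))))
    calc _ = S⁻¹ * exp (-(Λ * z)) * (-(z ^ 2 / (2 * (n + 2))) + 1) := by
          field_simp; ring
      _ ≤ S⁻¹ * exp (-(Λ * z)) * exp (-(z ^ 2 / (2 * (n + 2)))) :=
        mul_le_mul_of_nonneg_left this (by positivity)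
      _ = _ := by ring
  set J := ∫ z in Ici (0:ℝ), exp (-(Λ * z)) * convPow (fun x => g x + b x) (n + 2) z
  set R := ∫ z in Ici (0:ℝ), exp (-(Λ * z)) * fewFactorPart g b n z
  set G := ∫ z in Ici (0:ℝ), exp (-(Λ * z)) * (S⁻¹ * exp (-(z ^ 2 / (2 * (n + 2)))))
  have hSΛ : 0 < S * Λ := by positivity
  have a1 : |(J - R - G) * (S * Λ)| ≤ S * η := by
    rw [abs_mul, abs_of_pos hSΛ]
    calc _ ≤ η / Λ * (S * Λ) := by gcongr
      _ = _ := by field_simp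
  have a2 : R * (S * Λ) ≤ S * Λ * ((n + 3) * δ ^ (n + 1)) := by rw [mul_comm]; gcongr
  have a2' : 0 ≤ R * (S * Λ) := by positivity
  have a3 : G * (S * Λ) ≤ 1 := by
    calc _ ≤ S⁻¹ * (1 / Λ) * (S * Λ) := by gcongr
      _ = _ := by field_simp
  have a4 : 1 - 1 / ((n + 2) * Λ ^ 2) ≤ G * (S * Λ) := by
    calc _ = S⁻¹ * (1 / Λ - (2 * (n + 2 : ℝ))⁻¹ * (2 / Λ ^ 3)) * (S * Λ) := by field_simp
      _ ≤ _ := by gcongr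
  have a5 := abs_le.1 a1
  have a6 : 0 ≤ 1 / ((n + 2) * Λ ^ 2) := by positivity
  rw [abs_le]
  constructor <;> nlinarith

end IsStdSplit

theorem integral_comp_add_mul (F : ℝ → ℝ) (m : ℝ) {s : ℝ} (hs : 0 < s) :
    ∫ y, F (m + s * y) = s⁻¹ * ∫ v, F v := by
  rw [Measure.integral_comp_mul_left (fun v => F (m + v)), integral_add_left_eq_self,
    abs_of_pos (inv_pos.2 hs), smul_eq_mul]

theorem setIntegral_Ici_comp_add_mul (F : ℝ → ℝ) (m : ℝ) {s : ℝ} (hs : 0 < s) :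
    ∫ v in Ici m, F v = s * ∫ z in Ici (0:ℝ), F (m + s * z) := by
  have h := integral_comp_add_mul ((Ici m).indicator F) m hs
  rw [integral_indicator measurableSet_Ici] at h
  have e : (fun z => (Ici m).indicator F (m + s * z)) =
      (Ici (0:ℝ)).indicator fun z => F (m + s * z) := by
    ext z
    simp only [indicator, mem_Ici, le_add_iff_nonneg_right, mul_nonneg_iff_of_pos_left hs]
  rw [e, integral_indicator measurableSet_Ici] at h
  rw [h, mul_inv_cancel_left₀ hs.ne']

theorem convPow_affine_tilt {p f : ℝ → ℝ} {A B m s : ℝ} (hs : 0 < s)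
    (hf : ∀ z, f z = A * exp (B * z) * p (m + s * z)) :
    ∀ (n : ℕ) (z : ℝ), convPow f (n + 1) z =
      A ^ (n + 1) * (s⁻¹) ^ n * exp (B * z) * convPow p (n + 1) ((n + 1) * m + s * z)
  | 0, z => by simp [convPow, hf]
  | n + 1, z => by
    have h := integral_comp_add_mul
      (fun v => p v * convPow p (n + 1) ((((n + 1 : ℕ) : ℝ) + 1) * m + s * z - v)) m hs
    change ∫ y, f y * convPow f (n + 1) (z - y) = _ * ∫ v, _ 
    have e : (fun y => f y * convPow f (n + 1) (z - y)) = fun y =>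
        (A ^ (n + 2) * (s⁻¹) ^ n * exp (B * z)) * (p (m + s * y) *
          convPow p (n + 1) ((((n + 1 : ℕ) : ℝ) + 1) * m + s * z - (m + s * y))) := by
      ext y
      rw [convPow_affine_tilt hs hf n (z - y), hf y,
        show (((n + 1 : ℕ) : ℝ) + 1) * m + s * z - (m + s * y) = (n + 1) * m + s * (z - y) by
          push_cast; ring,
        show exp (B * z) = exp (B * y) * exp (B * (z - y)) by rw [← exp_add]; ring_nf]
      ring
    rw [e, integral_const_mul, h]
    ring

/-- The tail of a convolution power through an exponentially tilted and standardised density. -/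
theorem setIntegral_convPow_eq {p f : ℝ → ℝ} {Φ t m s : ℝ} (hs : 0 < s) (hΦ : 0 < Φ)
    (hf : ∀ z, f z = s * exp (t * m) / Φ * exp (t * s * z) * p (m + s * z)) (n : ℕ) :
    ∫ v in Ici ((n + 1) * m), convPow p (n + 1) v =
      exp (-((n + 1) * (m * t - log Φ))) *
        ∫ z in Ici (0:ℝ), exp (-(t * s * z)) * convPow f (n + 1) z := by
  rw [setIntegral_Ici_comp_add_mul _ _ hs, ← integral_const_mul, ← integral_const_mul]
  congr 1
  ext z
  rw [convPow_affine_tilt hs hf]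
  have e1 : exp (-((n + 1) * (m * t - log Φ))) = (Φ * (exp (t * m))⁻¹) ^ (n + 1) := by
    rw [← exp_neg]
    nth_rw 2 [← exp_log hΦ]
    rw [← exp_add, ← exp_nat_mul]
    congr 1; push_cast; ring
  rw [e1, exp_neg]
  have := exp_pos (t * m)
  have := exp_pos (t * s * z)
  rw [mul_pow, div_pow, mul_pow, inv_pow, inv_pow]
  field_simp
  ring

theorem tendsto_add_two_pow_mul_pow {r : ℝ} (h0 : 0 < r) (h1 : r < 1) (k : ℕ) :
    Tendsto (fun n : ℕ => ((n : ℝ) + 2) ^ k * r ^ n) atTop (𝓝 0) := by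
  have h := (tendsto_add_atTop_iff_nat 2).2
    (tendsto_pow_const_mul_const_pow_of_abs_lt_one k (r := r) (by rwa [abs_of_pos h0]))
  have h' := h.mul_const (r ^ 2)⁻¹
  rw [zero_mul] at h'
  refine h'.congr fun n => ?_
  push_cast
  rw [pow_add]
  field_simp

theorem tendsto_add_two_pow_mul_seq_pow {r : ℝ} (h0 : 0 < r) (h1 : r < 1) {u : ℕ → ℝ}
    (hu0 : ∀ᶠ n in atTop, 0 ≤ u n) (hu : ∀ᶠ n in atTop, u n ≤ r) (k : ℕ) :
    Tendsto (fun n : ℕ => ((n : ℝ) + 2) ^ k * u n ^ n) atTop (𝓝 0) := by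
  refine squeeze_zero' ?_ ?_ (tendsto_add_two_pow_mul_pow h0 h1 k)
  · filter_upwards [hu0] with n hn
    positivity
  · filter_upwards [hu0, hu] with n h0 h1
    gcongr

theorem tendsto_lltErr {κ δ : ℕ → ℝ} {C M ρ ε : ℝ} (hρ0 : 0 ≤ ρ) (hρ1 : ρ < 1) (hε : 0 < ε)
    (hκ : Tendsto κ atTop (𝓝 0)) (hδ : Tendsto δ atTop (𝓝 0)) (hδ0 : ∀ᶠ n in atTop, 0 ≤ δ n) :
    Tendsto (fun n : ℕ => (n + 2) * lltErr C (κ n) (δ n) M ρ ε n) atTop (𝓝 0) := by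
  have hn : Tendsto (fun n : ℕ => (n : ℝ) + 2) atTop atTop :=
    tendsto_atTop_add_const_right _ _ tendsto_natCast_atTop_atTop
  have t1 : Tendsto (fun n => κ n * gaussMom 3) atTop (𝓝 0) := by
    simpa using hκ.mul_const (gaussMom 3)
  have t2 : Tendsto (fun n : ℕ => (4 * C + 1) * gaussMom 4 / √((n : ℝ) + 2)) atTop (𝓝 0) :=
    tendsto_const_nhds.div_atTop (tendsto_sqrt_atTop.comp hn)
  have t3 := tendsto_add_two_pow_mul_seq_pow (r := 1 / 2) (by norm_num) (by norm_num) hδ0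
    ((hδ.eventually (gt_mem_nhds (by norm_num : (0:ℝ) < 1 / 2))).mono fun _ h => h.le) 2
  have t3' : Tendsto (fun n : ℕ => ((n : ℝ) + 2) * (n + 3) * δ n ^ (n + 1)) atTop (𝓝 0) := by
    have hq : Tendsto (fun n : ℕ => 1 + 1 / ((n : ℝ) + 2)) atTop (𝓝 1) := by
      simpa using (tendsto_const_nhds (x := (1 : ℝ))).add ((tendsto_const_nhds (x := (1 : ℝ))).div_atTop hn)
    have := (t3.mul hδ).mul hq
    simp only [zero_mul] at this
    refine this.congr fun n => ?_
    rw [pow_succ]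
    field_simp
    ring
  have t4 : Tendsto (fun n : ℕ => ((n : ℝ) + 2) * exp (-((n + 2) * ε ^ 2 / 4))) atTop (𝓝 0) := by
    have hr : exp (-(ε ^ 2 / 4)) < 1 := exp_lt_one_iff.2 (by have := pow_pos hε 2; linarith)
    have := (tendsto_add_two_pow_mul_pow (exp_pos _) hr 1).mul_const (exp (-(ε ^ 2 / 2)))
    rw [zero_mul] at this
    refine this.congr fun n => ?_
    rw [← exp_nat_mul, mul_assoc, ← exp_add, pow_one]
    congr 2; ring
  have t5 : Tendsto (fun n : ℕ => ((n : ℝ) + 2) ^ 3 * (ρ + 2 * δ n) ^ n) atTop (𝓝 0) := by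
    refine tendsto_add_two_pow_mul_seq_pow (r := (1 + ρ) / 2) (by linarith) (by linarith) ?_ ?_ 3
    · filter_upwards [hδ0] with n h; positivity
    · filter_upwards [hδ.eventually (gt_mem_nhds (by linarith : (0:ℝ) < (1 - ρ) / 4))] with n h
      linarith
  have := ((t1.add t2).add (((t3'.mul_const (exp 1)).add t4).mul_const (gaussMom 0))).add
    (t5.mul_const M)
  simp only [zero_mul, add_zero] at this
  refine this.congr fun n => ?_
  rw [lltErr]
  field_simp

theorem tendsto_tail_err {κ δ Λ : ℕ → ℝ} {C M ρ ε : ℝ} (hρ0 : 0 ≤ ρ) (hρ1 : ρ < 1) (hε : 0 < ε)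
    (hκ : Tendsto κ atTop (𝓝 0)) (hδ : Tendsto δ atTop (𝓝 0)) (hδ0 : ∀ᶠ n in atTop, 0 ≤ δ n)
    (hΛ : Tendsto Λ atTop atTop) (hΛδ : Tendsto (fun n => Λ n * δ n) atTop (𝓝 0)) :
    Tendsto (fun n : ℕ => √((n : ℝ) + 2) * (√(2 * π * (n + 2)) * lltErr C (κ n) (δ n) M ρ ε n +
        √(2 * π * (n + 2)) * Λ n * ((n + 3) * δ n ^ (n + 1)) + 1 / ((n + 2) * Λ n ^ 2)))
      atTop (𝓝 0) := by
  have hn : Tendsto (fun n : ℕ => (n : ℝ) + 2) atTop atTop :=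
    tendsto_atTop_add_const_right _ _ tendsto_natCast_atTop_atTop
  have t1 := (tendsto_lltErr (C := C) (M := M) hρ0 hρ1 hε hκ hδ hδ0).const_mul (√(2 * π))
  have t3 := tendsto_add_two_pow_mul_seq_pow (r := 1 / 2) (by norm_num) (by norm_num) hδ0
    ((hδ.eventually (gt_mem_nhds (by norm_num : (0:ℝ) < 1 / 2))).mono fun _ h => h.le) 2
  have t3' : Tendsto (fun n : ℕ => √(2 * π) * (((n : ℝ) + 2) * (n + 3) * Λ n * δ n ^ (n + 1)))
      atTop (𝓝 0) := by
    have hq : Tendsto (fun n : ℕ => 1 + 1 / ((n : ℝ) + 2)) atTop (𝓝 1) := by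
      simpa using (tendsto_const_nhds (x := (1 : ℝ))).add ((tendsto_const_nhds (x := (1 : ℝ))).div_atTop hn)
    have := ((t3.mul hΛδ).mul hq).const_mul (√(2 * π))
    simp only [zero_mul, mul_zero] at this
    refine this.congr fun n => ?_
    rw [pow_succ]
    field_simp
    ring
  have t4 : Tendsto (fun n : ℕ => 1 / (√((n : ℝ) + 2) * Λ n ^ 2)) atTop (𝓝 0) := by
    simp only [one_div]
    exact ((tendsto_sqrt_atTop.comp hn).atTop_mul_atTop₀
      ((tendsto_pow_atTop two_ne_zero).comp hΛ)).inv_tendsto_atTop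
  have := (t1.add t3').add t4
  simp only [mul_zero, add_zero] at this
  refine this.congr' ?_
  filter_upwards with n
  have hN : (0:ℝ) < n + 2 := by positivity
  have hs : 0 < √((n:ℝ) + 2) := sqrt_pos.2 hN
  have hs2 : √((n:ℝ) + 2) * √((n:ℝ) + 2) = n + 2 := mul_self_sqrt hN.le
  rw [sqrt_mul (by positivity : (0:ℝ) ≤ 2 * π) ((n : ℝ) + 2)]
  have e : 1 / (√((n : ℝ) + 2) * Λ n ^ 2) = √((n:ℝ) + 2) * (1 / ((n + 2) * Λ n ^ 2)) := by
    generalize √((n:ℝ) + 2) = s at *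
    rw [← hs2]
    by_cases h0 : Λ n = 0
    · simp [h0]
    · field_simp
  rw [e]
  generalize √((n:ℝ) + 2) = s at *
  rw [← hs2]
  ring

theorem integrable_pow_mul_of_integrable_four {f : ℝ → ℝ} (hf0 : ∀ x, 0 ≤ f x) (hf : Integrable f)
    (h4 : Integrable fun x => x ^ 4 * f x) {k : ℕ} (hk : k ≤ 4) :
    Integrable fun x => x ^ k * f x := by
  refine (hf.add h4).mono' ((by fun_prop : Continuous fun x : ℝ => x ^ k).aestronglyMeasurable.mul
    hf.aestronglyMeasurable) (ae_of_all _ fun x => ?_)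
  have : |x| ^ k ≤ 1 + x ^ 4 := by
    have e : x ^ 4 = |x| ^ 4 := (Even.pow_abs (by decide) x).symm
    rcases le_total |x| 1 with h | h
    · have := pow_le_one₀ (n := k) (abs_nonneg x) h
      have : 0 ≤ x ^ 4 := by rw [e]; positivity
      linarith
    · have := pow_le_pow_right₀ h hk
      rw [e]; linarith
  simp only [Pi.add_apply]
  rw [norm_mul, norm_pow, Real.norm_eq_abs, Real.norm_of_nonneg (hf0 x)]
  nlinarith [hf0 x]

theorem integral_cubic_mul {f : ℝ → ℝ} (hf0 : ∀ x, 0 ≤ f x) (hf : Integrable f)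
    (h4 : Integrable fun x => x ^ 4 * f x) (a₀ a₁ a₂ a₃ : ℝ) :
    Integrable (fun x => (a₀ + a₁ * x + a₂ * x ^ 2 + a₃ * x ^ 3) * f x) ∧
    ∫ x, (a₀ + a₁ * x + a₂ * x ^ 2 + a₃ * x ^ 3) * f x =
      a₀ * (∫ x, f x) + a₁ * (∫ x, x * f x) + a₂ * (∫ x, x ^ 2 * f x) +
        a₃ * ∫ x, x ^ 3 * f x := by
  have i1 : Integrable fun x => x * f x := by
    simpa using integrable_pow_mul_of_integrable_four hf0 hf h4 (k := 1) (by norm_num)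
  have j0 := hf.const_mul a₀
  have j1 := i1.const_mul a₁
  have j2 := (integrable_pow_mul_of_integrable_four hf0 hf h4 (k := 2) (by norm_num)).const_mul a₂
  have j3 := (integrable_pow_mul_of_integrable_four hf0 hf h4 (k := 3) (by norm_num)).const_mul a₃
  have e : (fun x => (a₀ + a₁ * x + a₂ * x ^ 2 + a₃ * x ^ 3) * f x) = fun x =>
      a₀ * f x + a₁ * (x * f x) + a₂ * (x ^ 2 * f x) + a₃ * (x ^ 3 * f x) := by
    ext x; ring
  rw [e]
  refine ⟨((j0.add j1).add j2).add j3, ?_⟩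
  rw [integral_add ((j0.fun_add j1).fun_add j2) j3, integral_add (j0.fun_add j1) j2,
    integral_add j0 j1]
  simp only [integral_const_mul]

/-- Affine change of variables for a density. -/
theorem integral_mul_affine (F f : ℝ → ℝ) (e : ℝ) {d : ℝ} (hd : 0 < d) :
    ∫ z, F z * (d * f (e + d * z)) = ∫ w, F ((w - e) / d) * f w := by
  have h := integral_comp_add_mul (fun v => F ((v - e) / d) * (d * f v)) e hd
  have e1 : (fun z => F ((e + d * z - e) / d) * (d * f (e + d * z))) = fun z =>
      F z * (d * f (e + d * z)) := by
    ext z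
    rw [show (e + d * z - e) / d = z by field_simp; ring]
  rw [e1] at h
  rw [h, ← integral_const_mul]
  congr 1; ext v; field_simp

theorem integrable_mul_affine {F f : ℝ → ℝ} (e : ℝ) {d : ℝ} (hd : 0 < d)
    (h : Integrable fun w => F ((w - e) / d) * f w) :
    Integrable fun z => F z * (d * f (e + d * z)) := by
  have h1 := (((h.comp_add_left e).comp_mul_left' hd.ne').const_mul d)
  refine h1.congr (ae_of_all _ fun z => ?_)
  simp only
  rw [show (e + d * z - e) / d = z by field_simp; ring]
  ring

theorem norm_ft_affine (f : ℝ → ℝ) (e : ℝ) {d : ℝ} (hd : 0 < d) (w : ℝ) :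
    ‖ft (fun z => d * f (e + d * z)) w‖ = ‖ft f (w / d)‖ := by
  rw [ft_const_mul, ft_apply, ft_apply]
  have h2 : ∫ z : ℝ, Complex.exp (-(2 * π * z * w : ℝ) * Complex.I) * (f (e + d * z) : ℂ) =
      ((d⁻¹ : ℝ) : ℂ) * ∫ v : ℝ,
        Complex.exp (-(2 * π * (v - e) * (w / d) : ℝ) * Complex.I) * (f v : ℂ) := by
    have h3 := Measure.integral_comp_mul_left (fun v : ℝ =>
      Complex.exp (-(2 * π * (e + v - e) * (w / d) : ℝ) * Complex.I) * (f (e + v) : ℂ)) d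
    rw [integral_add_left_eq_self (fun v : ℝ =>
      Complex.exp (-(2 * π * (v - e) * (w / d) : ℝ) * Complex.I) * (f v : ℂ)) e,
      abs_of_pos (inv_pos.2 hd), Complex.real_smul] at h3
    rw [← h3]
    congr 1; ext z
    rw [show 2 * π * (e + d * z - e) * (w / d) = 2 * π * z * w by field_simp; ring]
  have h4 : ∫ v : ℝ, Complex.exp (-(2 * π * (v - e) * (w / d) : ℝ) * Complex.I) * (f v : ℂ) =
      Complex.exp ((2 * π * e * (w / d) : ℝ) * Complex.I) *
        ∫ v : ℝ, Complex.exp (-(2 * π * v * (w / d) : ℝ) * Complex.I) * (f v : ℂ) := by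
    rw [← integral_const_mul]
    congr 1; ext v
    rw [← mul_assoc, ← Complex.exp_add]
    congr 2; push_cast; ring
  rw [h2, h4, norm_mul, norm_mul, norm_mul, Complex.norm_exp_ofReal_mul_I, one_mul,
    Complex.norm_real, Complex.norm_real, ← mul_assoc, norm_inv,
    mul_inv_cancel₀ (norm_ne_zero_iff.2 hd.ne'), one_mul]

/-- The standard Gaussian density. -/
def stdGauss (w : ℝ) : ℝ := (√(2 * π))⁻¹ * exp (-(w ^ 2 / 2))

theorem integrable_stdGauss : Integrable stdGauss := by
  unfold stdGauss
  refine ((integrable_exp_neg_mul_sq (b := 1 / 2) (by norm_num)).congr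
    (ae_of_all _ fun z => ?_)).const_mul _
  simp only
  congr 1; ring

theorem ft_stdGauss (w : ℝ) : ft stdGauss w = ((exp (-((2 * π * w) ^ 2 / 2)) : ℝ) : ℂ) := by
  have := ft_gaussian one_pos w
  simp only [mul_one, one_mul] at this
  exact this

/-- The mean of a density. -/
def densMean (f : ℝ → ℝ) : ℝ := ∫ w, w * f w

/-- The standard deviation of a density. -/
def densSd (f : ℝ → ℝ) : ℝ := √((∫ w, w ^ 2 * f w) - densMean f ^ 2)

theorem isStdSplit_of_close {G B : ℝ → ℝ} {M η : ℝ} (hG0 : ∀ w, 0 ≤ G w) (hB0 : ∀ w, 0 ≤ B w)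
    (hG : Integrable G) (hB : Integrable B) (h4 : Integrable fun w => w ^ 4 * (G w + B w))
    (h0 : ∫ w, (G w + B w) = 1) (hM : ∀ w, G w ≤ M)
    (hmean : |densMean fun w => G w + B w| ≤ 1 / 8)
    (hsd : 99 / 100 ≤ densSd fun w => G w + B w) (hsd' : (densSd fun w => G w + B w) ≤ 2)
    (hm4 : ∫ w, w ^ 4 * (G w + B w) ≤ 16 / 5)
    (hm3 : |(∫ w, w ^ 3 * (G w + B w)) - 3 * (densMean fun w => G w + B w) *
      (∫ w, w ^ 2 * (G w + B w)) + 2 * (densMean fun w => G w + B w) ^ 3| ≤ η) (hη : 2 * η ≤ 1)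
    (hb : ∫ w, B w ≤ 1) (hL : ∫ w, |G w + B w - stdGauss w| ≤ (1 - exp (-(1 / 8192))) / 2) :
    IsStdSplit (fun z => densSd (fun w => G w + B w) *
        G (densMean (fun w => G w + B w) + densSd (fun w => G w + B w) * z))
      (fun z => densSd (fun w => G w + B w) *
        B (densMean (fun w => G w + B w) + densSd (fun w => G w + B w) * z))
      30 (2 * η) (∫ w, B w) (2 * M) ((1 + exp (-(1 / 8192))) / 2) (1 / 32) := by
  set e := densMean fun w => G w + B w with he
  set d := densSd fun w => G w + B w with hd'
  have hd : 0 < d := by linarith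
  have f0 : ∀ w, 0 ≤ G w + B w := fun w => add_nonneg (hG0 w) (hB0 w)
  have hf : Integrable fun w => G w + B w := hG.add hB
  have hd2 : d ^ 2 = (∫ w, w ^ 2 * (G w + B w)) - e ^ 2 := by
    rw [hd', densSd, sq_sqrt]
    by_contra hneg
    rw [hd', densSd, sqrt_eq_zero_of_nonpos (not_le.1 hneg).le] at hd
    exact lt_irrefl _ hd
  have fz : (fun z => d * G (e + d * z) + d * B (e + d * z)) = fun z =>
      d * (fun w => G w + B w) (e + d * z) := by ext z; simp only; ring
  have fz' : ∀ z, d * G (e + d * z) + d * B (e + d * z) =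
      d * (fun w => G w + B w) (e + d * z) := congrFun fz
  have aff : ∀ u : ℝ → ℝ, Integrable u → Integrable fun z => d * u (e + d * z) := fun u hu => by
    have := integrable_mul_affine (F := fun _ => 1) (f := u) e hd (by simpa using hu)
    simpa using this
  have hcub := fun a₀ a₁ a₂ a₃ => (integral_cubic_mul f0 hf h4 a₀ a₁ a₂ a₃).2
  have he1 : ∫ w, w * (G w + B w) = e := rfl
  have hq4 : ∀ w, ((w - e) / d) ^ 4 * (G w + B w) ≤
      8 / d ^ 4 * (w ^ 4 * (G w + B w) + e ^ 4 * (G w + B w)) := by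
    intro w
    rw [← add_mul, ← mul_assoc]
    refine mul_le_mul_of_nonneg_right ?_ (f0 w)
    rw [div_pow, div_mul_eq_mul_div]
    gcongr
    have h1 : (w - e) ^ 2 ≤ 2 * (w ^ 2 + e ^ 2) := by nlinarith [sq_nonneg (w + e)]
    calc (w - e) ^ 4 = ((w - e) ^ 2) ^ 2 := by ring
      _ ≤ (2 * (w ^ 2 + e ^ 2)) ^ 2 := by gcongr
      _ ≤ _ := by nlinarith [sq_nonneg (w ^ 2 - e ^ 2)]
  constructor
  · exact fun z => mul_nonneg hd.le (hG0 _)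
  · exact fun z => mul_nonneg hd.le (hB0 _)
  · exact aff G hG
  · exact aff B hB
  · rw [fz]
    have := integral_mul_affine (fun _ => 1) (fun w => G w + B w) e hd
    simp only [one_mul] at this
    rw [this, h0]
  · simp only [fz']
    rw [integral_mul_affine (fun z => z) (fun w => G w + B w) e hd]
    have := hcub (-(e / d)) (1 / d) 0 0
    rw [h0, he1] at this
    rw [show (fun w => (w - e) / d * (G w + B w)) = fun w => (-(e / d) + 1 / d * w + 0 * w ^ 2 +
      0 * w ^ 3) * (G w + B w) by ext w; ring, this]
    ring
  · simp only [fz']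
    rw [integral_mul_affine (fun z => z ^ 2) (fun w => G w + B w) e hd]
    have := hcub (e ^ 2 / d ^ 2) (-(2 * e / d ^ 2)) (1 / d ^ 2) 0
    rw [h0, he1] at this
    rw [show (fun w => ((w - e) / d) ^ 2 * (G w + B w)) = fun w => (e ^ 2 / d ^ 2 +
      -(2 * e / d ^ 2) * w + 1 / d ^ 2 * w ^ 2 +
      0 * w ^ 3) * (G w + B w) by ext w; field_simp; ring, this,
      show (∫ w, w ^ 2 * (G w + B w)) = d ^ 2 + e ^ 2 by rw [hd2]; ring]
    field_simp
    ring
  · simp only [fz']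
    refine integrable_mul_affine (F := fun z => z ^ 4) (f := fun w => G w + B w) e hd ?_
    refine (((h4.add (hf.const_mul (e ^ 4))).const_mul (8 / d ^ 4))).mono'
      ((by fun_prop : Continuous fun w : ℝ => ((w - e) / d) ^ 4).aestronglyMeasurable.mul
        hf.aestronglyMeasurable) (ae_of_all _ fun w => ?_)
    have := f0 w
    rw [Real.norm_of_nonneg (by positivity)]
    exact hq4 w
  · simp only [fz']
    rw [integral_mul_affine (fun z => z ^ 4) (fun w => G w + B w) e hd]
    refine (integral_mono_of_nonneg (ae_of_all _ fun w => mul_nonneg (by positivity) (f0 w))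
      ((h4.add (hf.const_mul (e ^ 4))).const_mul (8 / d ^ 4)) (ae_of_all _ hq4)).trans ?_
    simp only [Pi.add_apply]
    rw [integral_const_mul, integral_add h4 (hf.const_mul _), integral_const_mul, h0]
    have d4 : (24 / 25 : ℝ) ≤ d ^ 4 := by
      calc (24 / 25 : ℝ) ≤ (99 / 100) ^ 4 := by norm_num
        _ ≤ _ := by gcongr
    have e4 : e ^ 4 ≤ 1 / 10 := by
      rw [← Even.pow_abs (by decide) e]
      calc |e| ^ 4 ≤ (1 / 8) ^ 4 := by gcongr
        _ ≤ _ := by norm_num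
    rw [div_mul_eq_mul_div, div_le_iff₀ (by positivity)]
    linarith
  · simp only [fz']
    rw [integral_mul_affine (fun z => z ^ 3) (fun w => G w + B w) e hd]
    have := hcub (-(e ^ 3 / d ^ 3)) (3 * e ^ 2 / d ^ 3) (-(3 * e / d ^ 3)) (1 / d ^ 3)
    rw [h0, he1] at this
    rw [show (fun w => ((w - e) / d) ^ 3 * (G w + B w)) = fun w => (-(e ^ 3 / d ^ 3) +
      (3 * e ^ 2 / d ^ 3) * w + -(3 * e / d ^ 3) * w ^ 2 + 1 / d ^ 3 * w ^ 3) * (G w + B w) by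
        ext w; field_simp; ring, this]
    have e2 : -(e ^ 3 / d ^ 3) * 1 + 3 * e ^ 2 / d ^ 3 * e +
        -(3 * e / d ^ 3) * (∫ w, w ^ 2 * (G w + B w)) + 1 / d ^ 3 * (∫ w, w ^ 3 * (G w + B w)) =
        ((∫ w, w ^ 3 * (G w + B w)) - 3 * e * (∫ w, w ^ 2 * (G w + B w)) + 2 * e ^ 3) / d ^ 3 := by
      field_simp; ring
    rw [e2, abs_div, abs_of_pos (by positivity : 0 < d ^ 3), div_le_iff₀ (by positivity)]
    have : (1:ℝ) / 2 ≤ d ^ 3 := by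
      calc (1:ℝ) / 2 ≤ (99 / 100) ^ 3 := by norm_num
        _ ≤ _ := by gcongr
    have hη0 : 0 ≤ η := (abs_nonneg _).trans hm3
    nlinarith
  · exact hη
  · have := integral_mul_affine (fun _ => 1) B e hd
    simp only [one_mul] at this
    rw [this]
  · exact hb
  · intro z
    exact mul_le_mul hsd' (hM _) (hG0 _) (by norm_num)
  · norm_num
  · norm_num
  · norm_num
  · intro w hw
    rw [fz, norm_ft_affine (fun w => G w + B w) e hd]
    have e1 : (fun w => G w + B w) = fun w => (G w + B w - stdGauss w) + stdGauss w := by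
      ext w; ring
    have i1 : Integrable fun w => G w + B w - stdGauss w := hf.sub integrable_stdGauss
    rw [e1, ft_add i1 integrable_stdGauss, ft_stdGauss]
    refine (norm_add_le _ _).trans ?_
    have a1 := (norm_ft_le (fun w => G w + B w - stdGauss w) (w / d)).trans hL
    have a2 : exp (-((2 * π * (w / d)) ^ 2 / 2)) ≤ exp (-(1 / 8192)) := by
      refine exp_le_exp.2 (neg_le_neg ?_)
      have : (1 / 64) ≤ |2 * π * (w / d)| := by
        rw [← mul_div_assoc, abs_div, abs_of_pos hd, le_div_iff₀ hd]
        linarith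
      rw [← sq_abs]
      nlinarith
    rw [Complex.norm_real, Real.norm_of_nonneg (exp_nonneg _)]
    linarith

/-- The measure on `ℝ` with density `p`. -/
def densMeasure (p : ℝ → ℝ) : Measure ℝ := volume.withDensity fun x => ENNReal.ofReal (p x)

theorem integral_densMeasure {p : ℝ → ℝ} (hp0 : ∀ x, 0 ≤ p x) (hp : Integrable p) (F : ℝ → ℝ) :
    ∫ x, F x ∂(densMeasure p) = ∫ x, F x * p x := by
  rw [densMeasure, integral_withDensity_eq_integral_toReal_smul₀
    hp.aestronglyMeasurable.aemeasurable.ennreal_ofReal (ae_of_all _ fun x => by simp)]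
  refine integral_congr_ae (ae_of_all _ fun x => ?_)
  simp [ENNReal.toReal_ofReal (hp0 x), mul_comm]

theorem integrable_densMeasure_iff {p : ℝ → ℝ} (hp0 : ∀ x, 0 ≤ p x) (hp : Integrable p)
    (F : ℝ → ℝ) : Integrable F (densMeasure p) ↔ Integrable fun x => F x * p x := by
  rw [densMeasure, integrable_withDensity_iff_integrable_smul₀'
    hp.aestronglyMeasurable.aemeasurable.ennreal_ofReal (ae_of_all _ fun x => by simp)]
  simp only [ENNReal.toReal_ofReal (hp0 _), smul_eq_mul, mul_comm]

theorem setIntegral_Ici_zero_eq {p : ℝ → ℝ} (hpzero : ∀ x < (0 : ℝ), p x = 0) (F : ℝ → ℝ) :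
    ∫ x in Ici (0 : ℝ), F x * p x = ∫ x, F x * p x :=
  setIntegral_eq_integral_of_forall_compl_eq_zero fun x hx => by
    rw [hpzero x (not_le.1 hx), mul_zero]

theorem integrable_exp_mul_dens {p : ℝ → ℝ} (hpzero : ∀ x < (0 : ℝ), p x = 0)
    (hp : Integrable p)
    (hPhi : ∀ t > (0:ℝ), IntegrableOn (fun x => exp (t * x) * p x) (Ici 0)) (t : ℝ) :
    Integrable fun x => exp (t * x) * p x := by
  rcases lt_or_ge 0 t with ht | ht
  · refine (integrableOn_iff_integrable_of_support_subset fun x hx => ?_).1 (hPhi t ht)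
    by_contra hneg
    exact hx (by simp [hpzero x (not_le.1 hneg)])
  · refine hp.norm.mono' (by fun_prop) (ae_of_all _ fun x => ?_)
    rcases lt_or_ge x 0 with hx | hx
    · simp [hpzero x hx]
    · rw [norm_mul, Real.norm_eq_abs, abs_exp]
      exact mul_le_of_le_one_left (norm_nonneg _)
        (exp_le_one_iff.2 (mul_nonpos_of_nonpos_of_nonneg ht hx))

/-- A probability density carried by `[0, ∞)` all of whose exponential moments are finite. -/
structure IsExpDensity (p : ℝ → ℝ) : Prop where
  nonneg : ∀ x, 0 ≤ p x
  eq_zero : ∀ x < (0 : ℝ), p x = 0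
  int : Integrable p
  mass : ∫ x, p x = 1
  int_exp : ∀ t, Integrable fun x => exp (t * x) * p x

namespace IsExpDensity

variable {p : ℝ → ℝ}

theorem mem_interior (hp : IsExpDensity p) (t : ℝ) :
    t ∈ interior (ProbabilityTheory.integrableExpSet id (densMeasure p)) := by
  have : ProbabilityTheory.integrableExpSet id (densMeasure p) = univ :=
    eq_univ_of_forall fun t =>
      (integrable_densMeasure_iff hp.nonneg hp.int _).2 (hp.int_exp t)
  simp [this]

theorem int_pow (hp : IsExpDensity p) (t : ℝ) (k : ℕ) :
    Integrable fun x => x ^ k * (exp (t * x) * p x) := by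
  have := ProbabilityTheory.integrable_pow_mul_exp_of_mem_interior_integrableExpSet
    (hp.mem_interior t) k
  rw [integrable_densMeasure_iff hp.nonneg hp.int] at this
  simpa [mul_assoc] using this

theorem mgfFun_eq (hp : IsExpDensity p) (t : ℝ) : mgfFun p t = ∫ x, exp (t * x) * p x :=
  setIntegral_Ici_zero_eq hp.eq_zero _

theorem mgf_eq (hp : IsExpDensity p) :
    ProbabilityTheory.mgf id (densMeasure p) = mgfFun p := by
  ext t
  rw [hp.mgfFun_eq, ProbabilityTheory.mgf, integral_densMeasure hp.nonneg hp.int]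
  rfl

theorem densMeasure_ne_zero (hp : IsExpDensity p) : densMeasure p ≠ 0 := fun h => by
  have := integral_densMeasure hp.nonneg hp.int fun _ => 1
  simp [h, hp.mass] at this

theorem mgfFun_pos (hp : IsExpDensity p) (t : ℝ) : 0 < mgfFun p t := by
  rw [← hp.mgf_eq]
  exact ProbabilityTheory.mgf_pos' hp.densMeasure_ne_zero
    (interior_subset (s := ProbabilityTheory.integrableExpSet id (densMeasure p))
      (hp.mem_interior t))

theorem mFun_eq_deriv_cgf (hp : IsExpDensity p) :
    mFun p = deriv (ProbabilityTheory.cgf id (densMeasure p)) := by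
  simp only [mFun, ← hp.mgf_eq]
  rfl

theorem mFun_eq (hp : IsExpDensity p) (t : ℝ) :
    mFun p t = (∫ x, x * (exp (t * x) * p x)) / mgfFun p t := by
  rw [hp.mFun_eq_deriv_cgf, ProbabilityTheory.deriv_cgf (hp.mem_interior t), hp.mgf_eq,
    integral_densMeasure hp.nonneg hp.int]
  simp [mul_assoc]

theorem s2Fun_eq_iteratedDeriv (hp : IsExpDensity p) (t : ℝ) :
    s2Fun p t = iteratedDeriv 2 (ProbabilityTheory.cgf id (densMeasure p)) t := by
  rw [s2Fun, hp.mFun_eq_deriv_cgf, iteratedDeriv_succ, iteratedDeriv_one]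

theorem s2Fun_eq (hp : IsExpDensity p) (t : ℝ) :
    s2Fun p t = (∫ x, x ^ 2 * (exp (t * x) * p x)) / mgfFun p t - mFun p t ^ 2 := by
  rw [hp.s2Fun_eq_iteratedDeriv, ProbabilityTheory.iteratedDeriv_two_cgf (hp.mem_interior t),
    hp.mgf_eq, integral_densMeasure hp.nonneg hp.int, ← hp.mFun_eq_deriv_cgf]
  simp [mul_assoc]

theorem s2Fun_nonneg (hp : IsExpDensity p) (t : ℝ) : 0 ≤ s2Fun p t := by
  rw [hp.s2Fun_eq_iteratedDeriv,
    ProbabilityTheory.iteratedDeriv_two_cgf_eq_integral (hp.mem_interior t), hp.mgf_eq]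
  exact div_nonneg (integral_nonneg fun x => by positivity) (hp.mgfFun_pos t).le

theorem monotone_mFun (hp : IsExpDensity p) : Monotone (mFun p) := by
  refine monotone_of_deriv_nonneg (fun t => ?_) hp.s2Fun_nonneg
  rw [hp.mFun_eq_deriv_cgf]
  exact (ProbabilityTheory.analyticAt_cgf (hp.mem_interior t)).deriv.differentiableAt

theorem tendsto_of_mFun_eq (hp : IsExpDensity p) {a u : ℕ → ℝ} (ha : Tendsto a atTop atTop)
    (hu : ∀ n, mFun p (u n) = a n) : Tendsto u atTop atTop := by
  refine tendsto_atTop.2 fun b => ?_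
  filter_upwards [ha.eventually_gt_atTop (mFun p b)] with n hn
  by_contra! hlt
  exact absurd (hp.monotone_mFun hlt.le) (by rw [hu]; exact not_le.2 hn)

end IsExpDensity

theorem hasDerivAt_integral_div {ε : ℝ → ℝ} (hε : Continuous ε) {x : ℝ} (hx : 1 < x) :
    HasDerivAt (fun y => ∫ u in (1:ℝ)..y, ε u / u) (ε x / x) x := by
  have hc : ContinuousOn (fun u => ε u / u) (Ioi 0) :=
    hε.continuousOn.div continuousOn_id fun u hu => ne_of_gt hu
  have hx0 : (0 : ℝ) < x := by linarith
  refine intervalIntegral.integral_hasDerivAt_right ?_ ?_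
    (hc.continuousAt (Ioi_mem_nhds hx0))
  · refine (hc.mono fun u hu => ?_).intervalIntegrable
    rw [uIcc_of_le hx.le] at hu
    exact lt_of_lt_of_le one_pos hu.1
  · exact ContinuousOn.stronglyMeasurableAtFilter isOpen_Ioi hc x hx0

/-- First-order expansion of an increment of `exp ∘ L` along a slowly varying elasticity `r`. -/
theorem tendsto_mul_exp_increment {L r x τ : ℝ → ℝ} {X : ℝ}
    (hL : ∀ y, X < y → HasDerivAt L (r y / y) y) (hr0 : ∀ᶠ t in atTop, r (x t) ≠ 0)
    (hx : Tendsto x atTop atTop) (hτ0 : ∀ᶠ t in atTop, τ t ≠ 0)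
    (hτ : Tendsto (fun t => τ t / x t) atTop (𝓝 0))
    (hr : ∀ ξ : ℝ → ℝ, Tendsto (fun t => ξ t / x t) atTop (𝓝 1) →
      Tendsto (fun t => r (ξ t) / r (x t)) atTop (𝓝 1))
    (hA : Tendsto (fun t => x t / (τ t * r (x t))) atTop atTop) (w : ℝ) :
    Tendsto (fun t => x t / (τ t * r (x t)) * (exp (L (x t + τ t * w) - L (x t)) - 1))
      atTop (𝓝 w) := by
  have hτw : Tendsto (fun t => |τ t / x t * w|) atTop (𝓝 0) := by
    simpa using (hτ.mul_const w).abs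
  have key : ∀ t, ∃ s ∈ Icc (0 : ℝ) 1, (∀ s ∈ Icc (0 : ℝ) 1, X < x t + τ t * w * s) →
      L (x t + τ t * w) - L (x t) =
        r (x t + τ t * w * s) / (x t + τ t * w * s) * (τ t * w) := fun t => by
    by_cases hg : ∀ s ∈ Icc (0 : ℝ) 1, X < x t + τ t * w * s
    · have hd : ∀ s ∈ Icc (0 : ℝ) 1, HasDerivAt (fun s => L (x t + τ t * w * s))
          (r (x t + τ t * w * s) / (x t + τ t * w * s) * (τ t * w)) s := fun s hs => by
        have h1 : HasDerivAt (fun s : ℝ => x t + τ t * w * s) (τ t * w) s := by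
          simpa using ((hasDerivAt_id s).const_mul (τ t * w)).const_add (x t)
        exact (hL _ (hg s hs)).comp s h1
      obtain ⟨s, hs, e⟩ := exists_hasDerivAt_eq_slope _ _ one_pos
        (fun s hs => (hd s hs).continuousAt.continuousWithinAt)
        (fun s hs => hd s (Ioo_subset_Icc_self hs))
      refine ⟨s, Ioo_subset_Icc_self hs, fun _ => ?_⟩
      rw [e]
      simp
    · exact ⟨0, by simp, fun h => absurd h hg⟩
  choose s hs hsL using key
  set ξ : ℝ → ℝ := fun t => x t + τ t * w * s t with hξ
  have hξx : Tendsto (fun t => ξ t / x t) atTop (𝓝 1) := by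
    have h1 : Tendsto (fun t => 1 + τ t / x t * w * s t) atTop (𝓝 (1 + 0)) := by
      refine tendsto_const_nhds.add (squeeze_zero_norm (fun t => ?_) hτw)
      rw [norm_mul, Real.norm_eq_abs, Real.norm_eq_abs, abs_of_nonneg (hs t).1]
      exact mul_le_of_le_one_right (abs_nonneg _) (hs t).2
    rw [add_zero] at h1
    refine h1.congr' ?_
    filter_upwards [hx.eventually_gt_atTop 0] with t ht
    simp only [hξ]
    field_simp
  have hgood : ∀ᶠ t in atTop, ∀ s ∈ Icc (0 : ℝ) 1, X < x t + τ t * w * s := by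
    filter_upwards [hx.eventually_gt_atTop 0, hx.eventually_gt_atTop (2 * X),
      hτw.eventually_le_const (by norm_num : (0 : ℝ) < 1 / 2)] with t h0 h1 h2 s hs
    have h3 : |τ t / x t * w * s| ≤ 1 / 2 := by
      rw [abs_mul, abs_of_nonneg hs.1]
      exact (mul_le_of_le_one_right (abs_nonneg _) hs.2).trans h2
    have h4 : x t + τ t * w * s = x t * (1 + τ t / x t * w * s) := by field_simp
    rw [h4]
    nlinarith [(abs_le.1 h3).1]
  have hlin : Tendsto (fun t => x t / (τ t * r (x t)) * (L (x t + τ t * w) - L (x t)))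
      atTop (𝓝 w) := by
    have h1 : Tendsto (fun t => w * (r (ξ t) / r (x t)) * (ξ t / x t)⁻¹) atTop
        (𝓝 (w * 1 * 1⁻¹)) := ((hr ξ hξx).const_mul w).mul (hξx.inv₀ one_ne_zero)
    rw [mul_one, inv_one, mul_one] at h1
    refine h1.congr' ?_
    filter_upwards [hgood, hr0, hτ0] with t hg h2 h3
    rw [hsL t hg, inv_div]
    simp only [hξ]
    field_simp
  have hΔ : Tendsto (fun t => L (x t + τ t * w) - L (x t)) atTop (𝓝 0) := by
    have := hlin.mul (tendsto_inv_atTop_zero.comp hA)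
    rw [mul_zero] at this
    refine this.congr' ?_
    filter_upwards [hA.eventually_gt_atTop 0] with t ht
    simp only [Function.comp]
    rw [mul_right_comm, mul_inv_cancel₀ ht.ne', one_mul]
  have hquad : Tendsto (fun t => x t / (τ t * r (x t)) *
      (exp (L (x t + τ t * w) - L (x t)) - 1 - (L (x t + τ t * w) - L (x t)))) atTop (𝓝 0) := by
    have h1 := (hlin.mul hΔ).abs
    rw [mul_zero, abs_zero] at h1
    refine squeeze_zero_norm' ?_ h1
    filter_upwards [hΔ.abs.eventually_le_const (by simp : |(0 : ℝ)| < 1)] with t ht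
    rw [Real.norm_eq_abs, abs_mul, mul_assoc, abs_mul _ ((_ - _) * _), ← pow_two, abs_pow, sq_abs]
    exact mul_le_mul_of_nonneg_left (abs_exp_sub_one_sub_id_le ht) (abs_nonneg _)
  have := hquad.add hlin
  rw [zero_add] at this
  exact this.congr fun t => by ring

/-- `xh t` is an approximate saddle point of `t * x - ∫ h`, with Gaussian scale `σ t`. -/
structure IsSaddleScale (h : ℝ → ℝ) (x₀ : ℝ) (xh σ : ℝ → ℝ) : Prop where
  mono : MonotoneOn h (Ici x₀)
  h_top : Tendsto h atTop atTop
  σ_pos : ∀ᶠ t in atTop, 0 < σ t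
  xh_top : Tendsto xh atTop atTop
  ratio_top : Tendsto (fun t => xh t / σ t) atTop atTop
  lin : ∀ w, Tendsto (fun t => σ t * (h (xh t + σ t * w) - t)) atTop (𝓝 w)
  tσ_top : Tendsto (fun t => t * σ t) atTop atTop
  tσ_le : ∀ᶠ t in atTop, t * σ t ≤ (xh t / σ t) ^ 2

/-- A function with positive limiting elasticity `r` eventually increases to infinity. -/
theorem exists_monotoneOn_of_elasticity {h r L : ℝ → ℝ} {β X : ℝ} (hβ : 0 < β)
    (hr : Tendsto r atTop (𝓝 β)) (hL : ∀ y, X < y → HasDerivAt L (r y / y) y)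
    (hh : ∀ y, X < y → h y = exp (L y)) :
    ∃ x₀, X < x₀ ∧ 0 < x₀ ∧ (∀ y ≥ x₀, β / 2 ≤ r y) ∧ MonotoneOn h (Ici x₀) ∧
      Tendsto h atTop atTop := by
  obtain ⟨x₀, h1, h2, h3⟩ : ∃ x₀, X < x₀ ∧ 0 < x₀ ∧ ∀ y ≥ x₀, β / 2 ≤ r y := by
    obtain ⟨x₁, hx₁⟩ := eventually_atTop.1 (hr.eventually_const_le (by linarith : β / 2 < β))
    exact ⟨max x₁ (max (X + 1) 1), by simp, by simp,
      fun y hy => hx₁ y ((le_max_left _ _).trans hy)⟩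
  have hmono : MonotoneOn (fun y => L y - β / 2 * log y) (Ici x₀) := by
    have hd : ∀ y ∈ Ici x₀, HasDerivAt (fun y => L y - β / 2 * log y)
        (r y / y - β / 2 * y⁻¹) y := fun y hy =>
      (hL y (lt_of_lt_of_le h1 hy)).sub
        ((hasDerivAt_log (lt_of_lt_of_le h2 hy).ne').const_mul _)
    refine monotoneOn_of_hasDerivWithinAt_nonneg (f' := fun y => r y / y - β / 2 * y⁻¹)
      (convex_Ici x₀)
      (fun y hy => (hd y hy).continuousAt.continuousWithinAt)
      (fun y hy => (hd y (interior_subset hy)).hasDerivWithinAt) fun y hy => ?_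
    have hy' : x₀ ≤ y := interior_subset hy
    rw [div_eq_mul_inv, ← sub_mul]
    exact mul_nonneg (sub_nonneg.2 (h3 y hy')) (inv_nonneg.2 (h2.le.trans hy'))
  have hLm : MonotoneOn L (Ici x₀) := fun a ha b hb hab => by
    have := hmono ha hb hab
    have h5 := log_le_log (lt_of_lt_of_le h2 ha) hab
    simp only at this
    nlinarith
  refine ⟨x₀, h1, h2, h3, fun a ha b hb hab => ?_, ?_⟩
  · rw [hh a (lt_of_lt_of_le h1 ha), hh b (lt_of_lt_of_le h1 hb)]
    exact exp_le_exp.2 (hLm ha hb hab)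
  · have : Tendsto (fun y => (L x₀ - β / 2 * log x₀) + β / 2 * log y) atTop atTop :=
      tendsto_atTop_add_const_left _ _ (tendsto_log_atTop.const_mul_atTop (by positivity))
    refine tendsto_atTop_mono' _ ?_ (tendsto_exp_atTop.comp this)
    filter_upwards [eventually_ge_atTop x₀] with y hy
    have := hmono self_mem_Ici hy hy
    simp only at this
    rw [hh y (lt_of_lt_of_le h1 hy), Function.comp]
    exact exp_le_exp.2 (by linarith)

/-- Approximate inverse at infinity of a continuous function tending to infinity. -/
theorem exists_tendsto_rightInverse {h : ℝ → ℝ} {x₀ : ℝ} (hm : MonotoneOn h (Ici x₀))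
    (hc : ContinuousOn h (Ici x₀)) (ht : Tendsto h atTop atTop) :
    ∃ xh : ℝ → ℝ, Tendsto xh atTop atTop ∧ ∀ᶠ t in atTop, h (xh t) = t := by
  have : ∀ t, ∃ x, h x₀ ≤ t → x₀ ≤ x ∧ h x = t := fun t => by
    by_cases hle : h x₀ ≤ t
    · obtain ⟨b, hb1, hb2⟩ := (ht.eventually_ge_atTop t |>.and (eventually_ge_atTop x₀)).exists
      obtain ⟨x, hx, e⟩ := intermediate_value_Icc hb2 (hc.mono Icc_subset_Ici_self) ⟨hle, hb1⟩
      exact ⟨x, fun _ => ⟨hx.1, e⟩⟩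
    · exact ⟨0, fun h => absurd h hle⟩
  choose xh hxh using this
  refine ⟨xh, tendsto_atTop.2 fun b => ?_, ?_⟩
  · filter_upwards [eventually_ge_atTop (h x₀), eventually_gt_atTop (h (max b x₀))] with t h1 h2
    obtain ⟨h3, h4⟩ := hxh t h1
    by_contra! hlt
    have := hm h3 (le_max_right b x₀) (hlt.le.trans (le_max_left _ _))
    linarith
  · filter_upwards [eventually_ge_atTop (h x₀)] with t h1
    exact (hxh t h1).2

theorem MemRbeta.exists_isSaddleScale {h : ℝ → ℝ} {β : ℝ} (hh : MemRbeta h β) :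
    ∃ x₀ xh σ, IsSaddleScale h x₀ xh σ := by
  obtain ⟨hβ, l, ε, ε', ε'', ⟨hε, -, hε0, hl⟩, hev, -, -⟩ := hh
  obtain ⟨X, hX1, hX⟩ : ∃ X, 1 ≤ X ∧ ∀ x ≥ X, h x = x ^ β * l x := by
    obtain ⟨X, hX⟩ := eventually_atTop.1 hev
    exact ⟨max X 1, le_max_right _ _, fun x hx => hX x ((le_max_left _ _).trans hx)⟩
  set r : ℝ → ℝ := fun y => β + ε y with hrdef
  set L : ℝ → ℝ := fun y => β * log y + ∫ u in (1:ℝ)..y, ε u / u with hLdef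
  have hεc : Continuous ε := continuous_iff_continuousAt.2 fun x => (hε x).continuousAt
  have hr : Tendsto r atTop (𝓝 β) := by simpa using hε0.const_add β
  have hL : ∀ y, X < y → HasDerivAt L (r y / y) y := fun y hy => by
    have := ((hasDerivAt_log (by linarith : y ≠ 0)).const_mul β).add
      (hasDerivAt_integral_div hεc (by linarith : 1 < y))
    refine this.congr_deriv ?_
    simp only [hrdef]
    ring
  have hhL : ∀ y, X < y → h y = exp (L y) := fun y hy => by
    have h0 : 0 < y := by linarith
    rw [hX y hy.le, hl y (by linarith), hLdef, exp_add, rpow_def_of_pos h0, mul_comm β]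
  obtain ⟨x₀, hx1, hx0, hrx, hmono, htop⟩ := exists_monotoneOn_of_elasticity hβ hr hL hhL
  have hcont : ContinuousOn h (Ici x₀) := by
    refine ContinuousOn.congr (f := fun y => exp (L y)) (fun y hy => ?_)
      fun y hy => hhL y (lt_of_lt_of_le hx1 hy)
    exact (continuous_exp.continuousAt.comp
      (hL y (lt_of_lt_of_le hx1 hy)).continuousAt).continuousWithinAt
  obtain ⟨xh, hxt, hxe⟩ := exists_tendsto_rightInverse hmono hcont htop
  set y : ℝ → ℝ := fun t => xh t * t * r (xh t) with hy
  have hrxh : Tendsto (fun t => r (xh t)) atTop (𝓝 β) := hr.comp hxt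
  have hytop : Tendsto y atTop atTop := (hxt.atTop_mul_atTop₀ tendsto_id).atTop_mul_pos hβ hrxh
  set σ : ℝ → ℝ := fun t => √(xh t / (t * r (xh t))) with hσ
  have hpos : ∀ᶠ t in atTop, 0 < t ∧ 0 < xh t ∧ β / 2 ≤ r (xh t) ∧ h (xh t) = t := by
    filter_upwards [eventually_gt_atTop 0, hxt.eventually_gt_atTop 0,
      hxt.eventually_ge_atTop x₀, hxe] with t h1 h2 h3 h4
    exact ⟨h1, h2, hrx _ h3, h4⟩
  have hσpos : ∀ᶠ t in atTop, 0 < σ t := by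
    filter_upwards [hpos] with t ⟨h1, h2, h3, _⟩
    have : 0 < r (xh t) := by linarith
    exact sqrt_pos.2 (by positivity)
  have hσsq : ∀ᶠ t in atTop, σ t ^ 2 * (t * r (xh t)) = xh t := by
    filter_upwards [hpos] with t ⟨h1, h2, h3, _⟩
    have : 0 < r (xh t) := by linarith
    rw [hσ, sq_sqrt (by positivity)]
    field_simp
  have hratio : ∀ᶠ t in atTop, (xh t / σ t) ^ 2 = y t := by
    filter_upwards [hpos, hσpos, hσsq] with t ⟨h1, h2, h3, _⟩ h4 h5
    rw [hy, div_pow, div_eq_iff (by positivity)]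
    linear_combination (-xh t) * h5
  have hratio' : ∀ᶠ t in atTop, xh t / σ t = √(y t) := by
    filter_upwards [hpos, hσpos, hratio] with t ⟨h1, h2, h3, _⟩ h4 h5
    rw [← h5, sqrt_sq (by positivity)]
  have htσ : ∀ᶠ t in atTop, t * σ t = √(y t) / r (xh t) := by
    filter_upwards [hpos, hσpos, hσsq, hratio'] with t ⟨h1, h2, h3, _⟩ h4 h5 h6
    have : 0 < r (xh t) := by linarith
    rw [← h6]
    field_simp
    linear_combination h5
  have hsy : Tendsto (fun t => √(y t)) atTop atTop := tendsto_sqrt_atTop.comp hytop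
  have hA : ∀ᶠ t in atTop, xh t / (σ t * r (xh t)) = t * σ t := by
    filter_upwards [htσ, hratio', hσpos] with t h1 h2 h3
    rw [h1, ← h2, div_div]
  have hAtop : Tendsto (fun t => t * σ t) atTop atTop := by
    have : Tendsto (fun t => √(y t) / r (xh t)) atTop atTop :=
      hsy.atTop_mul_pos (inv_pos.2 hβ) (hrxh.inv₀ hβ.ne')
    exact this.congr' (htσ.mono fun t ht => ht.symm)
  have hrat0 : Tendsto (fun t => xh t / σ t) atTop atTop :=
    hsy.congr' (hratio'.mono fun t ht => ht.symm)
  have hτ0 : Tendsto (fun t => σ t / xh t) atTop (𝓝 0) := by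
    refine (tendsto_inv_atTop_zero.comp hrat0).congr fun t => ?_
    simp
  refine ⟨x₀, xh, σ, hmono, htop, hσpos, hxt, hrat0, fun w => ?_, hAtop, ?_⟩
  · have hmain := tendsto_mul_exp_increment (x := xh) (τ := σ) hL
      (hpos.mono fun t ht => by have := ht.2.2.1; exact ne_of_gt (by linarith)) hxt
      (hσpos.mono fun t ht => ht.ne') hτ0 (fun ξ hξ => ?_)
      (hAtop.congr' (hA.mono fun t ht => ht.symm)) w
    · refine hmain.congr' ?_
      have hlarge : ∀ᶠ t in atTop, X < xh t + σ t * w := by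
        have h1 : Tendsto (fun t => xh t * (1 + σ t / xh t * w)) atTop atTop := by
          refine hxt.atTop_mul_pos one_pos ?_
          simpa using (hτ0.mul_const w).const_add 1
        filter_upwards [h1.eventually_gt_atTop X, hpos] with t h2 ⟨_, h3, _⟩
        have e : xh t * (1 + σ t / xh t * w) = xh t + σ t * w := by field_simp
        rwa [e] at h2
      filter_upwards [hlarge, hA, hpos, hxt.eventually_gt_atTop X] with t h1 h2 ⟨h3, h4, h5, h6⟩ h7
      rw [h2, hhL _ h1, exp_sub, ← hhL _ h7, h6]
      field_simp
    · have hξt : Tendsto ξ atTop atTop := by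
        have := hxt.atTop_mul_pos one_pos hξ
        refine this.congr' ?_
        filter_upwards [hpos] with t ⟨_, h3, _⟩
        field_simp
      have := (hr.comp hξt).div hrxh hβ.ne'
      rwa [div_self hβ.ne'] at this
  · filter_upwards [htσ, hratio, hpos, hsy.eventually_ge_atTop (2 / β),
      hytop.eventually_ge_atTop 0] with t h1 h2 ⟨_, _, h3, _⟩ h4 h5
    rw [h1, h2, div_le_iff₀ (by linarith)]
    have h6 : √(y t) * √(y t) = y t := mul_self_sqrt h5
    have h7 : 1 ≤ √(y t) * r (xh t) := by
      calc (1 : ℝ) = 2 / β * (β / 2) := by field_simp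
        _ ≤ _ := mul_le_mul h4 h3 (by positivity) (sqrt_nonneg _)
    nlinarith [sqrt_nonneg (y t)]

theorem lt_of_lt_geninv {h : ℝ → ℝ} {u x : ℝ} (hu : 0 < geninv h u) (hx : x < geninv h u) :
    h x < u := by
  by_contra! hle
  refine absurd (csInf_le ?_ (show x ∈ {x | u ≤ h x} from hle)) (not_le.2 hx)
  by_contra hb
  rw [geninv, sInf_of_not_bddBelow hb] at hu
  exact lt_irrefl _ hu

theorem le_of_geninv_lt {h : ℝ → ℝ} {u x : ℝ} (hm : StrictMonoOn h (Ici 0))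
    (hu : 0 < geninv h u) (hx : geninv h u < x) : u ≤ h x := by
  have hne : {x | u ≤ h x}.Nonempty := by
    by_contra hb
    rw [geninv, not_nonempty_iff_eq_empty.1 hb, sInf_empty] at hu
    exact lt_irrefl _ hu
  obtain ⟨y, hy, hyx⟩ := exists_lt_of_csInf_lt hne hx
  have hy0 : 0 ≤ y := by
    by_contra! hneg
    exact absurd (lt_of_lt_geninv hu (hneg.trans hu)) (not_lt.2 hy)
  exact le_trans hy (hm.monotoneOn hy0 (hy0.trans hyx.le) hyx.le)

theorem abs_log_sub_log_le {ε ε' : ℝ → ℝ} {T b : ℝ} (hT : 0 < T)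
    (hε : ∀ x, HasDerivAt ε (ε' x) x) (hpos : ∀ x ≥ T, 0 < ε x)
    (hb : ∀ x ≥ T, |x * ε' x / ε x| ≤ b) {x y : ℝ} (hx : T ≤ x) (hxy : x ≤ y) :
    |log (ε y) - log (ε x)| ≤ b * (log y - log x) := by
  have hd : ∀ s : ℝ, ∀ z ∈ Ici T, HasDerivAt (fun z => b * log z + s * log (ε z))
      (b * z⁻¹ + s * (ε' z / ε z)) z := fun s z hz =>
    ((hasDerivAt_log (lt_of_lt_of_le hT hz).ne').const_mul b).add
      (((hε z).log (hpos z hz).ne').const_mul s)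
  have hm : ∀ s : ℝ, |s| ≤ 1 → MonotoneOn (fun z => b * log z + s * log (ε z)) (Ici T) :=
      fun s hs => by
    refine monotoneOn_of_hasDerivWithinAt_nonneg (f' := fun z => b * z⁻¹ + s * (ε' z / ε z))
      (convex_Ici T)
      (fun y hy => (hd s y hy).continuousAt.continuousWithinAt)
      (fun y hy => (hd s y (interior_subset hy)).hasDerivWithinAt) fun z hz => ?_
    have hz' : T ≤ z := interior_subset hz
    have hz0 : 0 < z := hT.trans_le hz'
    have h1 := hb z hz'
    have h2 : |s * (z * ε' z / ε z)| ≤ b := by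
      rw [abs_mul]
      exact (mul_le_of_le_one_left (abs_nonneg _) hs).trans h1
    have h3 : b * z⁻¹ + s * (ε' z / ε z) = (b + s * (z * ε' z / ε z)) * z⁻¹ := by
      field_simp
    rw [h3]
    exact mul_nonneg (by linarith [(abs_le.1 h2).1]) (inv_nonneg.2 hz0.le)
  have h1 := hm 1 (by simp) hx (hx.trans hxy) hxy
  have h2 := hm (-1) (by simp) hx (hx.trans hxy) hxy
  simp only at h1 h2
  rw [abs_le]
  constructor <;> linarith

theorem MemRinfty.exists_isSaddleScale {h : ℝ → ℝ} (hh : MemRinfty h) :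
    ∃ x₀ xh σ, IsSaddleScale h x₀ xh σ := by
  obtain ⟨hmono, ε, ε', ε'', hε, -, hψ, hψtop, hlog, -, η, -, c, hc, hlow⟩ := hh
  obtain ⟨T, hT1, hpos, hbd⟩ : ∃ T, 1 ≤ T ∧ (∀ x ≥ T, 0 < ε x) ∧
      ∀ x ≥ T, |x * ε' x / ε x| ≤ 1 / 4 := by
    have h1 := hlog.abs.eventually_le_const (by simp : |(0 : ℝ)| < 1 / 4)
    obtain ⟨T, hT⟩ := eventually_atTop.1 (hlow.and h1)
    refine ⟨max T 1, le_max_right _ _, fun x hx => ?_, fun x hx => ?_⟩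
    · have h2 := (hT x ((le_max_left _ _).trans hx)).1
      have h3 : 0 < x := lt_of_lt_of_le one_pos ((le_max_right _ _).trans hx)
      exact (pos_iff_pos_of_mul_pos (lt_of_lt_of_le hc h2)).1 (rpow_pos_of_pos h3 _)
    · exact (hT x ((le_max_left _ _).trans hx)).2
  have hT0 : 0 < T := by linarith
  have hcmp : ∀ x ≥ T, ∀ y ≥ T, |log (ε y) - log (ε x)| ≤ 1 / 4 * |log y - log x| :=
      fun x hx y hy => by
    rcases le_total x y with hxy | hxy
    · exact (abs_log_sub_log_le hT0 hε hpos hbd hx hxy).trans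
        (mul_le_mul_of_nonneg_left (le_abs_self _) (by norm_num))
    · rw [abs_sub_comm, abs_sub_comm (log y)]
      exact (abs_log_sub_log_le hT0 hε hpos hbd hy hxy).trans
        (mul_le_mul_of_nonneg_left (le_abs_self _) (by norm_num))
  have hεc : Continuous ε := continuous_iff_continuousAt.2 fun x => (hε x).continuousAt
  set P : ℝ → ℝ := fun y => ∫ u in (1:ℝ)..y, ε u / u with hP
  set ψ := geninv h with hψdef
  have hP' : ∀ y, T < y → HasDerivAt P (ε y / y) y := fun y hy =>
    hasDerivAt_integral_div hεc (by linarith)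
  have hψpos : ∀ x ≥ (1 : ℝ), 0 < ψ x := fun x hx => by rw [hψ x hx]; exact exp_pos _
  have hgrow : ∀ s : ℝ, |s| ≤ 3 →
      Tendsto (fun t => log t + s * log (ε t)) atTop atTop := fun s hs => by
    have h1 : Tendsto (fun t => (3 * (1 / 4) * log T - 3 * |log (ε T)|) + 1 / 4 * log t)
        atTop atTop :=
      tendsto_atTop_add_const_left _ _ (tendsto_log_atTop.const_mul_atTop (by norm_num))
    refine tendsto_atTop_mono' _ ?_ h1
    filter_upwards [eventually_ge_atTop T] with t ht
    have h2 := hcmp T le_rfl t ht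
    rw [abs_of_nonneg (sub_nonneg.2 (log_le_log hT0 ht))] at h2
    have h3 : |log (ε t)| ≤ 1 / 4 * (log t - log T) + |log (ε T)| := by
      have := abs_sub_abs_le_abs_sub (log (ε t)) (log (ε T))
      linarith
    have h4 : |s * log (ε t)| ≤ 3 * |log (ε t)| := by
      rw [abs_mul]
      exact mul_le_mul_of_nonneg_right hs (abs_nonneg _)
    have h5 := neg_abs_le (s * log (ε t))
    linarith
  have hev : ∀ᶠ t in atTop, 0 < t ∧ 0 < ε t ∧ 0 < ψ t := by
    filter_upwards [eventually_ge_atTop T] with t ht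
    exact ⟨hT0.trans_le ht, hpos t ht, hψpos t (hT1.trans ht)⟩
  have hmulε : Tendsto (fun t => t * ε t) atTop atTop := by
    refine (tendsto_exp_atTop.comp (hgrow 1 (by norm_num))).congr' ?_
    filter_upwards [hev] with t ⟨h1, h2, _⟩
    rw [Function.comp, one_mul, exp_add, exp_log h1, exp_log h2]
  have hdivε : Tendsto (fun t => t / ε t) atTop atTop := by
    refine (tendsto_exp_atTop.comp (hgrow (-1) (by norm_num))).congr' ?_
    filter_upwards [hev] with t ⟨h1, h2, _⟩
    rw [Function.comp, neg_one_mul, exp_add, exp_log h1, exp_neg, exp_log h2, div_eq_mul_inv]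
  have hcube : ∀ᶠ t in atTop, ε t ^ 3 ≤ t := by
    filter_upwards [hev, (hgrow (-3) (by norm_num)).eventually_ge_atTop 0] with t ⟨h1, h2, _⟩ h3
    rw [← log_le_log_iff (by positivity) h1, log_pow]
    push_cast
    linarith
  set σ : ℝ → ℝ := fun t => √(ψ t * ε t / t) with hσ
  have hσpos : ∀ᶠ t in atTop, 0 < σ t := by
    filter_upwards [hev] with t ⟨h1, h2, h3⟩
    exact sqrt_pos.2 (by positivity)
  have hσsq : ∀ᶠ t in atTop, σ t ^ 2 * t = ψ t * ε t := by
    filter_upwards [hev] with t ⟨h1, h2, h3⟩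
    rw [hσ, sq_sqrt (by positivity)]
    field_simp
  have hratio : ∀ᶠ t in atTop, ψ t / σ t = √(ψ t * (t / ε t)) := by
    filter_upwards [hev, hσpos, hσsq] with t ⟨h1, h2, h3⟩ h4 h5
    have e : (ψ t / σ t) ^ 2 = ψ t * (t / ε t) := by
      rw [div_pow, div_eq_iff (by positivity)]
      field_simp
      linear_combination -h5
    rw [← e, sqrt_sq (by positivity)]
  have hrat : Tendsto (fun t => ψ t / σ t) atTop atTop :=
    (tendsto_sqrt_atTop.comp (hψtop.atTop_mul_atTop₀ hdivε)).congr'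
      (hratio.mono fun t ht => ht.symm)
  have htσ : ∀ᶠ t in atTop, t * σ t = √(ψ t * (t * ε t)) := by
    filter_upwards [hev, hσpos, hσsq] with t ⟨h1, h2, h3⟩ h4 h5
    have e : (t * σ t) ^ 2 = ψ t * (t * ε t) := by linear_combination t * h5
    rw [← e, sqrt_sq (by positivity)]
  have htσtop : Tendsto (fun t => t * σ t) atTop atTop :=
    (tendsto_sqrt_atTop.comp (hψtop.atTop_mul_atTop₀ hmulε)).congr'
      (htσ.mono fun t ht => ht.symm)
  have hA : ∀ᶠ t in atTop, t / ((σ t)⁻¹ * ε t) = ψ t / σ t := by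
    filter_upwards [hev, hσpos, hσsq] with t ⟨h1, h2, h3⟩ h4 h5
    field_simp
    linear_combination h5
  have hτ : Tendsto (fun t => (σ t)⁻¹ / t) atTop (𝓝 0) := by
    refine (tendsto_inv_atTop_zero.comp htσtop).congr fun t => ?_
    simp only [Function.comp, mul_inv]
    ring
  have hlarge : ∀ v, ∀ᶠ t in atTop, T < t + (σ t)⁻¹ * v := fun v => by
    have h1 : Tendsto (fun t => t * (1 + (σ t)⁻¹ / t * v)) atTop atTop := by
      refine tendsto_id.atTop_mul_pos one_pos ?_
      simpa using (hτ.mul_const v).const_add 1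
    filter_upwards [h1.eventually_gt_atTop T, hev] with t h2 ⟨h3, _⟩
    have e : t * (1 + (σ t)⁻¹ / t * v) = t + (σ t)⁻¹ * v := by field_simp
    rwa [e] at h2
  have hlin : ∀ v, Tendsto (fun t => (ψ (t + (σ t)⁻¹ * v) - ψ t) / σ t) atTop (𝓝 v) := fun v => by
    have hmain := tendsto_mul_exp_increment (x := fun t => t) (τ := fun t => (σ t)⁻¹) hP'
      (hev.mono fun t ht => ht.2.1.ne') tendsto_id (hσpos.mono fun t ht => (inv_pos.2 ht).ne') hτ
      (fun ξ hξ => ?_) (hrat.congr' (hA.mono fun t ht => ht.symm)) v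
    · refine hmain.congr' ?_
      filter_upwards [hlarge v, hA, hev, hσpos, eventually_ge_atTop T]
        with t h1 h2 ⟨h3, h4, h5⟩ h6 h7
      have e1 : exp (P t) = ψ t := (hψ t (by linarith)).symm
      have e2 : exp (P (t + (σ t)⁻¹ * v)) = ψ (t + (σ t)⁻¹ * v) := (hψ _ (by linarith)).symm
      rw [h2, exp_sub, e1, e2]
      field_simp
    · have hξt : Tendsto ξ atTop atTop := by
        refine (tendsto_id.atTop_mul_pos one_pos hξ).congr' ?_
        filter_upwards [eventually_gt_atTop 0] with t ht
        simp only [id]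
        field_simp
      have hl : Tendsto (fun t => |log (ξ t / t)|) atTop (𝓝 0) := by
        simpa using (hξ.log one_ne_zero).abs
      have hz : Tendsto (fun t => log (ε (ξ t)) - log (ε t)) atTop (𝓝 0) := by
        refine squeeze_zero_norm' ?_ (by simpa using hl.const_mul (1 / 4))
        filter_upwards [eventually_ge_atTop T, hξt.eventually_ge_atTop T] with t h1 h2
        rw [log_div (by linarith) (by linarith)]
        exact hcmp t h1 _ h2
      have := (continuous_exp.tendsto 0).comp hz
      rw [exp_zero] at this
      refine this.congr' ?_
      filter_upwards [eventually_ge_atTop T, hξt.eventually_ge_atTop T] with t h1 h2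
      rw [Function.comp, exp_sub, exp_log (hpos _ h1), exp_log (hpos _ h2)]
  refine ⟨0, ψ, σ, hmono.monotoneOn, ?_, hσpos, hψtop, hrat, fun w => ?_, htσtop, ?_⟩
  · refine tendsto_atTop.2 fun b => ?_
    filter_upwards [eventually_gt_atTop (ψ (max b 1))] with x hx
    exact (le_max_left _ _).trans
      (le_of_geninv_lt hmono (hψpos _ (le_max_right _ _)) hx)
  · refine tendsto_order.2 ⟨fun v hv => ?_, fun v hv => ?_⟩
    · have hv' : v < (v + w) / 2 := by linarith
      filter_upwards [(hlin ((v + w) / 2)).eventually_lt_const (by linarith : (v + w) / 2 < w),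
        hσpos, hlarge ((v + w) / 2)] with t h1 h2 h3
      rw [div_lt_iff₀ h2] at h1
      have h4 := le_of_geninv_lt hmono (hψpos (t + (σ t)⁻¹ * ((v + w) / 2)) (by linarith))
        (by linarith : ψ (t + (σ t)⁻¹ * ((v + w) / 2)) < ψ t + σ t * w)
      refine hv'.trans_le ?_
      calc (v + w) / 2 = σ t * ((σ t)⁻¹ * ((v + w) / 2)) := by field_simp
        _ ≤ _ := mul_le_mul_of_nonneg_left (by linarith) h2.le
    · have hv' : (v + w) / 2 < v := by linarith
      filter_upwards [(hlin ((v + w) / 2)).eventually_const_lt (by linarith : w < (v + w) / 2),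
        hσpos, hlarge ((v + w) / 2)] with t h1 h2 h3
      rw [lt_div_iff₀ h2] at h1
      have h4 := lt_of_lt_geninv (hψpos (t + (σ t)⁻¹ * ((v + w) / 2)) (by linarith))
        (by linarith : ψ t + σ t * w < ψ (t + (σ t)⁻¹ * ((v + w) / 2)))
      refine lt_of_le_of_lt ?_ hv'
      calc _ ≤ σ t * ((σ t)⁻¹ * ((v + w) / 2)) :=
            mul_le_mul_of_nonneg_left (by linarith) h2.le
        _ = _ := by field_simp
  · filter_upwards [htσ, hratio, hev, hcube, hψtop.eventually_ge_atTop 1]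
      with t h1 h2 ⟨h3, h4, h5⟩ h6 h7
    rw [h1, h2, sq_sqrt (by positivity)]
    refine (sqrt_le_left (by positivity)).2 ?_
    have e : (ψ t * (t / ε t)) ^ 2 = ψ t ^ 2 * t ^ 2 / ε t ^ 2 := by field_simp
    rw [e, le_div_iff₀ (by positivity)]
    calc ψ t * (t * ε t) * ε t ^ 2 = ψ t * t * ε t ^ 3 := by ring
      _ ≤ ψ t * t * (ψ t * t) :=
        mul_le_mul_of_nonneg_left (h6.trans (le_mul_of_one_le_left h3.le h7)) (by positivity)
      _ = _ := by ring

theorem MemFrakR.exists_isSaddleScale {h : ℝ → ℝ} (hh : MemFrakR h) :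
    ∃ x₀ xh σ, IsSaddleScale h x₀ xh σ := by
  rcases hh with ⟨β, hβ⟩ | hinf
  exacts [hβ.exists_isSaddleScale, hinf.exists_isSaddleScale]

theorem integrable_abs_pow_mul_exp_neg_abs {a : ℝ} (ha : 0 < a) (k : ℕ) :
    Integrable fun w : ℝ => |w| ^ k * exp (-(a * |w|)) := by
  refine (integrable_inv_one_add_sq.const_mul
    (k.factorial / a ^ k + (k + 2).factorial / a ^ (k + 2))).mono'
    (by fun_prop) (ae_of_all _ fun w => ?_)
  have hb : ∀ j : ℕ, |w| ^ j ≤ j.factorial / a ^ j * exp (a * |w|) := fun j => by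
    have := pow_div_factorial_le_exp (a * |w|) (by positivity) j
    rw [mul_pow, div_le_iff₀ (by positivity)] at this
    rw [div_mul_eq_mul_div, le_div_iff₀ (by positivity)]
    linarith
  rw [Real.norm_eq_abs, abs_of_nonneg (by positivity), exp_neg, ← div_eq_mul_inv,
    ← div_eq_mul_inv, div_le_div_iff₀ (exp_pos _) (by positivity)]
  have e : |w| ^ k * (1 + w ^ 2) = |w| ^ k + |w| ^ (k + 2) := by
    rw [pow_add, sq_abs]; ring
  rw [e, add_mul]
  exact add_le_add (hb k) (hb (k + 2))

theorem le_of_monotoneOn_deriv {g h : ℝ → ℝ} {x₀ x y : ℝ} (hg : ∀ x, HasDerivAt g (h x) x)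
    (hm : MonotoneOn h (Ici x₀)) (hx : x₀ ≤ x) (hy : x₀ ≤ y) : g x + h x * (y - x) ≤ g y := by
  rcases lt_trichotomy x y with hxy | rfl | hxy
  · obtain ⟨ξ, hξ, e⟩ := exists_hasDerivAt_eq_slope g h hxy
      (fun z _ => (hg z).continuousAt.continuousWithinAt) fun z _ => hg z
    have h1 := hm hx (hx.trans hξ.1.le) hξ.1.le
    rw [e, le_div_iff₀ (by linarith)] at h1
    linarith
  · simp
  · obtain ⟨ξ, hξ, e⟩ := exists_hasDerivAt_eq_slope g h hxy
      (fun z _ => (hg z).continuousAt.continuousWithinAt) fun z _ => hg z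
    have h1 := hm (hy.trans hξ.1.le) hx hξ.2.le
    rw [e, div_le_iff₀ (by linarith)] at h1
    linarith

/-- The exponent of the tilted density around its saddle point. -/
def saddleExponent (g xh σ : ℝ → ℝ) (t w : ℝ) : ℝ :=
  g (xh t + σ t * w) - g (xh t) - t * (σ t * w)

namespace IsSaddleScale

variable {g h xh σ : ℝ → ℝ} {x₀ : ℝ}

theorem inv_ratio (S : IsSaddleScale h x₀ xh σ) : Tendsto (fun t => σ t / xh t) atTop (𝓝 0) :=
  (tendsto_inv_atTop_zero.comp S.ratio_top).congr fun t => by simp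

theorem shift_top (S : IsSaddleScale h x₀ xh σ) (w : ℝ) :
    Tendsto (fun t => xh t + σ t * w) atTop atTop := by
  have h1 : Tendsto (fun t => xh t * (1 + σ t / xh t * w)) atTop atTop := by
    refine S.xh_top.atTop_mul_pos one_pos ?_
    simpa using (S.inv_ratio.mul_const w).const_add 1
  refine h1.congr' ?_
  filter_upwards [S.xh_top.eventually_gt_atTop 0] with t ht
  field_simp

theorem mono_left (S : IsSaddleScale h x₀ xh σ) {x₁ : ℝ} (hx : x₀ ≤ x₁) :
    IsSaddleScale h x₁ xh σ :=
  { S with mono := S.mono.mono (Ici_subset_Ici.2 hx) }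

theorem tendsto_saddleExponent (S : IsSaddleScale h x₀ xh σ) (hg : ∀ x, HasDerivAt g (h x) x)
    (w : ℝ) : Tendsto (fun t => saddleExponent g xh σ t w) atTop (𝓝 (w ^ 2 / 2)) := by
  have hev : ∀ᶠ t in atTop, ∀ r, |r| ≤ |w| → x₀ ≤ xh t + σ t * r := by
    filter_upwards [(S.shift_top (-|w|)).eventually_ge_atTop x₀, S.σ_pos] with t h1 h2 r hr
    nlinarith [(abs_le.1 hr).1]
  have habs : ∀ r ∈ uIcc 0 w, |r| ≤ |w| := fun r hr => by
    rcases le_total 0 w with hw | hw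
    · rw [uIcc_of_le hw] at hr
      rw [abs_of_nonneg hr.1, abs_of_nonneg hw]
      exact hr.2
    · rw [uIcc_of_ge hw] at hr
      rw [abs_of_nonpos hr.2, abs_of_nonpos hw]
      linarith [hr.1]
  have hmono : ∀ᶠ t in atTop, MonotoneOn (fun r => σ t * (h (xh t + σ t * r) - t))
      (Icc (-|w|) |w|) := by
    filter_upwards [hev, S.σ_pos] with t h1 h2 a ha b hb hab
    refine mul_le_mul_of_nonneg_left (sub_le_sub_right ?_ _) h2.le
    exact S.mono (h1 a (abs_le.2 ha)) (h1 b (abs_le.2 hb)) (by nlinarith)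
  have hint : ∀ᶠ t in atTop, IntervalIntegrable (fun r => σ t * (h (xh t + σ t * r) - t))
      volume 0 w := hmono.mono fun t ht =>
    (ht.mono fun r hr => abs_le.1 (habs r hr)).intervalIntegrable
  have heq : ∀ᶠ t in atTop, ∫ r in (0:ℝ)..w, σ t * (h (xh t + σ t * r) - t) =
      saddleExponent g xh σ t w := by
    filter_upwards [hint] with t ht
    rw [intervalIntegral.integral_eq_sub_of_hasDerivAt
      (f := fun r => g (xh t + σ t * r) - t * (σ t * r)) (fun r _ => ?_) ht]
    · simp only [saddleExponent]
      ring_nf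
    · have h1 : HasDerivAt (fun r : ℝ => σ t * r) (σ t) r := by
        simpa using (hasDerivAt_id r).const_mul (σ t)
      refine (((hg _).comp r (h1.const_add (xh t))).sub (h1.const_mul t)).congr_deriv ?_
      ring
  have hlim : Tendsto (fun t => ∫ r in (0:ℝ)..w, σ t * (h (xh t + σ t * r) - t)) atTop
      (𝓝 (∫ r in (0:ℝ)..w, r)) := by
    refine intervalIntegral.tendsto_integral_filter_of_dominated_convergence
      (fun _ => |w| + 1) (hint.mono fun t ht => ht.def'.aestronglyMeasurable) ?_
      intervalIntegrable_const (ae_of_all _ fun r _ => S.lin r)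
    filter_upwards [hmono, (S.lin |w|).eventually_le_const (lt_add_one _),
      (S.lin (-|w|)).eventually_const_le (by linarith : -(|w| + 1) < -|w|)] with t h1 h2 h3
    refine ae_of_all _ fun r hr => ?_
    have hr' := abs_le.1 (habs r (uIoc_subset_uIcc hr))
    have hw := abs_nonneg w
    rw [Real.norm_eq_abs, abs_le]
    exact ⟨h3.trans (h1 (left_mem_Icc.2 (by linarith)) hr' hr'.1),
      (h1 hr' (right_mem_Icc.2 (by linarith)) hr'.2).trans h2⟩
  rw [integral_id] at hlim
  have := hlim.congr' heq
  simpa using this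

theorem le_saddleExponent (S : IsSaddleScale h x₀ xh σ) (hg : ∀ x, HasDerivAt g (h x) x) :
    ∀ᶠ t in atTop, ∀ w, x₀ ≤ xh t + σ t * w → |w| / 4 - 1 ≤ saddleExponent g xh σ t w := by
  filter_upwards [(S.shift_top 0).eventually_ge_atTop x₀, (S.shift_top 1).eventually_ge_atTop x₀,
    (S.shift_top (-1)).eventually_ge_atTop x₀, S.σ_pos,
    (S.lin 0).eventually_le_const (by norm_num : (0 : ℝ) < 1 / 4),
    (S.lin 0).eventually_const_le (by norm_num : -(1 / 4) < (0 : ℝ)),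
    (S.lin 1).eventually_const_le (by norm_num : 3 / 4 < (1 : ℝ)),
    (S.lin (-1)).eventually_le_const (by norm_num : (-1 : ℝ) < -(3 / 4))]
    with t h0 h1 hn1 hσ d0 d0' d1 dn1 w hw
  have tang : ∀ v w, x₀ ≤ xh t + σ t * v → x₀ ≤ xh t + σ t * w →
      saddleExponent g xh σ t v + σ t * (h (xh t + σ t * v) - t) * (w - v) ≤
        saddleExponent g xh σ t w := fun v w hv hw => by
    have := le_of_monotoneOn_deriv hg S.mono hv hw
    simp only [saddleExponent]
    nlinarith
  have z : saddleExponent g xh σ t 0 = 0 := by simp [saddleExponent]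
  have a0 := tang 0 w h0 hw
  have a1 := tang 1 w h1 hw
  have an1 := tang (-1) w hn1 hw
  have b1 := tang 0 1 h0 h1
  have bn1 := tang 0 (-1) h0 hn1
  rw [z] at a0 b1 bn1
  rcases abs_cases w with ⟨e, hw0⟩ | ⟨e, hw0⟩
  · rw [e]
    rcases le_total w 1 with h | h
    · nlinarith
    · nlinarith
  · rw [e]
    rcases le_total (-1) w with h | h
    · nlinarith
    · nlinarith

end IsSaddleScale

theorem integrable_abs_pow_mul_exp_neg_sq_half (k : ℕ) :
    Integrable fun w : ℝ => |w| ^ k * exp (-(w ^ 2 / 2)) :=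
  (integrable_abs_pow_mul_exp_neg_sq (a := 1 / 2) (by norm_num) k).congr
    (ae_of_all _ fun w => by simp only; congr 2; ring)

theorem integrable_pow_mul_exp_neg_sq_half (k : ℕ) :
    Integrable fun w : ℝ => w ^ k * exp (-(w ^ 2 / 2)) := by
  refine (integrable_abs_pow_mul_exp_neg_sq_half k).mono' (by fun_prop)
    (ae_of_all _ fun w => ?_)
  rw [norm_mul, norm_pow, Real.norm_eq_abs, Real.norm_eq_abs, abs_exp]

theorem integral_exp_neg_sq_half : ∫ w : ℝ, exp (-(w ^ 2 / 2)) = √(2 * π) := by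
  have := integral_gaussian (1 / 2)
  rw [show π / (1 / 2) = 2 * π by ring] at this
  rw [← this]
  congr 1; ext w; congr 1; ring

theorem integral_mul_exp_neg_sq_half : ∫ w : ℝ, w * exp (-(w ^ 2 / 2)) = 0 := by
  have h : ∀ w : ℝ, HasDerivAt (fun w => -exp (-(w ^ 2 / 2))) (w * exp (-(w ^ 2 / 2))) w :=
      fun w => by
    have := (((hasDerivAt_pow 2 w).div_const 2).neg.exp).neg
    refine this.congr_deriv ?_
    simp; ring
  refine integral_eq_zero_of_hasDerivAt_of_integrable h ?_ ?_
  · simpa using integrable_pow_mul_exp_neg_sq_half 1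
  · simpa using (integrable_pow_mul_exp_neg_sq_half 0).neg

theorem integral_pow_mul_exp_neg_sq_half (k : ℕ) :
    ∫ w : ℝ, w ^ (k + 2) * exp (-(w ^ 2 / 2)) = (k + 1) * ∫ w : ℝ, w ^ k * exp (-(w ^ 2 / 2)) := by
  have h : ∀ w : ℝ, HasDerivAt (fun w => w ^ (k + 1) * exp (-(w ^ 2 / 2)))
      ((k + 1) * (w ^ k * exp (-(w ^ 2 / 2))) - w ^ (k + 2) * exp (-(w ^ 2 / 2))) w := fun w => by
    have := (hasDerivAt_pow (k + 1) w).mul ((hasDerivAt_pow 2 w).div_const 2).neg.exp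
    refine this.congr_deriv ?_
    simp; ring
  have i1 := (integrable_pow_mul_exp_neg_sq_half k).const_mul ((k : ℝ) + 1)
  have i2 := integrable_pow_mul_exp_neg_sq_half (k + 2)
  have := integral_eq_zero_of_hasDerivAt_of_integrable h (i1.sub i2)
    (integrable_pow_mul_exp_neg_sq_half (k + 1))
  rw [integral_sub i1 i2, integral_const_mul] at this
  linarith

/-- Everything needed to apply Laplace's method to the exponential tilts of the density `p`. -/
structure LaplaceSetup (p g q h : ℝ → ℝ) (c x₀ : ℝ) (xh σ : ℝ → ℝ) : Prop where
  dens : IsExpDensity p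
  scale : IsSaddleScale h x₀ xh σ
  deriv_g : ∀ x, HasDerivAt g (h x) x
  c_pos : 0 < c
  x₀_nonneg : 0 ≤ x₀
  form : ∀ x ≥ (0 : ℝ), p x = c * exp (-(g x - q x))
  q_le : ∀ x ≥ x₀, |q x| ≤ 1
  q_lim : Tendsto q atTop (𝓝 0)

/-- The tilted density, recentred and rescaled at its saddle point. -/
def saddleKernel (p g : ℝ → ℝ) (c : ℝ) (xh σ : ℝ → ℝ) (t w : ℝ) : ℝ :=
  exp (t * (xh t + σ t * w)) * p (xh t + σ t * w) / (c * exp (t * xh t - g (xh t)))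

/-- The part of `saddleKernel` beyond `x₀`. -/
def upperKernel (p g : ℝ → ℝ) (c x₀ : ℝ) (xh σ : ℝ → ℝ) (t w : ℝ) : ℝ :=
  {w | x₀ ≤ xh t + σ t * w}.indicator (saddleKernel p g c xh σ t) w

/-- The part of `saddleKernel` below `x₀`. -/
def lowerKernel (p g : ℝ → ℝ) (c x₀ : ℝ) (xh σ : ℝ → ℝ) (t w : ℝ) : ℝ :=
  {w | x₀ ≤ xh t + σ t * w}ᶜ.indicator (saddleKernel p g c xh σ t) w

namespace LaplaceSetup

variable {p g q h xh σ : ℝ → ℝ} {c x₀ : ℝ}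

theorem upper_add_lower (p g : ℝ → ℝ) (c x₀ : ℝ) (xh σ : ℝ → ℝ) (t w : ℝ) :
    upperKernel p g c x₀ xh σ t w + lowerKernel p g c x₀ xh σ t w = saddleKernel p g c xh σ t w :=
  congrFun (indicator_self_add_compl _ _) w

theorem measurableSet_upper (x₀ : ℝ) (xh σ : ℝ → ℝ) (t : ℝ) :
    MeasurableSet {w | x₀ ≤ xh t + σ t * w} :=
  measurableSet_le measurable_const (by fun_prop)

theorem kernel_nonneg (P : LaplaceSetup p g q h c x₀ xh σ) (t w : ℝ) :
    0 ≤ saddleKernel p g c xh σ t w :=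
  div_nonneg (mul_nonneg (exp_pos _).le (P.dens.nonneg _)) (mul_pos P.c_pos (exp_pos _)).le

theorem upper_nonneg (P : LaplaceSetup p g q h c x₀ xh σ) (t w : ℝ) :
    0 ≤ upperKernel p g c x₀ xh σ t w :=
  indicator_nonneg (fun w _ => P.kernel_nonneg t w) w

theorem lower_nonneg (P : LaplaceSetup p g q h c x₀ xh σ) (t w : ℝ) :
    0 ≤ lowerKernel p g c x₀ xh σ t w :=
  indicator_nonneg (fun w _ => P.kernel_nonneg t w) w

theorem kernel_eq (P : LaplaceSetup p g q h c x₀ xh σ) {t w : ℝ} (hw : x₀ ≤ xh t + σ t * w) :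
    saddleKernel p g c xh σ t w =
      exp (-saddleExponent g xh σ t w + q (xh t + σ t * w)) := by
  rw [saddleKernel, P.form _ (P.x₀_nonneg.trans hw), mul_left_comm,
    mul_div_mul_left _ _ P.c_pos.ne', ← exp_add, ← exp_sub, saddleExponent]
  ring_nf

theorem upper_le (P : LaplaceSetup p g q h c x₀ xh σ) :
    ∀ᶠ t in atTop, ∀ w, upperKernel p g c x₀ xh σ t w ≤ exp 2 * exp (-(1 / 4 * |w|)) := by
  filter_upwards [P.scale.le_saddleExponent P.deriv_g] with t ht w
  by_cases hw : x₀ ≤ xh t + σ t * w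
  · rw [upperKernel, indicator_of_mem (show w ∈ {w | x₀ ≤ xh t + σ t * w} from hw),
      P.kernel_eq hw, ← exp_add]
    refine exp_le_exp.2 ?_
    linarith [ht w hw, (abs_le.1 (P.q_le _ hw)).2]
  · rw [upperKernel, indicator_of_notMem (show w ∉ {w | x₀ ≤ xh t + σ t * w} from hw)]
    positivity

theorem tendsto_upper (P : LaplaceSetup p g q h c x₀ xh σ) (w : ℝ) :
    Tendsto (fun t => upperKernel p g c x₀ xh σ t w) atTop (𝓝 (exp (-(w ^ 2 / 2)))) := by
  have h1 := (P.scale.tendsto_saddleExponent P.deriv_g w).neg.add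
    (P.q_lim.comp (P.scale.shift_top w))
  rw [add_zero] at h1
  refine ((continuous_exp.tendsto _).comp h1).congr' ?_
  filter_upwards [(P.scale.shift_top w).eventually_ge_atTop x₀] with t hw
  rw [upperKernel, indicator_of_mem (show w ∈ {w | x₀ ≤ xh t + σ t * w} from hw),
    P.kernel_eq hw]
  rfl

theorem integrable_pow_mul_kernel (P : LaplaceSetup p g q h c x₀ xh σ) {t : ℝ} (hσ : 0 < σ t)
    {k : ℕ} (hk : k ≤ 4) : Integrable fun w => w ^ k * saddleKernel p g c xh σ t w := by
  have key : ∀ F : ℝ → ℝ, Integrable (fun x => F ((x - xh t) / σ t) * (exp (t * x) * p x)) →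
      Integrable fun w => F w * saddleKernel p g c xh σ t w := fun F hF => by
    have := (integrable_mul_affine (F := F) (f := fun x => exp (t * x) * p x) (xh t) hσ
      hF).const_mul (σ t * (c * exp (t * xh t - g (xh t))))⁻¹
    refine this.congr (ae_of_all _ fun w => ?_)
    have := P.c_pos
    simp only [saddleKernel]
    field_simp
  have i0 : Integrable fun w => saddleKernel p g c xh σ t w := by
    simpa using key (fun _ => 1) (by simpa using P.dens.int_exp t)
  refine integrable_pow_mul_of_integrable_four (P.kernel_nonneg t) i0 (key (fun w => w ^ 4) ?_) hk
  have hb := (((P.dens.int_pow t 4).const_mul 8).add ((P.dens.int_exp t).const_mul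
    (8 * xh t ^ 4))).const_mul (σ t ^ 4)⁻¹
  refine hb.mono' ((by fun_prop : Continuous fun x : ℝ => ((x - xh t) / σ t) ^ 4)
    |>.aestronglyMeasurable.mul (P.dens.int_exp t).aestronglyMeasurable) (ae_of_all _ fun x => ?_)
  have hn : 0 ≤ exp (t * x) * p x := mul_nonneg (exp_pos _).le (P.dens.nonneg x)
  simp only [Pi.add_apply]
  rw [Real.norm_eq_abs, abs_of_nonneg (by positivity), div_pow, div_mul_eq_mul_div, div_eq_inv_mul]
  refine mul_le_mul_of_nonneg_left ?_ (by positivity)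
  have h4 : (x - xh t) ^ 4 ≤ 8 * x ^ 4 + 8 * xh t ^ 4 := by
    nlinarith [sq_nonneg (x + xh t), sq_nonneg (x - xh t), sq_nonneg (x ^ 2 - xh t ^ 2),
      sq_nonneg ((x + xh t) ^ 2), sq_nonneg ((x - xh t) * (x + xh t))]
  calc _ ≤ (8 * x ^ 4 + 8 * xh t ^ 4) * (exp (t * x) * p x) := mul_le_mul_of_nonneg_right h4 hn
    _ = _ := by ring

theorem integrable_kernel (P : LaplaceSetup p g q h c x₀ xh σ) {t : ℝ} (hσ : 0 < σ t) :
    Integrable (saddleKernel p g c xh σ t) := by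
  simpa using P.integrable_pow_mul_kernel hσ (k := 0) (by norm_num)

theorem integrable_pow_mul_upper (P : LaplaceSetup p g q h c x₀ xh σ) {t : ℝ} (hσ : 0 < σ t)
    {k : ℕ} (hk : k ≤ 4) : Integrable fun w => w ^ k * upperKernel p g c x₀ xh σ t w := by
  refine ((P.integrable_pow_mul_kernel hσ hk).indicator (measurableSet_upper x₀ xh σ t)).congr
    (ae_of_all _ fun w => ?_)
  exact indicator_mul_right _ (fun w => w ^ k) _

theorem integrable_pow_mul_lower (P : LaplaceSetup p g q h c x₀ xh σ) {t : ℝ} (hσ : 0 < σ t)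
    {k : ℕ} (hk : k ≤ 4) : Integrable fun w => w ^ k * lowerKernel p g c x₀ xh σ t w := by
  refine ((P.integrable_pow_mul_kernel hσ hk).indicator
    (measurableSet_upper x₀ xh σ t).compl).congr (ae_of_all _ fun w => ?_)
  exact indicator_mul_right _ (fun w => w ^ k) _

theorem tendsto_integral_upper_sub (P : LaplaceSetup p g q h c x₀ xh σ) (k : ℕ) :
    Tendsto (fun t => ∫ w, |w| ^ k * |upperKernel p g c x₀ xh σ t w - exp (-(w ^ 2 / 2))|)
      atTop (𝓝 0) := by
  have key := tendsto_integral_filter_of_dominated_convergence (μ := volume) (l := atTop)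
    (F := fun t w => |w| ^ k * |upperKernel p g c x₀ xh σ t w - exp (-(w ^ 2 / 2))|)
    (f := fun _ => 0)
    (fun w => exp 2 * (|w| ^ k * exp (-(1 / 4 * |w|))) + |w| ^ k * exp (-(w ^ 2 / 2)))
    ?_ ?_ (((integrable_abs_pow_mul_exp_neg_abs (by norm_num) k).const_mul _).add
      (integrable_abs_pow_mul_exp_neg_sq_half k)) ?_
  · simpa using key
  · filter_upwards [P.scale.σ_pos] with t ht
    have h1 : Integrable fun w => upperKernel p g c x₀ xh σ t w := by
      simpa using P.integrable_pow_mul_upper ht (k := 0) (by norm_num)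
    have h2 : Continuous fun w : ℝ => exp (-(w ^ 2 / 2)) := by fun_prop
    exact (by fun_prop : Continuous fun w : ℝ => |w| ^ k).aestronglyMeasurable.mul
      (h1.aestronglyMeasurable.sub h2.aestronglyMeasurable).norm
  · filter_upwards [P.upper_le] with t ht
    refine ae_of_all _ fun w => ?_
    rw [Real.norm_eq_abs, abs_of_nonneg (by positivity)]
    have h1 : |upperKernel p g c x₀ xh σ t w - exp (-(w ^ 2 / 2))| ≤
        exp 2 * exp (-(1 / 4 * |w|)) + exp (-(w ^ 2 / 2)) := by
      rw [abs_le]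
      have := P.upper_nonneg t w
      have := ht w
      have := exp_pos (-(w ^ 2 / 2))
      have : 0 < exp 2 * exp (-(1 / 4 * |w|)) := by positivity
      constructor <;> linarith
    calc _ ≤ |w| ^ k * (exp 2 * exp (-(1 / 4 * |w|)) + exp (-(w ^ 2 / 2))) :=
          mul_le_mul_of_nonneg_left h1 (by positivity)
      _ = _ := by ring
  · refine ae_of_all _ fun w => ?_
    have := ((P.tendsto_upper w).sub_const (exp (-(w ^ 2 / 2)))).abs.const_mul (|w| ^ k)
    simpa using this

end LaplaceSetup

theorem tendsto_pow_mul_exp_neg_div_eight (k : ℕ) :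
    Tendsto (fun y : ℝ => y ^ k * exp (-(y / 8))) atTop (𝓝 0) := by
  have h := ((tendsto_pow_mul_exp_neg_atTop_nhds_zero k).comp
    (tendsto_id.atTop_div_const (by norm_num : (0 : ℝ) < 8))).const_mul ((8 : ℝ) ^ k)
  rw [mul_zero] at h
  refine h.congr fun y => ?_
  simp only [Function.comp, id]
  rw [← mul_assoc, ← mul_pow, mul_div_cancel₀ y (by norm_num)]

namespace LaplaceSetup

variable {p g q h xh σ : ℝ → ℝ} {c x₀ : ℝ}

theorem lower_le (P : LaplaceSetup p g q h c x₀ xh σ) {t : ℝ} (ht : 0 ≤ t) (w : ℝ) :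
    lowerKernel p g c x₀ xh σ t w ≤
      c⁻¹ * exp (t * (x₀ - xh t) + g (xh t)) * p (xh t + σ t * w) := by
  have hp := P.dens.nonneg (xh t + σ t * w)
  have hc := P.c_pos
  by_cases hw : x₀ ≤ xh t + σ t * w
  · rw [lowerKernel, indicator_of_notMem
      (show w ∉ {w | x₀ ≤ xh t + σ t * w}ᶜ from fun h' => h' hw)]
    positivity
  · rw [lowerKernel, indicator_of_mem (show w ∈ {w | x₀ ≤ xh t + σ t * w}ᶜ from hw), saddleKernel,
      div_le_iff₀ (by positivity)]
    have : c⁻¹ * exp (t * (x₀ - xh t) + g (xh t)) * p (xh t + σ t * w) *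
        (c * exp (t * xh t - g (xh t))) = exp (t * x₀) * p (xh t + σ t * w) := by
      rw [show t * x₀ = (t * (x₀ - xh t) + g (xh t)) + (t * xh t - g (xh t)) by ring,
        exp_add (t * (x₀ - xh t) + g (xh t))]
      field_simp
    rw [this]
    exact mul_le_mul_of_nonneg_right
      (exp_le_exp.2 (mul_le_mul_of_nonneg_left (not_le.1 hw).le ht)) hp

theorem integral_lower_le (P : LaplaceSetup p g q h c x₀ xh σ) :
    ∀ᶠ t in atTop, ∫ w, lowerKernel p g c x₀ xh σ t w ≤
      c⁻¹ * exp (g x₀ + 1) * (xh t / σ t * exp (-(xh t / σ t / 8))) := by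
  filter_upwards [P.scale.σ_pos, P.scale.xh_top.eventually_ge_atTop 1,
    P.scale.xh_top.eventually_ge_atTop (2 * x₀), eventually_ge_atTop (0 : ℝ),
    P.scale.le_saddleExponent P.deriv_g] with t hσ h1 h2 ht hS
  have hc := P.c_pos
  have hpi : Integrable fun w => p (xh t + σ t * w) :=
    (P.dens.int.comp_add_left (xh t)).comp_mul_left' hσ.ne'
  have hle : ∫ w, lowerKernel p g c x₀ xh σ t w ≤
      ∫ w, c⁻¹ * exp (t * (x₀ - xh t) + g (xh t)) * p (xh t + σ t * w) := by
    refine integral_mono ?_ (hpi.const_mul _) fun w => P.lower_le ht w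
    simpa using P.integrable_pow_mul_lower hσ (k := 0) (by norm_num)
  rw [integral_const_mul, integral_comp_add_mul p _ hσ, P.dens.mass, mul_one] at hle
  have hw0 : xh t + σ t * ((x₀ - xh t) / σ t) = x₀ := by field_simp; ring
  have hS' := hS ((x₀ - xh t) / σ t) hw0.ge
  have hx0 := P.x₀_nonneg
  rw [saddleExponent, hw0, mul_div_cancel₀ _ hσ.ne', abs_of_nonpos
    (div_nonpos_of_nonpos_of_nonneg (by linarith) hσ.le)] at hS'
  have hy : xh t / σ t / 2 ≤ -((x₀ - xh t) / σ t) := by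
    rw [← neg_div, div_right_comm]
    exact div_le_div_of_nonneg_right (by linarith) hσ.le
  have he : exp (t * (x₀ - xh t) + g (xh t)) ≤ exp (g x₀ + 1) * exp (-(xh t / σ t / 8)) := by
    rw [← exp_add]
    exact exp_le_exp.2 (by linarith)
  have hσi : (σ t)⁻¹ ≤ xh t / σ t := by
    rw [div_eq_mul_inv]
    exact le_mul_of_one_le_left (inv_pos.2 hσ).le h1
  calc _ ≤ _ := hle
    _ ≤ c⁻¹ * (exp (g x₀ + 1) * exp (-(xh t / σ t / 8))) * (xh t / σ t) := by gcongr
    _ = _ := by ring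

theorem integral_lower_nonneg (P : LaplaceSetup p g q h c x₀ xh σ) (t : ℝ) :
    0 ≤ ∫ w, lowerKernel p g c x₀ xh σ t w :=
  integral_nonneg (P.lower_nonneg t)

theorem tendsto_ratio_pow_mul_integral_lower (P : LaplaceSetup p g q h c x₀ xh σ) (k : ℕ) :
    Tendsto (fun t => (xh t / σ t) ^ k * ∫ w, lowerKernel p g c x₀ xh σ t w) atTop (𝓝 0) := by
  have h := ((tendsto_pow_mul_exp_neg_div_eight (k + 1)).comp P.scale.ratio_top).const_mul
    (c⁻¹ * exp (g x₀ + 1))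
  rw [mul_zero] at h
  refine squeeze_zero' ?_ ?_ h
  · filter_upwards [P.scale.ratio_top.eventually_ge_atTop 0] with t ht
    exact mul_nonneg (pow_nonneg ht k) (P.integral_lower_nonneg t)
  · filter_upwards [P.scale.ratio_top.eventually_ge_atTop 0, P.integral_lower_le] with t ht hl
    calc _ ≤ _ := mul_le_mul_of_nonneg_left hl (pow_nonneg ht k)
      _ = _ := by simp only [Function.comp]; ring

theorem tendsto_mul_integral_lower (P : LaplaceSetup p g q h c x₀ xh σ) :
    Tendsto (fun t => t * σ t * ∫ w, lowerKernel p g c x₀ xh σ t w) atTop (𝓝 0) := by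
  refine squeeze_zero' ?_ ?_ (P.tendsto_ratio_pow_mul_integral_lower 2)
  · filter_upwards [P.scale.tσ_top.eventually_ge_atTop 0] with t ht
    exact mul_nonneg ht (P.integral_lower_nonneg t)
  · filter_upwards [P.scale.tσ_le] with t ht
    exact mul_le_mul_of_nonneg_right ht (P.integral_lower_nonneg t)

theorem abs_pow_mul_lower_le (P : LaplaceSetup p g q h c x₀ xh σ) {t : ℝ} (hσ : 0 < σ t)
    (hx : x₀ ≤ xh t) (k : ℕ) (w : ℝ) :
    |w| ^ k * lowerKernel p g c x₀ xh σ t w ≤ (xh t / σ t) ^ k * lowerKernel p g c x₀ xh σ t w := by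
  by_cases hw : x₀ ≤ xh t + σ t * w
  · rw [lowerKernel, indicator_of_notMem
      (show w ∉ {w | x₀ ≤ xh t + σ t * w}ᶜ from fun h' => h' hw), mul_zero, mul_zero]
  by_cases hw' : xh t + σ t * w < 0
  · rw [lowerKernel, indicator_of_mem (show w ∈ {w | x₀ ≤ xh t + σ t * w}ᶜ from hw), saddleKernel,
      P.dens.eq_zero _ hw']
    simp
  · refine mul_le_mul_of_nonneg_right (pow_le_pow_left₀ (abs_nonneg _) ?_ k) (P.lower_nonneg t w)
    have h1 : w ≤ 0 := by
      by_contra hw0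
      have := mul_pos hσ (not_le.1 hw0)
      linarith
    rw [abs_of_nonpos h1, le_div_iff₀ hσ]
    linarith

theorem tendsto_integral_pow_mul_lower (P : LaplaceSetup p g q h c x₀ xh σ) {k : ℕ} (hk : k ≤ 4) :
    Tendsto (fun t => ∫ w, |w| ^ k * lowerKernel p g c x₀ xh σ t w) atTop (𝓝 0) := by
  refine squeeze_zero' (Eventually.of_forall fun t => integral_nonneg fun w =>
    mul_nonneg (by positivity) (P.lower_nonneg t w)) ?_ (P.tendsto_ratio_pow_mul_integral_lower k)
  filter_upwards [P.scale.σ_pos, P.scale.xh_top.eventually_ge_atTop x₀] with t hσ hx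
  rw [← integral_const_mul]
  refine integral_mono ?_ (Integrable.const_mul ?_ _) fun w => P.abs_pow_mul_lower_le hσ hx k w
  · refine (P.integrable_pow_mul_lower hσ hk).norm.congr (ae_of_all _ fun w => ?_)
    simp only [norm_mul, norm_pow, Real.norm_eq_abs, abs_of_nonneg (P.lower_nonneg t w)]
  · simpa using P.integrable_pow_mul_lower hσ (k := 0) (by norm_num)

theorem tendsto_integral_kernel_sub (P : LaplaceSetup p g q h c x₀ xh σ) {k : ℕ} (hk : k ≤ 4) :
    Tendsto (fun t => ∫ w, |w| ^ k * |saddleKernel p g c xh σ t w - exp (-(w ^ 2 / 2))|)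
      atTop (𝓝 0) := by
  have h := (P.tendsto_integral_upper_sub k).add (P.tendsto_integral_pow_mul_lower hk)
  rw [add_zero] at h
  refine squeeze_zero' (Eventually.of_forall fun t => integral_nonneg fun w => by positivity) ?_ h
  filter_upwards [P.scale.σ_pos] with t hσ
  have iu : Integrable fun w => |w| ^ k * |upperKernel p g c x₀ xh σ t w - exp (-(w ^ 2 / 2))| := by
    refine ((P.integrable_pow_mul_upper hσ hk).sub
      (integrable_pow_mul_exp_neg_sq_half k)).norm.congr (ae_of_all _ fun w => ?_)
    simp only [Pi.sub_apply, ← mul_sub, norm_mul, norm_pow, Real.norm_eq_abs]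
  have il : Integrable fun w => |w| ^ k * lowerKernel p g c x₀ xh σ t w := by
    refine (P.integrable_pow_mul_lower hσ hk).norm.congr (ae_of_all _ fun w => ?_)
    simp only [norm_mul, norm_pow, Real.norm_eq_abs, abs_of_nonneg (P.lower_nonneg t w)]
  have ik : Integrable fun w => |w| ^ k * |saddleKernel p g c xh σ t w - exp (-(w ^ 2 / 2))| := by
    refine ((P.integrable_pow_mul_kernel hσ hk).sub
      (integrable_pow_mul_exp_neg_sq_half k)).norm.congr (ae_of_all _ fun w => ?_)
    simp only [Pi.sub_apply, ← mul_sub, norm_mul, norm_pow, Real.norm_eq_abs]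
  rw [← integral_add iu il]
  refine integral_mono ik (iu.add il) fun w => ?_
  rw [← mul_add]
  refine mul_le_mul_of_nonneg_left ?_ (by positivity)
  rw [← upper_add_lower p g c x₀ xh σ t w, add_sub_right_comm]
  exact (abs_add_le _ _).trans_eq (by rw [abs_of_nonneg (P.lower_nonneg t w)])

theorem tendsto_integral_pow_mul_kernel (P : LaplaceSetup p g q h c x₀ xh σ) {k : ℕ} (hk : k ≤ 4) :
    Tendsto (fun t => ∫ w, w ^ k * saddleKernel p g c xh σ t w) atTop
      (𝓝 (∫ w, w ^ k * exp (-(w ^ 2 / 2)))) := by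
  rw [tendsto_iff_norm_sub_tendsto_zero]
  refine squeeze_zero' (Eventually.of_forall fun t => norm_nonneg _) ?_
    (P.tendsto_integral_kernel_sub hk)
  filter_upwards [P.scale.σ_pos] with t hσ
  rw [← integral_sub (P.integrable_pow_mul_kernel hσ hk) (integrable_pow_mul_exp_neg_sq_half k)]
  refine (norm_integral_le_integral_norm _).trans_eq ?_
  congr 1; ext w
  rw [← mul_sub, norm_mul, norm_pow, Real.norm_eq_abs, Real.norm_eq_abs]

end LaplaceSetup

/-- `upperKernel`, normalised by the total mass of `saddleKernel`. -/
def upperDens (p g : ℝ → ℝ) (c x₀ : ℝ) (xh σ : ℝ → ℝ) (t w : ℝ) : ℝ :=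
  upperKernel p g c x₀ xh σ t w / ∫ w, saddleKernel p g c xh σ t w

/-- `lowerKernel`, normalised by the total mass of `saddleKernel`. -/
def lowerDens (p g : ℝ → ℝ) (c x₀ : ℝ) (xh σ : ℝ → ℝ) (t w : ℝ) : ℝ :=
  lowerKernel p g c x₀ xh σ t w / ∫ w, saddleKernel p g c xh σ t w

namespace LaplaceSetup

variable {p g q h xh σ : ℝ → ℝ} {c x₀ : ℝ}

theorem upperDens_add_lowerDens (p g : ℝ → ℝ) (c x₀ : ℝ) (xh σ : ℝ → ℝ) (t w : ℝ) :
    upperDens p g c x₀ xh σ t w + lowerDens p g c x₀ xh σ t w =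
      saddleKernel p g c xh σ t w / ∫ w, saddleKernel p g c xh σ t w := by
  rw [upperDens, lowerDens, ← add_div, upper_add_lower]

theorem integral_saddleKernel_mul (P : LaplaceSetup p g q h c x₀ xh σ) {t : ℝ} (hσ : 0 < σ t)
    (F : ℝ → ℝ) : ∫ w, F (xh t + σ t * w) * saddleKernel p g c xh σ t w =
      (∫ x, F x * (exp (t * x) * p x)) / (σ t * (c * exp (t * xh t - g (xh t)))) := by
  have hc := P.c_pos
  have := integral_comp_add_mul (fun x => F x * (exp (t * x) * p x)) (xh t) hσ
  simp only [saddleKernel, ← mul_div_assoc]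
  rw [integral_div, this]
  field_simp

theorem integral_saddleKernel (P : LaplaceSetup p g q h c x₀ xh σ) {t : ℝ} (hσ : 0 < σ t) :
    ∫ w, saddleKernel p g c xh σ t w =
      mgfFun p t / (σ t * (c * exp (t * xh t - g (xh t)))) := by
  simpa [P.dens.mgfFun_eq] using P.integral_saddleKernel_mul hσ fun _ => 1

theorem integral_saddleKernel_pos (P : LaplaceSetup p g q h c x₀ xh σ) {t : ℝ} (hσ : 0 < σ t) :
    0 < ∫ w, saddleKernel p g c xh σ t w := by
  have := P.c_pos
  have := P.dens.mgfFun_pos t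
  rw [P.integral_saddleKernel hσ]
  positivity

theorem integral_mul_dens (P : LaplaceSetup p g q h c x₀ xh σ) {t : ℝ} (hσ : 0 < σ t)
    (F : ℝ → ℝ) :
    ∫ w, F (xh t + σ t * w) * (upperDens p g c x₀ xh σ t w + lowerDens p g c x₀ xh σ t w) =
      (∫ x, F x * (exp (t * x) * p x)) / mgfFun p t := by
  simp only [upperDens_add_lowerDens, ← mul_div_assoc]
  rw [integral_div, P.integral_saddleKernel_mul hσ, P.integral_saddleKernel hσ,
    div_div_div_cancel_right₀]
  have := P.c_pos
  positivity

theorem integrable_pow_mul_dens (P : LaplaceSetup p g q h c x₀ xh σ) {t : ℝ} (hσ : 0 < σ t)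
    {k : ℕ} (hk : k ≤ 4) : Integrable fun w =>
      w ^ k * (upperDens p g c x₀ xh σ t w + lowerDens p g c x₀ xh σ t w) := by
  simp only [upperDens_add_lowerDens, ← mul_div_assoc]
  exact (P.integrable_pow_mul_kernel hσ hk).div_const _

theorem integral_dens (P : LaplaceSetup p g q h c x₀ xh σ) {t : ℝ} (hσ : 0 < σ t) :
    ∫ w, (upperDens p g c x₀ xh σ t w + lowerDens p g c x₀ xh σ t w) = 1 := by
  simp only [upperDens_add_lowerDens]
  rw [integral_div, div_self (P.integral_saddleKernel_pos hσ).ne']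

theorem mFun_eq (P : LaplaceSetup p g q h c x₀ xh σ) {t : ℝ} (hσ : 0 < σ t) :
    mFun p t = xh t + σ t *
      densMean fun w => upperDens p g c x₀ xh σ t w + lowerDens p g c x₀ xh σ t w := by
  have i0 := P.integrable_pow_mul_dens hσ (k := 0) (by norm_num)
  have i1 := P.integrable_pow_mul_dens hσ (k := 1) (by norm_num)
  simp only [pow_zero, pow_one, one_mul] at i0 i1
  rw [P.dens.mFun_eq, ← P.integral_mul_dens hσ fun x => x]
  simp only [add_mul, mul_assoc]
  rw [integral_add (i0.const_mul _) (i1.const_mul _), integral_const_mul, integral_const_mul,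
    P.integral_dens hσ, mul_one, densMean]

theorem s2Fun_eq (P : LaplaceSetup p g q h c x₀ xh σ) {t : ℝ} (hσ : 0 < σ t) :
    √(s2Fun p t) = σ t *
      densSd fun w => upperDens p g c x₀ xh σ t w + lowerDens p g c x₀ xh σ t w := by
  have i0 := P.integrable_pow_mul_dens hσ (k := 0) (by norm_num)
  have i1 := P.integrable_pow_mul_dens hσ (k := 1) (by norm_num)
  have i2 := P.integrable_pow_mul_dens hσ (k := 2) (by norm_num)
  simp only [pow_zero, pow_one, one_mul] at i0 i1
  have e : ∀ w, (xh t + σ t * w) ^ 2 *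
      (upperDens p g c x₀ xh σ t w + lowerDens p g c x₀ xh σ t w) =
      (xh t ^ 2 * (upperDens p g c x₀ xh σ t w + lowerDens p g c x₀ xh σ t w) +
      2 * xh t * σ t * (w * (upperDens p g c x₀ xh σ t w + lowerDens p g c x₀ xh σ t w))) +
      σ t ^ 2 * (w ^ 2 * (upperDens p g c x₀ xh σ t w + lowerDens p g c x₀ xh σ t w)) :=
    fun w => by ring
  rw [P.dens.s2Fun_eq, ← P.integral_mul_dens hσ fun x => x ^ 2, P.mFun_eq hσ]
  simp only [e]
  rw [integral_add ((i0.const_mul _).fun_add (i1.const_mul _)) (i2.const_mul _),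
    integral_add (i0.const_mul _) (i1.const_mul _), integral_const_mul, integral_const_mul,
    integral_const_mul, P.integral_dens hσ, densSd, ← sqrt_sq hσ.le, ← sqrt_mul (sq_nonneg _),
    sqrt_sq hσ.le]
  congr 1
  simp only [densMean]
  ring

theorem split_eq (P : LaplaceSetup p g q h c x₀ xh σ) {t : ℝ} (hσ : 0 < σ t) (e d z : ℝ) :
    d * upperDens p g c x₀ xh σ t (e + d * z) + d * lowerDens p g c x₀ xh σ t (e + d * z) =
      σ t * d * exp (t * (xh t + σ t * e)) / mgfFun p t * exp (t * (σ t * d) * z) *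
        p (xh t + σ t * e + σ t * d * z) := by
  have hc := P.c_pos
  have hΦ := P.dens.mgfFun_pos t
  rw [← mul_add, upperDens_add_lowerDens, P.integral_saddleKernel hσ, saddleKernel,
    show xh t + σ t * (e + d * z) = xh t + σ t * e + σ t * d * z by ring,
    show t * (xh t + σ t * e + σ t * d * z) = t * (xh t + σ t * e) + t * (σ t * d) * z by ring,
    exp_add]
  field_simp

end LaplaceSetup

/-- The third central moment of a density. -/
def densThird (f : ℝ → ℝ) : ℝ :=
  (∫ w, w ^ 3 * f w) - 3 * densMean f * (∫ w, w ^ 2 * f w) + 2 * densMean f ^ 3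

namespace LaplaceSetup

variable {p g q h xh σ : ℝ → ℝ} {c x₀ : ℝ}

theorem tendsto_integral_kernel (P : LaplaceSetup p g q h c x₀ xh σ) :
    Tendsto (fun t => ∫ w, saddleKernel p g c xh σ t w) atTop (𝓝 √(2 * π)) := by
  simpa [integral_exp_neg_sq_half] using P.tendsto_integral_pow_mul_kernel (k := 0) (by norm_num)

theorem tendsto_integral_pow_mul_dens (P : LaplaceSetup p g q h c x₀ xh σ) {k : ℕ} (hk : k ≤ 4) :
    Tendsto (fun t => ∫ w, w ^ k * (upperDens p g c x₀ xh σ t w + lowerDens p g c x₀ xh σ t w))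
      atTop (𝓝 ((∫ w, w ^ k * exp (-(w ^ 2 / 2))) / √(2 * π))) := by
  have h := (P.tendsto_integral_pow_mul_kernel hk).div P.tendsto_integral_kernel (by positivity)
  refine h.congr fun t => ?_
  simp only [upperDens_add_lowerDens, ← mul_div_assoc, Pi.div_apply]
  rw [integral_div]

theorem tendsto_densMean (P : LaplaceSetup p g q h c x₀ xh σ) :
    Tendsto (fun t => densMean fun w => upperDens p g c x₀ xh σ t w + lowerDens p g c x₀ xh σ t w)
      atTop (𝓝 0) := by
  simpa [integral_mul_exp_neg_sq_half, densMean] using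
    P.tendsto_integral_pow_mul_dens (k := 1) (by norm_num)

theorem tendsto_second (P : LaplaceSetup p g q h c x₀ xh σ) :
    Tendsto (fun t => ∫ w, w ^ 2 * (upperDens p g c x₀ xh σ t w + lowerDens p g c x₀ xh σ t w))
      atTop (𝓝 1) := by
  have h := P.tendsto_integral_pow_mul_dens (k := 2) (by norm_num)
  have e := integral_pow_mul_exp_neg_sq_half 0
  simp only [zero_add, pow_zero, one_mul, integral_exp_neg_sq_half, Nat.cast_zero] at e
  rwa [e, div_self (by positivity)] at h

theorem tendsto_fourth (P : LaplaceSetup p g q h c x₀ xh σ) :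
    Tendsto (fun t => ∫ w, w ^ 4 * (upperDens p g c x₀ xh σ t w + lowerDens p g c x₀ xh σ t w))
      atTop (𝓝 3) := by
  have h := P.tendsto_integral_pow_mul_dens (k := 4) (by norm_num)
  have e := integral_pow_mul_exp_neg_sq_half 0
  have e' := integral_pow_mul_exp_neg_sq_half 2
  simp only [zero_add, pow_zero, one_mul, integral_exp_neg_sq_half, Nat.cast_zero] at e
  norm_num at e'
  rw [e', e, mul_div_cancel_right₀ _ (by positivity)] at h
  exact h

theorem tendsto_densSd (P : LaplaceSetup p g q h c x₀ xh σ) :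
    Tendsto (fun t => densSd fun w => upperDens p g c x₀ xh σ t w + lowerDens p g c x₀ xh σ t w)
      atTop (𝓝 1) := by
  have h := (P.tendsto_second.sub (P.tendsto_densMean.pow 2)).sqrt
  simpa [densSd] using h

theorem tendsto_densThird (P : LaplaceSetup p g q h c x₀ xh σ) :
    Tendsto (fun t =>
      densThird fun w => upperDens p g c x₀ xh σ t w + lowerDens p g c x₀ xh σ t w)
      atTop (𝓝 0) := by
  have h3 := P.tendsto_integral_pow_mul_dens (k := 3) (by norm_num)
  have e := integral_pow_mul_exp_neg_sq_half 1
  norm_num [integral_mul_exp_neg_sq_half] at e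
  rw [e, zero_div] at h3
  have h := (h3.sub ((P.tendsto_densMean.const_mul 3).mul P.tendsto_second)).add
    ((P.tendsto_densMean.pow 3).const_mul 2)
  simpa [densThird] using h

theorem integral_lowerDens (p g : ℝ → ℝ) (c x₀ : ℝ) (xh σ : ℝ → ℝ) (t : ℝ) :
    ∫ w, lowerDens p g c x₀ xh σ t w =
      (∫ w, lowerKernel p g c x₀ xh σ t w) / ∫ w, saddleKernel p g c xh σ t w :=
  integral_div _ _

theorem tendsto_integral_lowerDens (P : LaplaceSetup p g q h c x₀ xh σ) :
    Tendsto (fun t => ∫ w, lowerDens p g c x₀ xh σ t w) atTop (𝓝 0) := by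
  have h := (P.tendsto_integral_pow_mul_lower (k := 0) (by norm_num)).div
    P.tendsto_integral_kernel (by positivity)
  rw [zero_div] at h
  refine h.congr fun t => ?_
  rw [integral_lowerDens]
  simp

theorem tendsto_mul_integral_lowerDens (P : LaplaceSetup p g q h c x₀ xh σ) :
    Tendsto (fun t => t * σ t * ∫ w, lowerDens p g c x₀ xh σ t w) atTop (𝓝 0) := by
  have h := P.tendsto_mul_integral_lower.div P.tendsto_integral_kernel (by positivity)
  rw [zero_div] at h
  refine h.congr fun t => ?_
  rw [integral_lowerDens, ← mul_div_assoc, Pi.div_apply]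

theorem tendsto_integral_abs_dens_sub (P : LaplaceSetup p g q h c x₀ xh σ) :
    Tendsto (fun t => ∫ w,
      |upperDens p g c x₀ xh σ t w + lowerDens p g c x₀ xh σ t w - stdGauss w|) atTop (𝓝 0) := by
  have hs : 0 < √(2 * π) := by positivity
  have hK := P.tendsto_integral_kernel
  have h1 := (P.tendsto_integral_kernel_sub (k := 0) (by norm_num)).div hK hs.ne'
  have h2 := ((hK.inv₀ hs.ne').sub_const (√(2 * π))⁻¹).abs.mul_const (√(2 * π))
  have h := h1.add h2
  simp only [sub_self, abs_zero, zero_mul, zero_div, add_zero, pow_zero, one_mul] at h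
  refine squeeze_zero' (Eventually.of_forall fun t => integral_nonneg fun w => abs_nonneg _) ?_ h
  filter_upwards [P.scale.σ_pos] with t hσ
  have hI := P.integral_saddleKernel_pos hσ
  set I := ∫ w, saddleKernel p g c xh σ t w with hIdef
  have ik := P.integrable_kernel hσ
  have ie : Integrable fun w : ℝ => exp (-(w ^ 2 / 2)) := by
    simpa using integrable_pow_mul_exp_neg_sq_half 0
  have ia := ((ik.sub ie).abs).div_const I
  have ib := ie.const_mul |I⁻¹ - (√(2 * π))⁻¹|
  have hr : (∫ w, |saddleKernel p g c xh σ t w - exp (-(w ^ 2 / 2))|) / I +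
      |I⁻¹ - (√(2 * π))⁻¹| * √(2 * π) =
      ∫ w, (|saddleKernel p g c xh σ t w - exp (-(w ^ 2 / 2))| / I +
        |I⁻¹ - (√(2 * π))⁻¹| * exp (-(w ^ 2 / 2))) := by
    rw [← integral_div, ← integral_exp_neg_sq_half, ← integral_const_mul, integral_exp_neg_sq_half]
    exact (integral_add ia ib).symm
  simp only [Pi.div_apply]
  rw [hr]
  refine integral_mono ?_ (ia.add ib) fun w => ?_
  · simp only [upperDens_add_lowerDens]
    exact ((ik.div_const _).sub integrable_stdGauss).abs
  · simp only [upperDens_add_lowerDens, ← hIdef]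
    have : saddleKernel p g c xh σ t w / I - stdGauss w =
        (saddleKernel p g c xh σ t w - exp (-(w ^ 2 / 2))) / I +
          (I⁻¹ - (√(2 * π))⁻¹) * exp (-(w ^ 2 / 2)) := by
      rw [stdGauss]; ring
    rw [this]
    refine (abs_add_le _ _).trans_eq ?_
    rw [abs_div, abs_of_pos hI, abs_mul, abs_exp]

theorem eventually_isStdSplit (P : LaplaceSetup p g q h c x₀ xh σ) :
    ∀ᶠ t in atTop, ∀ e d,
      e = densMean (fun w => upperDens p g c x₀ xh σ t w + lowerDens p g c x₀ xh σ t w) →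
      d = densSd (fun w => upperDens p g c x₀ xh σ t w + lowerDens p g c x₀ xh σ t w) →
      IsStdSplit (fun z => d * upperDens p g c x₀ xh σ t (e + d * z))
        (fun z => d * lowerDens p g c x₀ xh σ t (e + d * z)) 30
        (2 * |densThird fun w => upperDens p g c x₀ xh σ t w + lowerDens p g c x₀ xh σ t w|)
        (∫ w, lowerDens p g c x₀ xh σ t w) (2 * exp 2) ((1 + exp (-(1 / 8192))) / 2) (1 / 32) := by
  have hm := P.tendsto_densMean.abs
  have h3 := P.tendsto_densThird.abs
  rw [abs_zero] at hm h3
  have hs : 1 < √(2 * π) := by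
    rw [Real.lt_sqrt (by norm_num)]
    linarith [pi_gt_three]
  have hρ : exp (-(1 / 8192 : ℝ)) < 1 := exp_lt_one_iff.2 (by norm_num)
  filter_upwards [P.scale.σ_pos, hm.eventually_le_const (by norm_num : (0 : ℝ) < 1 / 8),
    P.tendsto_densSd.eventually_const_le (by norm_num : (99 / 100 : ℝ) < 1),
    P.tendsto_densSd.eventually_le_const (by norm_num : (1 : ℝ) < 2),
    P.tendsto_fourth.eventually_le_const (by norm_num : (3 : ℝ) < 16 / 5),
    h3.eventually_le_const (by norm_num : (0 : ℝ) < 1 / 2),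
    P.tendsto_integral_lowerDens.eventually_le_const (zero_lt_one' ℝ),
    P.tendsto_integral_abs_dens_sub.eventually_le_const
      (by linarith : (0 : ℝ) < (1 - exp (-(1 / 8192))) / 2),
    P.upper_le, P.tendsto_integral_kernel.eventually_const_le hs]
    with t hσ a1 a2 a3 a4 a5 a6 a7 a8 a9
  rintro e d rfl rfl
  have iu : Integrable (upperDens p g c x₀ xh σ t) := by
    have := (P.integrable_pow_mul_upper hσ (k := 0) (by norm_num)).div_const
      (∫ w, saddleKernel p g c xh σ t w)
    simp only [pow_zero, one_mul] at this
    exact this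
  have il : Integrable (lowerDens p g c x₀ xh σ t) := by
    have := (P.integrable_pow_mul_lower hσ (k := 0) (by norm_num)).div_const
      (∫ w, saddleKernel p g c xh σ t w)
    simp only [pow_zero, one_mul] at this
    exact this
  have hI := P.integral_saddleKernel_pos hσ
  refine isStdSplit_of_close (fun w => div_nonneg (P.upper_nonneg t w) hI.le)
    (fun w => div_nonneg (P.lower_nonneg t w) hI.le) iu il
    (P.integrable_pow_mul_dens hσ le_rfl) (P.integral_dens hσ) (fun w => ?_) a1 a2 a3 a4 le_rfl
    (by simp only [densThird] at a5 ⊢; linarith) a6 a7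
  rw [upperDens, div_le_iff₀ hI]
  calc _ ≤ exp 2 * exp (-(1 / 4 * |w|)) := a8 w
    _ ≤ exp 2 * 1 := by
      refine mul_le_mul_of_nonneg_left (exp_le_one_iff.2 ?_) (exp_pos _).le
      have := abs_nonneg w
      linarith
    _ ≤ _ := mul_le_mul_of_nonneg_left a9 (exp_pos _).le

end LaplaceSetup

/-- The leading term of `P(Sₙ ≥ n m(t))`. -/
def tailPrefactor (p : ℝ → ℝ) (n : ℕ) (t : ℝ) : ℝ :=
  exp (-((n : ℝ) * (mFun p t * t - log (mgfFun p t)))) / (√(2 * π) * √n * t * √(s2Fun p t))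

namespace LaplaceSetup

variable {p g q h xh σ : ℝ → ℝ} {c x₀ : ℝ}

theorem setIntegral_convPow_div_tailPrefactor (P : LaplaceSetup p g q h c x₀ xh σ) {t : ℝ}
    (hσ : 0 < σ t) {e d : ℝ} (hd : 0 < d)
    (he : e = densMean fun w => upperDens p g c x₀ xh σ t w + lowerDens p g c x₀ xh σ t w)
    (hd' : d = densSd fun w => upperDens p g c x₀ xh σ t w + lowerDens p g c x₀ xh σ t w)
    (k : ℕ) :
    (∫ v in Ici (((k + 2 : ℕ) : ℝ) * mFun p t), convPow p (k + 2) v) /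
        tailPrefactor p (k + 2) t =
      (∫ z in Ici (0 : ℝ), exp (-(t * (σ t * d) * z)) * convPow (fun z =>
        d * upperDens p g c x₀ xh σ t (e + d * z) + d * lowerDens p g c x₀ xh σ t (e + d * z))
        (k + 2) z) * (√(2 * π * (k + 2)) * (t * (σ t * d))) := by
  have key := setIntegral_convPow_eq (mul_pos hσ hd) (P.dens.mgfFun_pos t)
    (fun z => P.split_eq hσ e d z) (k + 1)
  rw [he, ← P.mFun_eq hσ, ← he] at key
  have hcast : ((k + 1 : ℕ) : ℝ) + 1 = ((k + 2 : ℕ) : ℝ) := by push_cast; ring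
  rw [hcast] at key
  have hcast' : ((k + 2 : ℕ) : ℝ) = (k : ℝ) + 2 := by push_cast; ring
  rw [key, tailPrefactor, P.s2Fun_eq hσ, ← hd', div_div_eq_mul_div,
    mul_right_comm, mul_assoc, mul_div_cancel_left₀ _ (exp_ne_zero _), mul_comm,
    sqrt_mul (by positivity : 0 ≤ 2 * π) ((k : ℝ) + 2), hcast', mul_assoc _ t]

theorem tendsto_sqrt_mul_tail_error (P : LaplaceSetup p g q h c x₀ xh σ) {u : ℕ → ℝ}
    (hu : Tendsto u atTop atTop) :
    Tendsto (fun n : ℕ => √n * ((∫ v in Ici ((n : ℝ) * mFun p (u n)), convPow p n v) /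
      tailPrefactor p n (u n) - 1)) atTop (𝓝 0) := by
  rw [← tendsto_add_atTop_iff_nat 2]
  have hv : Tendsto (fun k => u (k + 2)) atTop atTop := (tendsto_add_atTop_iff_nat 2).2 hu
  set d : ℝ → ℝ := fun t =>
    densSd fun w => upperDens p g c x₀ xh σ t w + lowerDens p g c x₀ xh σ t w
  have hdlim : Tendsto d atTop (𝓝 1) := P.tendsto_densSd
  have hΛ : Tendsto (fun t => t * (σ t * d t)) atTop atTop :=
    (P.scale.tσ_top.atTop_mul_pos one_pos hdlim).congr fun t => by ring
  have hΛδ : Tendsto (fun t => t * (σ t * d t) * ∫ w, lowerDens p g c x₀ xh σ t w) atTop (𝓝 0) := by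
    have := hdlim.mul P.tendsto_mul_integral_lowerDens
    rw [mul_zero] at this
    exact this.congr fun t => by ring
  have hκ := P.tendsto_densThird.abs.const_mul 2
  rw [abs_zero, mul_zero] at hκ
  have hδ0 : ∀ᶠ t in atTop, 0 ≤ ∫ w, lowerDens p g c x₀ xh σ t w := by
    filter_upwards [P.scale.σ_pos] with t hσ
    exact integral_nonneg fun w =>
      div_nonneg (P.lower_nonneg t w) (P.integral_saddleKernel_pos hσ).le
  have hρ : exp (-(1 / 8192 : ℝ)) < 1 := exp_lt_one_iff.2 (by norm_num)
  have herr := tendsto_tail_err (C := 30) (M := 2 * exp 2) (ρ := (1 + exp (-(1 / 8192))) / 2)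
    (ε := 1 / 32) (by positivity) (by linarith) (by norm_num) (hκ.comp hv)
    (P.tendsto_integral_lowerDens.comp hv) (hv.eventually hδ0) (hΛ.comp hv) (hΛδ.comp hv)
  refine squeeze_zero_norm' ?_ herr
  filter_upwards [hv.eventually P.eventually_isStdSplit, hv.eventually P.scale.σ_pos,
    hv.eventually_gt_atTop 0, hv.eventually (hdlim.eventually (lt_mem_nhds one_pos))]
    with k hk hσ ht hdpos
  rw [P.setIntegral_convPow_div_tailPrefactor hσ hdpos rfl rfl k, norm_mul, Real.norm_eq_abs,
    Real.norm_eq_abs, abs_of_nonneg (sqrt_nonneg _)]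
  push_cast
  refine mul_le_mul_of_nonneg_left ?_ (sqrt_nonneg _)
  exact (hk _ _ rfl rfl).abs_laplace_tail_sub_one_le (by positivity) k (by positivity)

theorem exists_tail_expansion (P : LaplaceSetup p g q h c x₀ xh σ) {u : ℕ → ℝ}
    (hu : Tendsto u atTop atTop) :
    ∃ E : ℕ → ℝ, Tendsto (fun n : ℕ => √n * E n) atTop (𝓝 0) ∧
      ∀ᶠ n : ℕ in atTop, (∫ v in Ici ((n : ℝ) * mFun p (u n)), convPow p n v) =
        tailPrefactor p n (u n) * (1 + E n) := by
  refine ⟨_, P.tendsto_sqrt_mul_tail_error hu, ?_⟩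
  filter_upwards [hu.eventually P.scale.σ_pos, hu.eventually_gt_atTop 0,
    hu.eventually (P.tendsto_densSd.eventually (lt_mem_nhds one_pos)), eventually_gt_atTop 0]
    with n hσ ht hd hn
  have hne : tailPrefactor p n (u n) ≠ 0 := by
    rw [tailPrefactor, P.s2Fun_eq hσ]
    have : (0 : ℝ) < n := Nat.cast_pos.2 hn
    positivity
  rw [add_sub_cancel, mul_div_cancel₀ _ hne]

end LaplaceSetup

theorem isExpDensity_of_form {p g q : ℝ → ℝ} {c : ℝ} (hc : 0 < c)
    (hpdef : ∀ x ≥ (0:ℝ), p x = c * exp (-(g x - q x))) (hpzero : ∀ x < (0:ℝ), p x = 0)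
    (hpdens : (∫ x in Ici (0:ℝ), p x) = 1)
    (hPhi : ∀ t > (0:ℝ), IntegrableOn (fun x => exp (t * x) * p x) (Ici 0)) :
    IsExpDensity p := by
  have hint : Integrable p := by
    refine (integrableOn_iff_integrable_of_support_subset fun x hx => ?_).1
      (not_imp_comm.1 integral_undef (by rw [hpdens]; exact one_ne_zero) :
        IntegrableOn p (Ici 0))
    by_contra hneg
    exact hx (hpzero x (not_le.1 hneg))
  refine ⟨fun x => ?_, hpzero, hint, ?_, integrable_exp_mul_dens hpzero hint hPhi⟩
  · rcases lt_or_ge x 0 with hx | hx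
    · rw [hpzero x hx]
    · rw [hpdef x hx]
      positivity
  · have := setIntegral_Ici_zero_eq hpzero fun _ => 1
    simp only [one_mul] at this
    rw [← this, hpdens]

theorem tendsto_perturbation {q h : ℝ → ℝ} (hh : Tendsto h atTop atTop)
    (hq : ∃ ϑ > (0:ℝ), ∀ᶠ x in atTop, ∀ v, |v - x| < ϑ * x → |q v| ≤ 1 / √(x * h x)) :
    Tendsto q atTop (𝓝 0) := by
  obtain ⟨ϑ, hϑ, hq⟩ := hq
  have hlim : Tendsto (fun x => 1 / √(x * h x)) atTop (𝓝 0) :=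
    tendsto_const_nhds.div_atTop (tendsto_sqrt_atTop.comp (tendsto_id.atTop_mul_atTop₀ hh))
  refine squeeze_zero_norm' ?_ hlim
  filter_upwards [hq, eventually_gt_atTop 0] with x hx h0
  exact hx x (by rw [sub_self, abs_zero]; positivity)

theorem exists_laplaceSetup {p g q h : ℝ → ℝ} {c : ℝ} (hc : 0 < c) (hp : IsExpDensity p)
    (hpdef : ∀ x ≥ (0:ℝ), p x = c * exp (-(g x - q x)))
    (hg : ∀ x, HasDerivAt g (h x) x) (hmem : MemFrakR h)
    (hq : ∃ ϑ > (0:ℝ), ∀ᶠ x in atTop, ∀ v, |v - x| < ϑ * x → |q v| ≤ 1 / √(x * h x)) :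
    ∃ x₀ xh σ, LaplaceSetup p g q h c x₀ xh σ := by
  obtain ⟨x₀, xh, σ, S⟩ := hmem.exists_isSaddleScale
  have hq0 := tendsto_perturbation S.h_top hq
  obtain ⟨x₁, hx₁⟩ := eventually_atTop.1 (hq0.abs.eventually_le_const
    (by rw [abs_zero]; exact zero_lt_one' ℝ))
  exact ⟨max x₀ (max 0 x₁), xh, σ, hp, S.mono_left (le_max_left _ _), hg, hc,
    (le_max_left _ _).trans (le_max_right _ _), hpdef,
    fun x hx => hx₁ x (((le_max_right _ _).trans (le_max_right _ _)).trans hx), hq0⟩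

/-- **tail probability estimate.** If `aₙ → ∞`, `tₙ = m⁻¹(aₙ)` and
`ψ(tₙ)²/(√n ψ'(tₙ)) → 0`, then
`P(Sₙ ≥ n aₙ) = (exp(-n I(aₙ))/(√(2π) √n tₙ s(tₙ))) (1 + o(1/√n))`,
where `I(aₙ) = aₙ tₙ - log Φ(tₙ)`. -/
theorem tail_probability_asymptotic
    (p g q h : ℝ → ℝ) (c : ℝ) (hc : 0 < c)
    (hpdef : ∀ x ≥ (0:ℝ), p x = c * Real.exp (-(g x - q x)))
    (hpzero : ∀ x < (0:ℝ), p x = 0)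
    (hpdens : (∫ x in Set.Ici (0:ℝ), p x) = 1)
    (hgpos : ∀ x ≥ (0:ℝ), 0 < g x)
    (hglim : Tendsto (fun x => g x / x) atTop atTop)
    (hgderiv : ∀ x, HasDerivAt g (h x) x)
    (hq : ∃ ϑ > (0:ℝ), ∀ᶠ x in atTop, ∀ v, |v - x| < ϑ * x → |q v| ≤ 1 / Real.sqrt (x * h x))
    (hmem : MemFrakR h)
    (hPhi : ∀ t > (0:ℝ), IntegrableOn (fun x => Real.exp (t * x) * p x) (Set.Ici 0))
    (a tseq : ℕ → ℝ) (ha : Tendsto a atTop atTop)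
    (htm : ∀ n, mFun p (tseq n) = a n)
    (hgrowth : Tendsto
      (fun n : ℕ => geninv h (tseq n) ^ 2 / (Real.sqrt n * deriv (geninv h) (tseq n)))
      atTop (𝓝 0)) :
    ∃ E : ℕ → ℝ, Tendsto (fun n : ℕ => Real.sqrt n * E n) atTop (𝓝 0) ∧
      ∀ᶠ n : ℕ in atTop,
        (∫ v in Set.Ici ((n : ℝ) * a n), convPow p n v) =
          Real.exp (-((n : ℝ) * (a n * tseq n - Real.log (mgfFun p (tseq n))))) /
              (Real.sqrt (2 * Real.pi) * Real.sqrt n * tseq n * Real.sqrt (s2Fun p (tseq n))) *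
            (1 + E n) := by
  have hp := isExpDensity_of_form hc hpdef hpzero hpdens hPhi
  obtain ⟨x₀, xh, σ, P⟩ := exists_laplaceSetup hc hp hpdef hgderiv hmem hq
  obtain ⟨E, hE, hE'⟩ := P.exists_tail_expansion (hp.tendsto_of_mFun_eq ha htm)
  simp only [tailPrefactor, htm] at hE'
  exact ⟨E, hE, hE'⟩
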